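/- Let F ∈ ℤ[t] be an irreducible polynomial of degree g ≥ 2, and let 0 < δ < 1 and C > 0 be real constants. There exist constants D ≥ 2, y₀ and c > 0, depending only on F, δ and C, such that for all reals x, y, z with y ≥ y₀, y < z ≤ x^{1−δ/2} and, writing η = log(z/y), (log y)^{−C} ≤ η ≤ log y: H_F(x, y, z) − H_F(x/2, y, z) ≥ c · (x/(log y)²) · ∑_{a ∈ 𝒫(D, z)} L(a; η) ρ(a)/a. -/

import Mathlib

open Real MeasureTheory
open scoped Classical

/-- number of residues n mod d with F(n) ≡ 0 (mod d) -/
noncomputable def polyRho (F : Polynomial ℤ) (d : ℕ) : ℕ :=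
  ((Finset.range d).filter (fun n => (d : ℤ) ∣ F.eval (n : ℤ))).card

/-- H_F(x,y,z): number of positive n ≤ x with F(n) having a divisor in (y,z] -/
noncomputable def polyH (F : Polynomial ℤ) (x y z : ℝ) : ℕ :=
  {n : ℕ | 0 < n ∧ (n : ℝ) ≤ x ∧
    ∃ d : ℕ, 0 < d ∧ (d : ℤ) ∣ F.eval (n : ℤ) ∧ y < (d : ℝ) ∧ (d : ℝ) ≤ z}.ncard

/-- H(x,y,z): number of positive n ≤ x having a divisor in (y,z] -/
noncomputable def Hdiv (x y z : ℝ) : ℕ :=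
  {n : ℕ | 0 < n ∧ (n : ℝ) ≤ x ∧
    ∃ d : ℕ, 0 < d ∧ d ∣ n ∧ y < (d : ℝ) ∧ (d : ℝ) ≤ z}.ncard

/-- L(a;σ) -/
noncomputable def Lfun (a : ℕ) (σ : ℝ) : ℝ :=
  (volume {x : ℝ | ∃ d : ℕ, d ∣ a ∧ Real.exp x < (d : ℝ) ∧ (d : ℝ) ≤ Real.exp (x + σ)}).toReal

/-- W(a;σ): ordered pairs of divisors near each other -/
noncomputable def Wfun (a : ℕ) (σ : ℝ) : ℕ :=
  {p : ℕ × ℕ | p.1 ∣ a ∧ p.2 ∣ a ∧ |Real.log ((p.1 : ℝ) / (p.2 : ℝ))| ≤ σ}.ncard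

/-- 𝒫(s,t): squarefree integers with all prime factors in (s,t] -/
def Psf (s t : ℝ) : Set ℕ :=
  {a : ℕ | 0 < a ∧ Squarefree a ∧ ∀ p : ℕ, p.Prime → p ∣ a → s < (p : ℝ) ∧ (p : ℝ) ≤ t}

/-- φ_F(n) = n ∏_{p|n} (1 - ρ(p)/p) -/
noncomputable def polyPhi (F : Polynomial ℤ) (n : ℕ) : ℝ :=
  (n : ℝ) * ∏ p ∈ n.primeFactors, (1 - (polyRho F p : ℝ) / p)

/-- P⁺(n): largest prime factor, P⁺(1)=0 -/
def Pplus (n : ℕ) : ℕ := n.primeFactors.sup id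

/-- h(n;X): least prime q with ∏_{p^ν ∥ n, p ≤ q} p^ν > √X -/
noncomputable def hfun (n : ℕ) (X : ℝ) : ℕ :=
  sInf {q : ℕ | q.Prime ∧
    Real.sqrt X < ∏ p ∈ n.primeFactors.filter (fun p => p ≤ q), (p : ℝ) ^ (n.factorization p)}

/-- the primes `p` with `D < p ≤ v` -/
def prs (D v : ℕ) : Finset ℕ := (Finset.Ioc D v).filter Nat.Prime

theorem mem_prs {D v p : ℕ} : p ∈ prs D v ↔ (D < p ∧ p ≤ v) ∧ p.Prime := by
  simp [prs]

theorem prs_union {D w v : ℕ} (h1 : D ≤ w) (h2 : w ≤ v) : prs D w ∪ prs w v = prs D v := by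
  ext p; simp only [Finset.mem_union, mem_prs]
  constructor
  · rintro (h | h) <;> exact ⟨⟨by omega, by omega⟩, h.2⟩
  · intro h
    by_cases hp : p ≤ w
    · exact Or.inl ⟨⟨h.1.1, hp⟩, h.2⟩
    · exact Or.inr ⟨⟨by omega, h.1.2⟩, h.2⟩

theorem prs_disjoint {D w v : ℕ} : Disjoint (prs D w) (prs w v) := by
  rw [Finset.disjoint_left]; intro p h1 h2
  rw [mem_prs] at h1 h2; omega

theorem sum_log_div_prs_zero (n : ℕ) (hn : 1 ≤ n) :
    ∑ p ∈ prs 0 n, Real.log p / p ≤ Real.log n + Real.log 4 := by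
  have hn0 : (0 : ℝ) < n := by exact_mod_cast hn
  have hdvd : (∏ p ∈ prs 0 n, p ^ (n / p)) ∣ n.factorial := by
    apply Finset.prod_dvd_of_isRelPrime
    · intro p hp q hq hpq
      rw [Finset.mem_coe, mem_prs] at hp hq
      exact Nat.coprime_iff_isRelPrime.1 (Nat.Coprime.pow _ _ ((Nat.coprime_primes hp.2 hq.2).2 hpq))
    · intro p hp
      rw [mem_prs] at hp
      rw [hp.2.pow_dvd_factorial_iff (b := Nat.log p n + 2) (by omega)]
      have : n / p = n / p ^ 1 := by simp
      rw [this]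
      exact Finset.single_le_sum (f := fun i => n / p ^ i) (fun i _ => Nat.zero_le _)
        (by simp)
  have h1 : Real.log (∏ p ∈ prs 0 n, p ^ (n / p) : ℕ) ≤ Real.log (n.factorial : ℕ) := by
    apply Real.log_le_log
    · have : 0 < ∏ p ∈ prs 0 n, p ^ (n / p) :=
        Finset.prod_pos fun p hp => pow_pos (mem_prs.1 hp).2.pos _
      exact_mod_cast this
    · exact_mod_cast Nat.le_of_dvd (Nat.factorial_pos n) hdvd
  have h2 : Real.log (n.factorial : ℕ) ≤ n * Real.log n := by
    rw [← Real.log_pow]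
    apply Real.log_le_log (by exact_mod_cast Nat.factorial_pos n)
    exact_mod_cast Nat.factorial_le_pow n
  have h3 : Real.log (∏ p ∈ prs 0 n, p ^ (n / p) : ℕ)
      = ∑ p ∈ prs 0 n, ((n / p : ℕ) : ℝ) * Real.log p := by
    push_cast
    rw [Real.log_prod]
    · exact Finset.sum_congr rfl fun p _ => by rw [Real.log_pow]
    · intro p hp
      have := (mem_prs.1 hp).2.pos
      positivity
  have h4 : ∑ p ∈ prs 0 n, ((n : ℝ) * (Real.log p / p) - Real.log p) ≤
      ∑ p ∈ prs 0 n, ((n / p : ℕ) : ℝ) * Real.log p := by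
    apply Finset.sum_le_sum
    intro p hp
    have hp1 := (mem_prs.1 hp).2.one_le
    have hlog : 0 ≤ Real.log p := Real.log_nonneg (by exact_mod_cast hp1)
    have hfl : (n : ℝ) / p - 1 ≤ ((n / p : ℕ) : ℝ) := by
      have := Nat.lt_floor_add_one ((n : ℝ) / p)
      rw [Nat.floor_div_eq_div] at this
      linarith
    calc (n : ℝ) * (Real.log p / p) - Real.log p = ((n : ℝ) / p - 1) * Real.log p := by ring
      _ ≤ _ := mul_le_mul_of_nonneg_right hfl hlog
  have h5 : ∑ p ∈ prs 0 n, Real.log p ≤ Real.log 4 * n := by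
    have := Chebyshev.theta_le_log4_mul_x (x := n) hn0.le
    simpa [Chebyshev.theta, prs] using this
  rw [Finset.sum_sub_distrib, ← Finset.mul_sum] at h4
  have h6 : (n : ℝ) * ∑ p ∈ prs 0 n, Real.log p / p ≤ n * (Real.log n + Real.log 4) := by
    nlinarith
  exact le_of_mul_le_mul_left h6 hn0

theorem sum_log_div_prs (D n : ℕ) (hn : 1 ≤ n) :
    ∑ p ∈ prs D n, Real.log p / p ≤ Real.log n + Real.log 4 := by
  refine le_trans (Finset.sum_le_sum_of_subset_of_nonneg ?_ ?_) (sum_log_div_prs_zero n hn)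
  · intro p hp; rw [mem_prs] at *; exact ⟨⟨hp.2.pos, hp.1.2⟩, hp.2⟩
  · intro p hp _
    have := (mem_prs.1 hp).2.one_le
    have : 0 ≤ Real.log p := Real.log_nonneg (by exact_mod_cast this)
    positivity

/-- reciprocals of primes over `(w, v]`, where `log v ≤ A log w` -/
theorem sum_inv_prs (w v : ℕ) (A : ℝ) (hw : 1 ≤ w) (hv : 2 ≤ v)
    (h : Real.log v ≤ A * Real.log (w + 1 : ℕ)) :
    ∑ p ∈ prs w v, (1 : ℝ) / p ≤ 3 * A := by
  have hw1 : 0 < Real.log (w + 1 : ℕ) := Real.log_pos (by push_cast; have : (1:ℝ) ≤ w := by exact_mod_cast hw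
                                                          linarith)
  have hlv : Real.log 2 ≤ Real.log v := Real.log_le_log (by norm_num) (by exact_mod_cast hv)
  have h4 : Real.log 4 = 2 * Real.log 2 := by
    rw [show (4 : ℝ) = 2 ^ 2 by norm_num, Real.log_pow]; norm_num
  have hS := sum_log_div_prs w v (by omega)
  have h1 : Real.log (w + 1 : ℕ) * ∑ p ∈ prs w v, (1 : ℝ) / p ≤ ∑ p ∈ prs w v, Real.log p / p := by
    rw [Finset.mul_sum]
    apply Finset.sum_le_sum
    intro p hp
    rw [mem_prs] at hp
    rw [mul_one_div]
    gcongr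
    · exact_mod_cast hp.1.1
  have : Real.log (w + 1 : ℕ) * ∑ p ∈ prs w v, (1 : ℝ) / p ≤ Real.log (w + 1 : ℕ) * (3 * A) := by
    nlinarith
  exact le_of_mul_le_mul_left this hw1

theorem sum_powerset_union {A B : Finset ℕ} (h : Disjoint A B) (f g : Finset ℕ → ℝ) :
    ∑ S ∈ (A ∪ B).powerset, f (S ∩ A) * g (S ∩ B)
      = (∑ S ∈ A.powerset, f S) * ∑ T ∈ B.powerset, g T := by
  rw [Finset.sum_mul_sum, ← Finset.sum_product']
  refine Finset.sum_nbij' (fun S => (S ∩ A, S ∩ B)) (fun q => q.1 ∪ q.2) ?_ ?_ ?_ ?_ ?_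
  · intro S hS
    simp [Finset.inter_subset_right]
  · rintro ⟨S, T⟩ hq
    simp only [Finset.mem_product, Finset.mem_powerset] at hq ⊢
    exact Finset.union_subset_union hq.1 hq.2
  · intro S hS
    simp only [Finset.mem_powerset] at hS ⊢
    rw [← Finset.inter_union_distrib_left, Finset.inter_eq_left.2 hS]
  · rintro ⟨S, T⟩ hq
    simp only [Finset.mem_product, Finset.mem_powerset] at hq
    rw [Finset.disjoint_left] at h
    ext x
    · simp only [Finset.mem_inter, Finset.mem_union]
      constructor
      · rintro ⟨h1 | h1, h2⟩
        · exact h1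
        · exact absurd (hq.2 h1) (h h2)
      · intro h1; exact ⟨Or.inl h1, hq.1 h1⟩
    · simp only [Finset.mem_inter, Finset.mem_union]
      constructor
      · rintro ⟨h1 | h1, h2⟩
        · exact absurd h2 (h (hq.1 h1))
        · exact h1
      · intro h1; exact ⟨Or.inr h1, hq.2 h1⟩
  · intro S hS; rfl

theorem prod_inter_mul {A B S : Finset ℕ} (h : Disjoint A B) (hS : S ⊆ A ∪ B) {M : Type*}
    [CommMonoid M] (g : ℕ → M) :
    (∏ p ∈ S ∩ A, g p) * ∏ p ∈ S ∩ B, g p = ∏ p ∈ S, g p := by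
  rw [← Finset.prod_union, ← Finset.inter_union_distrib_left, Finset.inter_eq_left.2 hS]
  exact Finset.disjoint_of_subset_left Finset.inter_subset_right
    (Finset.disjoint_of_subset_right Finset.inter_subset_right h)

/-- truncated alternating sum -/
noncomputable def bonf (m : ℕ) (T : Finset ℕ) : ℝ := if T.card ≤ m then (-1) ^ T.card else 0

theorem bonf_sign (g : ℕ → ℝ) (B : Finset ℕ) (hg : ∀ p ∈ B, 0 ≤ g p ∧ g p ≤ 1) (m : ℕ) :
    0 ≤ (-1) ^ m * (∑ T ∈ B.powerset, bonf m T * ∏ p ∈ T, g p - ∏ p ∈ B, (1 - g p)) := by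
  induction B using Finset.induction_on generalizing m with
  | empty => simp [bonf]
  | insert p B hp ih =>
    have hB : ∀ q ∈ B, 0 ≤ g q ∧ g q ≤ 1 := fun q hq => hg q (Finset.mem_insert_of_mem hq)
    have hgp := hg p (Finset.mem_insert_self _ _)
    rw [Finset.sum_powerset_insert hp, Finset.prod_insert hp]
    have key : ∑ T ∈ B.powerset, bonf m (insert p T) * ∏ q ∈ insert p T, g q
        = - g p * ∑ T ∈ B.powerset, (if m = 0 then 0 else bonf (m - 1) T) * ∏ q ∈ T, g q := by
      rw [Finset.mul_sum]
      apply Finset.sum_congr rfl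
      intro T hT
      have hpT : p ∉ T := fun h => hp (Finset.mem_powerset.1 hT h)
      rw [Finset.prod_insert hpT]
      unfold bonf
      rw [Finset.card_insert_of_notMem hpT]
      rcases m with _ | m
      · simp
      · by_cases hc : T.card ≤ m
        · simp [hc, pow_succ]; ring
        · simp [hc]
    rw [key]
    rcases m with _ | m
    · have := ih hB 0
      simp only [pow_zero, one_mul, if_true, zero_mul, Finset.sum_const_zero, mul_zero, add_zero] at this ⊢
      have hP : 0 ≤ ∏ q ∈ B, (1 - g q) := Finset.prod_nonneg fun q hq => by linarith [(hB q hq).2]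
      nlinarith
    · have h1 := ih hB (m + 1)
      have h2 := ih hB m
      simp only [Nat.add_eq_zero_iff, one_ne_zero, and_false, if_false, Nat.add_sub_cancel]
      rw [pow_succ] at h1 ⊢
      nlinarith [mul_nonneg hgp.1 h2]

noncomputable def lvl (m : ℕ) (T : Finset ℕ) : ℝ := if T.card = m then 1 else 0

theorem bonf_succ (m : ℕ) (T : Finset ℕ) : bonf (m + 1) T = bonf m T + (-1) ^ (m + 1) * lvl (m + 1) T := by
  unfold bonf lvl
  rcases lt_trichotomy T.card (m + 1) with h | h | h
  · rw [if_pos (by omega), if_pos (by omega), if_neg (by omega)]; ring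
  · rw [if_pos (by omega), if_neg (by omega), if_pos h, h]; ring
  · rw [if_neg (by omega), if_neg (by omega), if_neg (by omega)]; ring

theorem bonf_even_ge (g : ℕ → ℝ) (B : Finset ℕ) (hg : ∀ p ∈ B, 0 ≤ g p ∧ g p ≤ 1) (b : ℕ) :
    ∏ p ∈ B, (1 - g p) ≤ ∑ T ∈ B.powerset, bonf (2 * b) T * ∏ p ∈ T, g p := by
  have := bonf_sign g B hg (2 * b)
  rw [pow_mul] at this
  norm_num at this
  linarith

theorem bonf_even_le (g : ℕ → ℝ) (B : Finset ℕ) (hg : ∀ p ∈ B, 0 ≤ g p ∧ g p ≤ 1) (b : ℕ) :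
    ∑ T ∈ B.powerset, bonf (2 * b) T * ∏ p ∈ T, g p
      - ∑ T ∈ B.powerset, lvl (2 * b + 1) T * ∏ p ∈ T, g p ≤ ∏ p ∈ B, (1 - g p) := by
  have := bonf_sign g B hg (2 * b + 1)
  simp only [bonf_succ, pow_succ, pow_mul] at this
  norm_num [add_mul, Finset.sum_add_distrib] at this
  linarith

theorem sum_lvl_le (g : ℕ → ℝ) (B : Finset ℕ) (hg : ∀ p ∈ B, 0 ≤ g p ∧ g p ≤ 1 / 2) (m : ℕ) (S : ℝ)
    (hS : ∑ p ∈ B, g p ≤ S) :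
    ∑ T ∈ B.powerset, lvl m T * ∏ p ∈ T, g p ≤ (1 / 2) ^ m * Real.exp (4 * S) * ∏ p ∈ B, (1 - g p) := by
  have h1 : ∑ T ∈ B.powerset, lvl m T * ∏ p ∈ T, g p ≤ (1 / 2) ^ m * ∏ p ∈ B, (1 + 2 * g p) := by
    rw [Finset.prod_one_add, Finset.mul_sum]
    apply Finset.sum_le_sum
    intro T hT
    have hTg : 0 ≤ ∏ p ∈ T, g p := Finset.prod_nonneg fun p hp => (hg p (Finset.mem_powerset.1 hT hp)).1
    rw [Finset.prod_mul_distrib, Finset.prod_const]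
    unfold lvl
    split_ifs with h
    · rw [h, ← mul_assoc, ← mul_pow]; norm_num
    · simp only [zero_mul]; positivity
  have h2 : ∏ p ∈ B, (1 + 2 * g p) ≤ Real.exp (2 * S) := by
    calc _ ≤ ∏ p ∈ B, Real.exp (2 * g p) := by
          apply Finset.prod_le_prod
          · intro p hp; linarith [(hg p hp).1]
          · intro p hp; linarith [Real.add_one_le_exp (2 * g p)]
      _ = Real.exp (2 * ∑ p ∈ B, g p) := by rw [← Real.exp_sum, Finset.mul_sum]
      _ ≤ _ := Real.exp_le_exp.2 (by linarith)
  have h3 : Real.exp (-(2 * S)) ≤ ∏ p ∈ B, (1 - g p) := by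
    calc _ ≤ Real.exp (∑ p ∈ B, -(2 * g p)) := by
          apply Real.exp_le_exp.2
          rw [Finset.sum_neg_distrib, ← Finset.mul_sum]; linarith
      _ = ∏ p ∈ B, Real.exp (-(2 * g p)) := by rw [Real.exp_sum]
      _ ≤ _ := by
          apply Finset.prod_le_prod
          · intro p hp; positivity
          · intro p hp
            obtain ⟨h0, h1⟩ := hg p hp
            rw [Real.exp_neg]
            rw [inv_le_comm₀ (Real.exp_pos _) (by linarith)]
            refine le_trans ?_ (Real.add_one_le_exp _)
            rw [inv_le_iff_one_le_mul₀ (by linarith)]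
            nlinarith
  calc _ ≤ (1 / 2) ^ m * ∏ p ∈ B, (1 + 2 * g p) := h1
    _ ≤ (1 / 2) ^ m * Real.exp (2 * S) := by gcongr
    _ = (1 / 2) ^ m * Real.exp (4 * S) * Real.exp (-(2 * S)) := by
        rw [mul_assoc, ← Real.exp_add]; ring_nf
    _ ≤ _ := by gcongr

theorem sieve_weights (k : ℝ) (hk : 0 ≤ k) (v : ℕ) : 1 ≤ v → ∀ (b : ℕ) (P : Finset ℕ), P ⊆ prs 0 v →
    ∃ l u : Finset ℕ → ℝ, (∀ S, |l S| ≤ v + 1) ∧ (∀ S, |u S| ≤ 1) ∧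
      (∀ S ⊆ P, (l S ≠ 0 ∨ u S ≠ 0) → ∏ p ∈ S, p ≤ v ^ (4 * b + 6)) ∧
      (∀ g : ℕ → ℝ, (∀ p ∈ P, 0 ≤ g p ∧ g p ≤ 1) →
        ∑ S ∈ P.powerset, l S * ∏ p ∈ S, g p ≤ ∏ p ∈ P, (1 - g p) ∧
        ∏ p ∈ P, (1 - g p) ≤ ∑ S ∈ P.powerset, u S * ∏ p ∈ S, g p) ∧
      (∀ g : ℕ → ℝ, (∀ p ∈ P, 0 ≤ g p ∧ g p ≤ k / p ∧ g p ≤ 1 / 2) →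
        (1 - Real.exp (24 * k) * (1 / 4) ^ b) * ∑ S ∈ P.powerset, u S * ∏ p ∈ S, g p
          ≤ ∑ S ∈ P.powerset, l S * ∏ p ∈ S, g p) := by
  induction v using Nat.strong_induction_on with
  | _ v ih =>
  intro hv1 b P hP
  by_cases hv : v ≤ 1
  · have : P = ∅ := by
      rw [Finset.eq_empty_iff_forall_notMem]
      intro p hp
      have := mem_prs.1 (hP hp)
      have := this.2.two_le
      omega
    subst this
    refine ⟨fun _ => 1, fun _ => 1, by simp, by simp, ?_, by simp, ?_⟩
    · intro S hS _
      rw [Finset.subset_empty.1 hS]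
      simpa using Nat.one_le_pow _ _ (by omega)
    · intro g _
      simp
      positivity
  push Not at hv
  set w := Nat.sqrt v with hw
  have hwv : w < v := Nat.sqrt_lt_self hv
  have hw1 : 1 ≤ w := Nat.sqrt_pos.2 (by omega)
  have hww : w ^ 2 ≤ v := Nat.sqrt_le' v
  set A := P.filter (fun p => p ≤ w) with hA
  set B := P.filter (fun p => ¬ p ≤ w) with hB
  have hAB : Disjoint A B := Finset.disjoint_filter_filter_not _ _ _
  have hABP : A ∪ B = P := Finset.filter_union_filter_not_eq _ _
  have hAP : A ⊆ P := Finset.filter_subset _ _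
  have hBP : B ⊆ P := Finset.filter_subset _ _
  have hAw : A ⊆ prs 0 w := by
    intro p hp
    rw [hA, Finset.mem_filter] at hp
    have := mem_prs.1 (hP hp.1)
    exact mem_prs.2 ⟨⟨this.1.1, hp.2⟩, this.2⟩
  have hBw : B ⊆ prs w v := by
    intro p hp
    rw [hB, Finset.mem_filter] at hp
    have := mem_prs.1 (hP hp.1)
    exact mem_prs.2 ⟨⟨by omega, this.1.2⟩, this.2⟩
  obtain ⟨l, u, hl, hu, hsupp, hbd, hmain⟩ := ih w hwv hw1 (b + 1) A hAw
  refine ⟨fun S => l (S ∩ A) * bonf (2 * b) (S ∩ B) - u (S ∩ A) * lvl (2 * b + 1) (S ∩ B),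
    fun S => u (S ∩ A) * bonf (2 * b) (S ∩ B), ?_, ?_, ?_, ?_, ?_⟩
  · intro S
    have h1 := hl (S ∩ A)
    have h2 := hu (S ∩ A)
    have hb : |bonf (2 * b) (S ∩ B)| ≤ 1 := by
      unfold bonf; split_ifs <;> simp
    have hz : |lvl (2 * b + 1) (S ∩ B)| ≤ 1 := by
      unfold lvl; split_ifs <;> simp
    have hwv' : (w : ℝ) + 1 ≤ v := by exact_mod_cast hwv
    calc _ ≤ |l (S ∩ A) * bonf (2 * b) (S ∩ B)| + |u (S ∩ A) * lvl (2 * b + 1) (S ∩ B)| := abs_sub _ _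
      _ = |l (S ∩ A)| * |bonf (2 * b) (S ∩ B)| + |u (S ∩ A)| * |lvl (2 * b + 1) (S ∩ B)| := by
          rw [abs_mul, abs_mul]
      _ ≤ ((w : ℝ) + 1) * 1 + 1 * 1 := by gcongr
      _ ≤ _ := by linarith
  · intro S
    have h2 := hu (S ∩ A)
    have hb : |bonf (2 * b) (S ∩ B)| ≤ 1 := by
      unfold bonf; split_ifs <;> simp
    rw [abs_mul]
    calc _ ≤ (1 : ℝ) * 1 := by gcongr
      _ = 1 := by norm_num
  · intro S hS hne
    have h1 : (l (S ∩ A) ≠ 0 ∨ u (S ∩ A) ≠ 0) ∧ (S ∩ B).card ≤ 2 * b + 1 := by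
      have hc : bonf (2 * b) (S ∩ B) ≠ 0 ∨ lvl (2 * b + 1) (S ∩ B) ≠ 0 → (S ∩ B).card ≤ 2 * b + 1 := by
        unfold bonf lvl
        rintro (h | h)
        · by_contra hcon
          rw [if_neg (by omega)] at h
          exact h rfl
        · by_contra hcon
          rw [if_neg (by omega)] at h
          exact h rfl
      constructor
      · by_contra hcon
        push Not at hcon
        simp [hcon.1, hcon.2] at hne
      · apply hc
        by_contra hcon
        push Not at hcon
        simp [hcon.1, hcon.2] at hne
    have h2 := hsupp (S ∩ A) Finset.inter_subset_right h1.1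
    rw [← prod_inter_mul hAB (hABP.symm ▸ hS) (fun p => p)]
    have h3 : ∏ p ∈ S ∩ B, p ≤ v ^ (2 * b + 1) := by
      calc ∏ p ∈ S ∩ B, p ≤ ∏ p ∈ S ∩ B, v := by
            apply Finset.prod_le_prod'
            intro p hp
            exact (mem_prs.1 (hBw (Finset.mem_inter.1 hp).2)).1.2
        _ = v ^ (S ∩ B).card := by rw [Finset.prod_const]
        _ ≤ _ := Nat.pow_le_pow_right (by omega) h1.2
    calc _ ≤ w ^ (4 * (b + 1) + 6) * v ^ (2 * b + 1) := Nat.mul_le_mul h2 h3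
      _ = (w ^ 2) ^ (2 * b + 5) * v ^ (2 * b + 1) := by rw [← pow_mul]; ring_nf
      _ ≤ v ^ (2 * b + 5) * v ^ (2 * b + 1) := Nat.mul_le_mul_right _ (Nat.pow_le_pow_left hww _)
      _ = _ := by rw [← pow_add]; ring_nf
  all_goals
    have hsplit : ∀ (f h : Finset ℕ → ℝ) (g : ℕ → ℝ),
        ∑ S ∈ P.powerset, f (S ∩ A) * h (S ∩ B) * ∏ p ∈ S, g p
          = (∑ S ∈ A.powerset, f S * ∏ p ∈ S, g p) * ∑ S ∈ B.powerset, h S * ∏ p ∈ S, g p := by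
      intro f h g
      rw [← sum_powerset_union hAB, hABP]
      apply Finset.sum_congr rfl
      intro S hS
      rw [← prod_inter_mul hAB (hABP.symm ▸ Finset.mem_powerset.1 hS) g]
      ring
    have hprod : ∀ g : ℕ → ℝ, ∏ p ∈ P, g p = (∏ p ∈ A, g p) * ∏ p ∈ B, g p := by
      intro g
      rw [← hABP, Finset.prod_union hAB]
    simp only [sub_mul, Finset.sum_sub_distrib, hsplit, hprod]
    intro g hg
  · have hgA : ∀ p ∈ A, 0 ≤ g p ∧ g p ≤ 1 := fun p hp => hg p (hAP hp)
    have hgB : ∀ p ∈ B, 0 ≤ g p ∧ g p ≤ 1 := fun p hp => hg p (hBP hp)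
    obtain ⟨e1, e2⟩ := hbd g hgA
    have e3 := bonf_even_ge g B hgB b
    have e4 := bonf_even_le g B hgB b
    have e5 : 0 ≤ ∑ T ∈ B.powerset, lvl (2 * b + 1) T * ∏ p ∈ T, g p := by
      apply Finset.sum_nonneg
      intro T hT
      apply mul_nonneg
      · unfold lvl; split_ifs <;> norm_num
      · exact Finset.prod_nonneg fun p hp => (hgB p (Finset.mem_powerset.1 hT hp)).1
    have e6 : 0 ≤ ∏ p ∈ A, (1 - g p) := Finset.prod_nonneg fun p hp => by linarith [(hgA p hp).2]
    have e7 : 0 ≤ ∏ p ∈ B, (1 - g p) := Finset.prod_nonneg fun p hp => by linarith [(hgB p hp).2]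
    generalize (∑ T ∈ B.powerset, lvl (2 * b + 1) T * ∏ p ∈ T, g p) = Z at *
    generalize (∑ T ∈ B.powerset, bonf (2 * b) T * ∏ p ∈ T, g p) = Y at *
    generalize (∑ T ∈ A.powerset, l T * ∏ p ∈ T, g p) = L at *
    generalize (∑ T ∈ A.powerset, u T * ∏ p ∈ T, g p) = U at *
    generalize ∏ p ∈ A, (1 - g p) = V at *
    generalize ∏ p ∈ B, (1 - g p) = W at *
    constructor
    · nlinarith [mul_nonneg (sub_nonneg.2 e1) (e7.trans e3), mul_nonneg (sub_nonneg.2 e2) e5]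
    · exact mul_le_mul e2 e3 e7 (e6.trans e2)
  · have hgA : ∀ p ∈ A, 0 ≤ g p ∧ g p ≤ k / p ∧ g p ≤ 1 / 2 := fun p hp => hg p (hAP hp)
    have hgB : ∀ p ∈ B, 0 ≤ g p ∧ g p ≤ k / p ∧ g p ≤ 1 / 2 := fun p hp => hg p (hBP hp)
    have hgA1 : ∀ p ∈ A, 0 ≤ g p ∧ g p ≤ 1 := fun p hp => ⟨(hgA p hp).1, by linarith [(hgA p hp).2.2]⟩
    have hgB1 : ∀ p ∈ B, 0 ≤ g p ∧ g p ≤ 1 := fun p hp => ⟨(hgB p hp).1, by linarith [(hgB p hp).2.2]⟩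
    obtain ⟨e1, e2⟩ := hbd g hgA1
    have e3 := bonf_even_ge g B hgB1 b
    have e6 : 0 ≤ ∏ p ∈ A, (1 - g p) := Finset.prod_nonneg fun p hp => by linarith [(hgA1 p hp).2]
    have e7 : 0 ≤ ∏ p ∈ B, (1 - g p) := Finset.prod_nonneg fun p hp => by linarith [(hgB1 p hp).2]
    have e8 := hmain g hgA
    have hsum : ∑ p ∈ B, g p ≤ 6 * k := by
      have h1 : ∑ p ∈ prs w v, (1 : ℝ) / p ≤ 3 * 2 := by
        apply sum_inv_prs w v 2 hw1 (by omega)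
        rw [← Nat.cast_ofNat, ← Real.log_pow]
        apply Real.log_le_log (by exact_mod_cast hv1)
        exact_mod_cast (Nat.lt_succ_sqrt' v).le
      calc ∑ p ∈ B, g p ≤ ∑ p ∈ B, k / p := Finset.sum_le_sum fun p hp => (hgB p hp).2.1
        _ ≤ ∑ p ∈ prs w v, k / p := Finset.sum_le_sum_of_subset_of_nonneg hBw
            fun p _ _ => by positivity
        _ = k * ∑ p ∈ prs w v, (1 : ℝ) / p := by rw [Finset.mul_sum]; simp [div_eq_mul_inv]
        _ ≤ _ := by nlinarith
    have e9 := sum_lvl_le g B (fun p hp => ⟨(hgB p hp).1, (hgB p hp).2.2⟩) (2 * b + 1) _ hsum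
    have e10 : ((1 : ℝ) / 2) ^ (2 * b + 1) = 1 / 2 * (1 / 4) ^ b := by
      rw [pow_succ, pow_mul]; norm_num; ring
    rw [e10, show (4 : ℝ) * (6 * k) = 24 * k by ring] at e9
    rw [pow_succ] at e8
    have e11 : 0 ≤ Real.exp (24 * k) * (1 / 4) ^ b := by positivity
    have e12 : (1 : ℝ) / 2 * (1 / 4) ^ b * Real.exp (24 * k) = 1 / 2 * (Real.exp (24 * k) * (1 / 4) ^ b) := by
      ring
    rw [e12] at e9
    have e13 : Real.exp (24 * k) * ((1 / 4) ^ b * (1 / 4)) = 1 / 4 * (Real.exp (24 * k) * (1 / 4) ^ b) := by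
      ring
    rw [e13] at e8
    generalize Real.exp (24 * k) * (1 / 4) ^ b = c at *
    generalize (∑ T ∈ B.powerset, lvl (2 * b + 1) T * ∏ p ∈ T, g p) = Z at *
    generalize (∑ T ∈ B.powerset, bonf (2 * b) T * ∏ p ∈ T, g p) = Y at *
    generalize (∑ T ∈ A.powerset, l T * ∏ p ∈ T, g p) = L at *
    generalize (∑ T ∈ A.powerset, u T * ∏ p ∈ T, g p) = U at *
    generalize ∏ p ∈ A, (1 - g p) = V at *
    generalize ∏ p ∈ B, (1 - g p) = W at *
    have hY : 0 ≤ Y := e7.trans e3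
    have hU : 0 ≤ U := e6.trans e2
    have hZ : Z ≤ 1 / 2 * c * Y := e9.trans (by gcongr)
    have h1 : (1 - 1 / 4 * c) * U * Y ≤ L * Y := mul_le_mul_of_nonneg_right e8 hY
    have h2 : U * Z ≤ U * (1 / 2 * c * Y) := mul_le_mul_of_nonneg_left hZ hU
    have h3 : 0 ≤ c * (U * Y) := by positivity
    nlinarith

theorem prod_injOn {D v : ℕ} {S T : Finset ℕ} (hS : S ⊆ prs D v) (hT : T ⊆ prs D v)
    (h : ∏ p ∈ S, p = ∏ p ∈ T, p) : S = T := by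
  rw [← Nat.primeFactors_prod (s := S) fun p hp => (mem_prs.1 (hS hp)).2, h,
    Nat.primeFactors_prod fun p hp => (mem_prs.1 (hT hp)).2]

/-- a lower bound sieve of Brun-Hooley type -/
theorem sieve_lower (k : ℝ) (hk : 0 ≤ k) : ∃ K : ℕ, ∀ v : ℕ, 1 ≤ v → ∀ P : Finset ℕ, P ⊆ prs 0 v →
    ∀ g : ℕ → ℝ, (∀ p ∈ P, 0 ≤ g p ∧ g p ≤ k / p ∧ g p ≤ 1 / 2) →
    ∀ {α : Type} (A : Finset α) (E : ℕ → α → Prop) (X R : ℝ), 0 ≤ X → 0 ≤ R →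
    (∀ S ⊆ P, ∏ p ∈ S, p ≤ v ^ K →
      |((A.filter fun a => ∀ p ∈ S, E p a).card : ℝ) - X * ∏ p ∈ S, g p| ≤ R) →
    X / 2 * ∏ p ∈ P, (1 - g p) - (v + 1) * v ^ K * R ≤ ((A.filter fun a => ∀ p ∈ P, ¬ E p a).card : ℝ) := by
  obtain ⟨b, hb⟩ := exists_pow_lt_of_lt_one (show (0 : ℝ) < 1 / 2 / Real.exp (24 * k) by positivity)
    (show (1 / 4 : ℝ) < 1 by norm_num)
  refine ⟨4 * b + 6, ?_⟩
  intro v hv P hP g hg α A E X R hX hR hAE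
  obtain ⟨l, u, hl, hu, hsupp, hbd, hmain⟩ := sieve_weights k hk v hv b P hP
  have hb' : Real.exp (24 * k) * (1 / 4) ^ b ≤ 1 / 2 := by
    have := (lt_div_iff₀ (Real.exp_pos (24 * k))).1 hb
    linarith
  have hg1 : ∀ p ∈ P, 0 ≤ g p ∧ g p ≤ 1 := fun p hp => ⟨(hg p hp).1, by linarith [(hg p hp).2.2]⟩
  have hV : 0 ≤ ∏ p ∈ P, (1 - g p) := Finset.prod_nonneg fun p hp => by linarith [(hg1 p hp).2]
  have h1 : 1 / 2 * ∏ p ∈ P, (1 - g p) ≤ ∑ S ∈ P.powerset, l S * ∏ p ∈ S, g p := by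
    have e1 := hmain g hg
    have e2 := (hbd g hg1).2
    nlinarith
  have h2 : ∑ S ∈ P.powerset, l S * ((A.filter fun a => ∀ p ∈ S, E p a).card : ℝ)
      ≤ ((A.filter fun a => ∀ p ∈ P, ¬ E p a).card : ℝ) := by
    have e1 : ∀ a ∈ A, ∑ S ∈ P.powerset, l S * (if ∀ p ∈ S, E p a then (1 : ℝ) else 0)
        ≤ if ∀ p ∈ P, ¬ E p a then (1 : ℝ) else 0 := by
      intro a _
      have := (hbd (fun p => if E p a then 1 else 0) (by intro p _; split_ifs <;> norm_num)).1
      convert this using 1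
      · apply Finset.sum_congr rfl
        intro S _
        rw [Finset.prod_ite_zero]; simp
      · have : ∀ p, (1 : ℝ) - (if E p a then 1 else 0) = if ¬ E p a then 1 else 0 := by
          intro p; split_ifs <;> simp_all
        simp only [this]
        rw [Finset.prod_ite_zero]; simp
    have e2 := Finset.sum_le_sum e1
    rw [Finset.sum_comm] at e2
    simpa only [← Finset.mul_sum, Finset.sum_boole] using e2
  have h3 : ∑ S ∈ P.powerset, l S * (X * ∏ p ∈ S, g p) - (v + 1) * v ^ (4 * b + 6) * R
      ≤ ∑ S ∈ P.powerset, l S * ((A.filter fun a => ∀ p ∈ S, E p a).card : ℝ) := by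
    have e1 : ∀ S ∈ P.powerset, l S * (X * ∏ p ∈ S, g p)
        - l S * ((A.filter fun a => ∀ p ∈ S, E p a).card : ℝ)
        ≤ if ∏ p ∈ S, p ≤ v ^ (4 * b + 6) then ((v : ℝ) + 1) * R else 0 := by
      intro S hS
      rw [Finset.mem_powerset] at hS
      split_ifs with hc
      · rw [← mul_sub]
        refine (le_abs_self _).trans ?_
        rw [abs_mul, abs_sub_comm]
        exact mul_le_mul (hl S) (hAE S hS hc) (abs_nonneg _) (by positivity)
      · have : l S = 0 := by
          by_contra hcon
          exact hc (hsupp S hS (Or.inl hcon))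
        simp [this]
    have e2 := Finset.sum_le_sum e1
    rw [Finset.sum_sub_distrib, ← Finset.sum_filter, Finset.sum_const, nsmul_eq_mul] at e2
    have e3 : (P.powerset.filter fun S => ∏ p ∈ S, p ≤ v ^ (4 * b + 6)).card ≤ v ^ (4 * b + 6) := by
      calc _ ≤ (Finset.Icc 1 (v ^ (4 * b + 6))).card := by
            apply Finset.card_le_card_of_injOn (fun S => ∏ p ∈ S, p)
            · intro S hS
              simp only [Finset.coe_filter, Finset.mem_powerset, Set.mem_ofPred_eq] at hS
              simp only [Finset.coe_Icc, Set.mem_Icc]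
              exact ⟨Finset.prod_pos fun p hp => (mem_prs.1 (hP (hS.1 hp))).2.pos, hS.2⟩
            · intro S hS T hT h
              simp only [Finset.coe_filter, Finset.mem_powerset, Set.mem_ofPred_eq] at hS hT
              exact prod_injOn (hS.1.trans hP) (hT.1.trans hP) h
        _ = _ := by simp
    have e4 : ((P.powerset.filter fun S => ∏ p ∈ S, p ≤ v ^ (4 * b + 6)).card : ℝ) ≤ (v : ℝ) ^ (4 * b + 6) := by
      exact_mod_cast e3
    have e5 : 0 ≤ ((v : ℝ) + 1) * R := by positivity
    nlinarith
  have h4 : ∑ S ∈ P.powerset, l S * (X * ∏ p ∈ S, g p) = X * ∑ S ∈ P.powerset, l S * ∏ p ∈ S, g p := by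
    rw [Finset.mul_sum]; exact Finset.sum_congr rfl fun S _ => by ring
  rw [h4] at h3
  have h5 := mul_le_mul_of_nonneg_left h1 hX
  linarith

theorem sum_powerset_union_le {A B : Finset ℕ} (h : Disjoint A B) (f : Finset ℕ → ℝ) (c : ℕ → ℝ)
    (hc : ∀ p ∈ B, 0 ≤ c p)
    (hf : ∀ S ⊆ A ∪ B, ∀ p ∈ B, p ∉ S → f (insert p S) ≤ c p * f S) :
    ∑ S ∈ (A ∪ B).powerset, f S ≤ (∏ p ∈ B, (1 + c p)) * ∑ S ∈ A.powerset, f S := by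
  induction B using Finset.induction_on with
  | empty => simp
  | insert p B hp ih =>
    have hpA : p ∉ A := fun hA => Finset.disjoint_left.1 h hA (Finset.mem_insert_self _ _)
    have hdis : Disjoint A B := Finset.disjoint_of_subset_right (Finset.subset_insert _ _) h
    have hpAB : p ∉ A ∪ B := by simp [hp, hpA]
    have hsub : A ∪ B ⊆ A ∪ insert p B := Finset.union_subset_union_right (Finset.subset_insert _ _)
    have ih' := ih hdis (fun q hq => hc q (Finset.mem_insert_of_mem hq))
      (fun S hS q hq => hf S (hS.trans hsub) q (Finset.mem_insert_of_mem hq))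
    rw [Finset.union_insert, Finset.sum_powerset_insert hpAB, Finset.prod_insert hp]
    have h1 : ∑ S ∈ (A ∪ B).powerset, f (insert p S) ≤ c p * ∑ S ∈ (A ∪ B).powerset, f S := by
      rw [Finset.mul_sum]
      refine Finset.sum_le_sum fun S hS => ?_
      rw [Finset.mem_powerset] at hS
      exact hf S (hS.trans hsub) p (Finset.mem_insert_self _ _) fun h => hpAB (hS h)
    have h2 := hc p (Finset.mem_insert_self _ _)
    nlinarith

theorem sum_powerset_mul_log_le (A : Finset ℕ) (hA : ∀ p ∈ A, 1 ≤ p) (f : Finset ℕ → ℝ) (c : ℕ → ℝ)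
    (hc : ∀ p ∈ A, 0 ≤ c p) (hf0 : ∀ S ⊆ A, 0 ≤ f S)
    (hf : ∀ S ⊆ A, ∀ p ∈ A, p ∉ S → f (insert p S) ≤ c p * f S) :
    ∑ S ∈ A.powerset, f S * Real.log (∏ p ∈ S, p : ℕ) ≤
      (∑ p ∈ A, c p * Real.log p) * ∑ S ∈ A.powerset, f S := by
  have h1 : ∀ S ∈ A.powerset, f S * Real.log (∏ p ∈ S, p : ℕ)
      = ∑ p ∈ A, if p ∈ S then f S * Real.log p else 0 := by
    intro S hS
    rw [Finset.mem_powerset] at hS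
    rw [Nat.cast_prod, Real.log_prod, Finset.mul_sum, ← Finset.sum_filter, Finset.filter_mem_eq_inter,
      Finset.inter_eq_right.2 hS]
    intro p hp
    have := hA p (hS hp)
    positivity
  rw [Finset.sum_congr rfl h1, Finset.sum_comm, Finset.sum_mul]
  refine Finset.sum_le_sum fun p hp => ?_
  have hlog : 0 ≤ Real.log p := Real.log_natCast_nonneg p
  obtain ⟨B, hpB, rfl⟩ : ∃ B, p ∉ B ∧ insert p B = A :=
    ⟨A.erase p, Finset.notMem_erase _ _, Finset.insert_erase hp⟩
  rw [Finset.sum_powerset_insert hpB, Finset.sum_powerset_insert hpB]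
  have h2 : ∑ S ∈ B.powerset, (if p ∈ S then f S * Real.log p else 0) = 0 := by
    refine Finset.sum_eq_zero fun S hS => ?_
    rw [Finset.mem_powerset] at hS
    rw [if_neg fun h => hpB (hS h)]
  rw [h2, zero_add]
  have h3 : 0 ≤ ∑ S ∈ B.powerset, f (insert p S) := by
    refine Finset.sum_nonneg fun S hS => hf0 _ ?_
    rw [Finset.mem_powerset] at hS
    exact Finset.insert_subset_insert _ hS
  have h4 : ∑ S ∈ B.powerset, (if p ∈ insert p S then f (insert p S) * Real.log p else 0)
      ≤ ∑ S ∈ B.powerset, c p * Real.log p * f S := by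
    refine Finset.sum_le_sum fun S hS => ?_
    rw [Finset.mem_powerset] at hS
    rw [if_pos (Finset.mem_insert_self _ _)]
    have := hf S (hS.trans (Finset.subset_insert _ _)) p hp fun h => hpB (hS h)
    nlinarith
  rw [← Finset.mul_sum] at h4
  have := mul_nonneg (mul_nonneg (hc p hp) hlog) h3
  nlinarith

theorem sum_powerset_le_two_mul (A : Finset ℕ) (hA : ∀ p ∈ A, 1 ≤ p) (f : Finset ℕ → ℝ) (c : ℕ → ℝ)
    (hc : ∀ p ∈ A, 0 ≤ c p) (hf0 : ∀ S ⊆ A, 0 ≤ f S)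
    (hf : ∀ S ⊆ A, ∀ p ∈ A, p ∉ S → f (insert p S) ≤ c p * f S) (Y : ℝ) (hY : 1 < Y)
    (hcY : ∑ p ∈ A, c p * Real.log p ≤ Real.log Y / 2) :
    ∑ S ∈ A.powerset, f S ≤ 2 * ∑ S ∈ A.powerset.filter (fun S => ((∏ p ∈ S, p : ℕ) : ℝ) ≤ Y), f S := by
  have hlY : 0 < Real.log Y := Real.log_pos hY
  have h1 := sum_powerset_mul_log_le A hA f c hc hf0 hf
  have h0 : 0 ≤ ∑ S ∈ A.powerset, f S := Finset.sum_nonneg fun S hS => hf0 S (Finset.mem_powerset.1 hS)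
  have h2 := Finset.sum_filter_add_sum_filter_not A.powerset (fun S => ((∏ p ∈ S, p : ℕ) : ℝ) ≤ Y) f
  have h3 : Real.log Y * ∑ S ∈ A.powerset.filter (fun S => ¬ ((∏ p ∈ S, p : ℕ) : ℝ) ≤ Y), f S
      ≤ ∑ S ∈ A.powerset, f S * Real.log (∏ p ∈ S, p : ℕ) := by
    rw [Finset.mul_sum]
    refine (Finset.sum_le_sum (g := fun S => f S * Real.log (∏ p ∈ S, p : ℕ)) fun S hS => ?_).trans
      (Finset.sum_le_sum_of_subset_of_nonneg (Finset.filter_subset _ _) fun S hS _ =>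
        mul_nonneg (hf0 S (Finset.mem_powerset.1 hS)) (Real.log_natCast_nonneg _))
    rw [Finset.mem_filter, Finset.mem_powerset, not_le] at hS
    have := Real.log_le_log (by linarith) hS.2.le
    have := hf0 S hS.1
    nlinarith
  have h4 : Real.log Y * ∑ S ∈ A.powerset.filter (fun S => ¬ ((∏ p ∈ S, p : ℕ) : ℝ) ≤ Y), f S
      ≤ Real.log Y * ((∑ S ∈ A.powerset, f S) / 2) := by nlinarith
  have := le_of_mul_le_mul_left h4 hlY
  linarith

theorem prod_one_add_le_exp (B : Finset ℕ) (c : ℕ → ℝ) (hc : ∀ p ∈ B, 0 ≤ c p) :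
    ∏ p ∈ B, (1 + c p) ≤ Real.exp (∑ p ∈ B, c p) := by
  rw [Real.exp_sum]
  refine Finset.prod_le_prod (fun p hp => by linarith [hc p hp]) fun p _ => ?_
  rw [add_comm]; exact Real.add_one_le_exp _

/-- integer valued maps on `ℤ^m` which preserve congruences -/
def CongPres {m : ℕ} (f : (Fin m → ℤ) → ℤ) : Prop :=
  ∀ (d : ℤ) (v w : Fin m → ℤ), (∀ i, d ∣ v i - w i) → d ∣ f v - f w

/-- the integer points of the half-open cube of side `b` with lower corner `s` -/
noncomputable def ibox {m : ℕ} (s : Fin m → ℤ) (b : ℕ) : Finset (Fin m → ℤ) :=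
  Fintype.piFinset fun i => Finset.Ico (s i) (s i + b)

theorem mem_ibox {m : ℕ} {s : Fin m → ℤ} {b : ℕ} {v : Fin m → ℤ} :
    v ∈ ibox s b ↔ ∀ i, s i ≤ v i ∧ v i < s i + b := by
  simp [ibox, Fintype.mem_piFinset]

theorem card_ibox {m : ℕ} (s : Fin m → ℤ) (b : ℕ) : (ibox s b).card = b ^ m := by
  simp [ibox, Fintype.card_piFinset]

/-- number of zeros of `f` modulo `d` -/
noncomputable def numZeros {m : ℕ} (f : (Fin m → ℤ) → ℤ) (d : ℕ) : ℕ :=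
  ((ibox (0 : Fin m → ℤ) d).filter fun v => (d : ℤ) ∣ f v).card

theorem numZeros_le {m : ℕ} (f : (Fin m → ℤ) → ℤ) (d : ℕ) : numZeros f d ≤ d ^ m := by
  rw [← card_ibox (0 : Fin m → ℤ) d]; exact Finset.card_filter_le _ _

theorem CongPres.dvd_iff {m : ℕ} {f : (Fin m → ℤ) → ℤ} (hf : CongPres f) {d : ℤ} {v w : Fin m → ℤ}
    (h : ∀ i, d ∣ v i - w i) : d ∣ f v ↔ d ∣ f w := by
  have := hf d v w h
  exact (dvd_iff_dvd_of_dvd_sub this)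

theorem emod_mem_ibox {m : ℕ} {d : ℕ} (hd : 0 < d) (v : Fin m → ℤ) :
    (fun i => v i % (d : ℤ)) ∈ ibox (0 : Fin m → ℤ) d := by
  rw [mem_ibox]
  intro i
  have h : (0 : ℤ) < d := by exact_mod_cast hd
  exact ⟨Int.emod_nonneg _ h.ne', by simpa using Int.emod_lt_of_pos _ h⟩

theorem abs_card_modEq_sub_le (s r : ℤ) (b : ℕ) {d : ℕ} (hd : 0 < d) (hr : 0 ≤ r ∧ r < d) :
    |(((Finset.Ico s (s + b)).filter fun t => t % (d : ℤ) = r).card : ℝ) - (b : ℝ) / d| ≤ 1 := by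
  have hdz : (0 : ℤ) < d := by exact_mod_cast hd
  have h1 : ((Finset.Ico s (s + b)).filter fun t => t % (d : ℤ) = r)
      = (Finset.Ico s (s + b)).filter fun t => t ≡ r [ZMOD d] := by
    refine Finset.filter_congr fun t _ => ?_
    rw [Int.ModEq, Int.emod_eq_of_lt hr.1 hr.2]
  have h2 := Int.Ico_filter_modEq_card s (s + b) hdz r
  have hle : ⌈((s : ℚ) - r) / (d : ℤ)⌉ ≤ ⌈(((s + b : ℤ) : ℚ) - r) / (d : ℤ)⌉ := by
    apply Int.ceil_le_ceil
    push_cast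
    gcongr
    linarith [(Nat.cast_nonneg b : (0 : ℚ) ≤ b)]
  rw [max_eq_left (sub_nonneg.2 hle)] at h2
  rw [h1]
  have e1 := Int.le_ceil (((s : ℚ) - r) / (d : ℤ))
  have e2 := Int.ceil_lt_add_one (((s : ℚ) - r) / (d : ℤ))
  have e3 := Int.le_ceil ((((s + b : ℤ) : ℚ) - r) / (d : ℤ))
  have e4 := Int.ceil_lt_add_one ((((s + b : ℤ) : ℚ) - r) / (d : ℤ))
  have e5 : (((s + b : ℤ) : ℚ) - r) / (d : ℤ) = ((s : ℚ) - r) / (d : ℤ) + b / d := by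
    push_cast; ring
  rw [e5] at e3 e4 h2
  have hq : |((((Finset.Ico s (s + b)).filter fun t => t ≡ r [ZMOD d]).card : ℤ) : ℚ) - (b : ℚ) / d| ≤ 1 := by
    rw [h2, abs_le]; push_cast; push_cast at e1 e2 e3 e4
    constructor <;> linarith
  have : ((|((((Finset.Ico s (s + b)).filter fun t => t ≡ r [ZMOD d]).card : ℤ) : ℚ) - (b : ℚ) / d| : ℚ) : ℝ) ≤ (1 : ℚ) := by
    exact_mod_cast hq
  push_cast at this
  simpa using this

theorem abs_prod_sub_prod_le {ι : Type*} (s : Finset ι) (x : ι → ℝ) (y B : ℝ) (hB : 1 ≤ B)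
    (hy : 0 ≤ y ∧ y ≤ B) (hx : ∀ i ∈ s, 0 ≤ x i ∧ x i ≤ B ∧ |x i - y| ≤ 1) :
    |∏ i ∈ s, x i - y ^ s.card| ≤ s.card * B ^ (s.card - 1) := by
  induction s using Finset.induction_on with
  | empty => simp
  | insert a s ha ih =>
    have ih' := ih fun i hi => hx i (Finset.mem_insert_of_mem hi)
    obtain ⟨h1, h2, h3⟩ := hx a (Finset.mem_insert_self _ _)
    rw [Finset.prod_insert ha, Finset.card_insert_of_notMem ha]
    have e : x a * ∏ i ∈ s, x i - y ^ (s.card + 1)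
        = (x a - y) * ∏ i ∈ s, x i + y * (∏ i ∈ s, x i - y ^ s.card) := by ring
    have hp : |∏ i ∈ s, x i| ≤ B ^ s.card := by
      rw [Finset.abs_prod, ← Finset.prod_const]
      refine Finset.prod_le_prod (fun i _ => abs_nonneg _) fun i hi => ?_
      obtain ⟨h1, h2, h3⟩ := hx i (Finset.mem_insert_of_mem hi)
      rw [abs_of_nonneg h1]; exact h2
    have hB' : (s.card : ℝ) * B ^ (s.card - 1) * B = s.card * B ^ s.card := by
      rcases Nat.eq_zero_or_pos s.card with h | h
      · simp [h]
      · rw [mul_assoc, ← pow_succ, Nat.sub_add_cancel h]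
    rw [e]
    calc _ ≤ |(x a - y) * ∏ i ∈ s, x i| + |y * (∏ i ∈ s, x i - y ^ s.card)| := abs_add_le _ _
      _ = |x a - y| * |∏ i ∈ s, x i| + y * |∏ i ∈ s, x i - y ^ s.card| := by
          rw [abs_mul, abs_mul, abs_of_nonneg hy.1]
      _ ≤ 1 * B ^ s.card + B * (s.card * B ^ (s.card - 1)) := by
          gcongr
          exact hy.2
      _ = _ := by rw [mul_comm B, hB']; simp; ring

theorem abs_card_ibox_dvd_sub_le {m : ℕ} {f : (Fin m → ℤ) → ℤ} (hf : CongPres f) (s : Fin m → ℤ) (b : ℕ)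
    {d : ℕ} (hd : 0 < d) :
    |(((ibox s b).filter fun v => (d : ℤ) ∣ f v).card : ℝ) - numZeros f d * ((b : ℝ) / d) ^ m|
      ≤ numZeros f d * (m * ((b : ℝ) / d + 1) ^ (m - 1)) := by
  have hmaps : ∀ v ∈ (ibox s b).filter (fun v => (d : ℤ) ∣ f v), (fun i => v i % (d : ℤ)) ∈
      (ibox (0 : Fin m → ℤ) d).filter (fun v => (d : ℤ) ∣ f v) := by
    intro v hv
    rw [Finset.mem_filter] at hv ⊢
    refine ⟨emod_mem_ibox hd v, (hf.dvd_iff fun i => ?_).1 hv.2⟩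
    exact Int.dvd_self_sub_emod
  rw [Finset.card_eq_sum_card_fiberwise hmaps, numZeros, Nat.cast_sum, ← nsmul_eq_mul, ← Finset.sum_const,
    ← Finset.sum_sub_distrib, ← nsmul_eq_mul, ← Finset.sum_const]
  refine (Finset.abs_sum_le_sum_abs _ _).trans (Finset.sum_le_sum fun r hr => ?_)
  rw [Finset.mem_filter, mem_ibox] at hr
  have hfib : ((ibox s b).filter (fun v => (d : ℤ) ∣ f v)).filter (fun v => (fun i => v i % (d : ℤ)) = r)
      = Fintype.piFinset fun i => (Finset.Ico (s i) (s i + b)).filter fun t => t % (d : ℤ) = r i := by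
    ext v
    rw [Finset.mem_filter, Finset.mem_filter, mem_ibox, Fintype.mem_piFinset]
    constructor
    · rintro ⟨⟨h1, _⟩, h2⟩ i
      rw [Finset.mem_filter, Finset.mem_Ico]
      exact ⟨h1 i, congrFun h2 i⟩
    · intro h
      simp only [Finset.mem_filter, Finset.mem_Ico] at h
      refine ⟨⟨fun i => (h i).1, ?_⟩, funext fun i => (h i).2⟩
      refine (hf.dvd_iff fun i => ?_).1 hr.2
      rw [← (h i).2, ← Int.neg_sub, Int.dvd_neg]
      exact Int.dvd_self_sub_emod
  rw [hfib, Fintype.card_piFinset, Nat.cast_prod]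
  have hbd : (0 : ℝ) ≤ (b : ℝ) / d := by positivity
  have := abs_prod_sub_prod_le (Finset.univ : Finset (Fin m))
    (fun i => (((Finset.Ico (s i) (s i + b)).filter fun t => t % (d : ℤ) = r i).card : ℝ))
    ((b : ℝ) / d) ((b : ℝ) / d + 1) (by linarith) ⟨hbd, by linarith⟩ (fun i _ => by
      have h := abs_card_modEq_sub_le (s i) (r i) b hd (by simpa using hr.1 i)
      have h' := abs_le.1 h
      exact ⟨Nat.cast_nonneg _, by linarith, h⟩)
  simpa using this

theorem numZeros_mul {m : ℕ} {f : (Fin m → ℤ) → ℤ} (hf : CongPres f) {d e : ℕ} (hd : 0 < d) (he : 0 < e)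
    (hde : Nat.Coprime d e) : numZeros f (d * e) = numZeros f d * numZeros f e := by
  have hdz : (0 : ℤ) < d := by exact_mod_cast hd
  have hez : (0 : ℤ) < e := by exact_mod_cast he
  have hcop : IsCoprime (d : ℤ) e := Nat.isCoprime_iff_coprime.2 hde
  rw [numZeros, numZeros, numZeros, ← Finset.card_product]
  refine Finset.card_bij (fun v _ => (fun i => v i % (d : ℤ), fun i => v i % (e : ℤ))) ?_ ?_ ?_
  · intro v hv
    rw [Finset.mem_filter] at hv
    rw [Finset.mem_product, Finset.mem_filter, Finset.mem_filter]
    refine ⟨⟨emod_mem_ibox hd v, (hf.dvd_iff fun i => ?_).1 ((Dvd.intro _ (by push_cast; rfl)).trans hv.2)⟩,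
      emod_mem_ibox he v, (hf.dvd_iff fun i => ?_).1 ((Dvd.intro_left (d : ℤ) (by push_cast; rfl)).trans hv.2)⟩
    · exact Int.dvd_self_sub_emod
    · exact Int.dvd_self_sub_emod
  · intro v hv w hw h
    rw [Finset.mem_filter, mem_ibox] at hv hw
    rw [Prod.mk.injEq] at h
    funext i
    have h1 : (d : ℤ) ∣ v i - w i := Int.ModEq.dvd (congrFun h.1 i).symm
    have h2 : (e : ℤ) ∣ v i - w i := Int.ModEq.dvd (congrFun h.2 i).symm
    have h3 := hcop.mul_dvd h1 h2
    have a1 := hv.1 i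
    have a2 := hw.1 i
    have h4 : |v i - w i| < (d : ℤ) * e := by
      rw [abs_lt]; push_cast at a1 a2; simp at a1 a2; constructor <;> linarith
    have := Int.eq_zero_of_abs_lt_dvd h3 h4
    linarith
  · rintro ⟨r, t⟩ hrt
    rw [Finset.mem_product, Finset.mem_filter, Finset.mem_filter, mem_ibox, mem_ibox] at hrt
    obtain ⟨⟨hr1, hr2⟩, ht1, ht2⟩ := hrt
    obtain ⟨u, w, huw⟩ := hcop
    set v : Fin m → ℤ := fun i => (r i * (w * e) + t i * (u * d)) % ((d * e : ℕ) : ℤ) with hv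
    have hdv : ∀ i, (d : ℤ) ∣ v i - r i := by
      intro i
      have h1 : ((d * e : ℕ) : ℤ) ∣ v i - (r i * (w * e) + t i * (u * d)) := by
        rw [hv, ← Int.neg_sub, Int.dvd_neg]; exact Int.dvd_self_sub_emod
      have h2 : (d : ℤ) ∣ v i - (r i * (w * e) + t i * (u * d)) := (Dvd.intro _ (by push_cast; rfl)).trans h1
      have h3 : v i - r i = (v i - (r i * (w * e) + t i * (u * d))) + d * (u * (t i - r i)) := by
        linear_combination (r i) * huw
      rw [h3]; exact dvd_add h2 (Dvd.intro _ rfl)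
    have hev : ∀ i, (e : ℤ) ∣ v i - t i := by
      intro i
      have h1 : ((d * e : ℕ) : ℤ) ∣ v i - (r i * (w * e) + t i * (u * d)) := by
        rw [hv, ← Int.neg_sub, Int.dvd_neg]; exact Int.dvd_self_sub_emod
      have h2 : (e : ℤ) ∣ v i - (r i * (w * e) + t i * (u * d)) := (Dvd.intro_left (d : ℤ) (by push_cast; rfl)).trans h1
      have h3 : v i - t i = (v i - (r i * (w * e) + t i * (u * d))) + e * (w * (r i - t i)) := by
        linear_combination (t i) * huw
      rw [h3]; exact dvd_add h2 (Dvd.intro _ rfl)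
    refine ⟨v, ?_, ?_⟩
    · rw [Finset.mem_filter]
      refine ⟨emod_mem_ibox (Nat.mul_pos hd he) _, ?_⟩
      push_cast
      exact (Nat.isCoprime_iff_coprime.2 hde).mul_dvd ((hf.dvd_iff hdv).2 hr2) ((hf.dvd_iff hev).2 ht2)
    · rw [Prod.mk.injEq]
      constructor <;> funext i
      · rw [Int.emod_eq_emod_iff_emod_sub_eq_zero.2 (Int.emod_eq_zero_of_dvd (hdv i))]
        have := hr1 i
        exact Int.emod_eq_of_lt (by simpa using this.1) (by simpa using this.2)
      · rw [Int.emod_eq_emod_iff_emod_sub_eq_zero.2 (Int.emod_eq_zero_of_dvd (hev i))]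
        have := ht1 i
        exact Int.emod_eq_of_lt (by simpa using this.1) (by simpa using this.2)

theorem numZeros_one {m : ℕ} (f : (Fin m → ℤ) → ℤ) : numZeros f 1 = 1 := by
  have := card_ibox (0 : Fin m → ℤ) 1
  simpa [numZeros] using this

theorem numZeros_prod {m : ℕ} {f : (Fin m → ℤ) → ℤ} (hf : CongPres f) (S : Finset ℕ) (hS : ∀ p ∈ S, p.Prime) :
    numZeros f (∏ p ∈ S, p) = ∏ p ∈ S, numZeros f p := by
  induction S using Finset.induction_on with
  | empty => simp [numZeros_one]
  | insert p S hp ih =>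
    rw [Finset.prod_insert hp, Finset.prod_insert hp, numZeros_mul hf, ih fun q hq => hS q (Finset.mem_insert_of_mem hq)]
    · exact (hS p (Finset.mem_insert_self _ _)).pos
    · exact Finset.prod_pos fun q hq => (hS q (Finset.mem_insert_of_mem hq)).pos
    · refine Nat.Coprime.prod_right fun q hq => ?_
      refine (Nat.coprime_primes (hS p (Finset.mem_insert_self _ _)) (hS q (Finset.mem_insert_of_mem hq))).2 ?_
      rintro rfl; exact hp hq

theorem prod_primes_dvd_iff (S : Finset ℕ) (hS : ∀ p ∈ S, p.Prime) (n : ℤ) :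
    ((∏ p ∈ S, p : ℕ) : ℤ) ∣ n ↔ ∀ p ∈ S, (p : ℤ) ∣ n := by
  constructor
  · intro h p hp
    exact (Int.natCast_dvd_natCast.2 (Finset.dvd_prod_of_mem _ hp)).trans h
  · intro h
    rw [Int.natCast_dvd]
    refine Finset.prod_primes_dvd _ (fun p hp => (hS p hp).prime) fun p hp => ?_
    exact Int.natCast_dvd.1 (h p hp)

theorem card_quotient_span_singleton {R : Type*} [CommRing R] [IsDomain R] [Module.Free ℤ R] [Module.Finite ℤ R]
    {x : R} (hx : x ≠ 0) : Nat.card (R ⧸ Ideal.span {x}) = (Algebra.norm ℤ x).natAbs := by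
  have hinj : Function.Injective (LinearMap.mulLeft ℤ x) := fun a b h => mul_left_cancel₀ hx h
  let e := LinearEquiv.ofInjective (LinearMap.mulLeft ℤ x) hinj
  have h := Submodule.natAbs_det_equiv (LinearMap.range (LinearMap.mulLeft ℤ x)) e
  have h2 : (LinearMap.range (LinearMap.mulLeft ℤ x)).subtype ∘ₗ
      AddMonoidHom.toIntLinearMap ((e : R ≃+ LinearMap.range (LinearMap.mulLeft ℤ x)) : R →+ LinearMap.range (LinearMap.mulLeft ℤ x)) = LinearMap.mulLeft ℤ x := by
    ext y; rfl
  have h3 : Nat.card (R ⧸ LinearMap.range (LinearMap.mulLeft ℤ x)) = (Algebra.norm ℤ x).natAbs := by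
    rw [← h, Algebra.norm_apply]
    congr 2
  rw [← h3]
  have h4 : (Ideal.span {x}).toAddSubgroup = (LinearMap.range (LinearMap.mulLeft ℤ x)).toAddSubgroup := by
    ext y
    simp only [Submodule.mem_toAddSubgroup, Ideal.mem_span_singleton', LinearMap.mem_range, LinearMap.mulLeft_apply]
    exact exists_congr fun a => by rw [mul_comm]
  change (Ideal.span {x}).toAddSubgroup.index = (LinearMap.range (LinearMap.mulLeft ℤ x)).toAddSubgroup.index
  rw [h4]

theorem dvd_norm_cast {R : Type*} [CommRing R] [IsDomain R] [Module.Free ℤ R] [Module.Finite ℤ R] (x : R) : x ∣ ((Algebra.norm ℤ x : ℤ) : R) := by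
  by_cases hx : x = 0
  · rw [hx, Algebra.norm_zero]; simp
  have h := card_quotient_span_singleton hx
  have h1 : ((Nat.card (R ⧸ Ideal.span {x}) : ℕ) : R ⧸ Ideal.span {x}) = 0 := by
    have := card_nsmul_eq_zero' (G := R ⧸ Ideal.span {x}) (x := 1)
    simpa using this
  rw [h] at h1
  have h2 : (((Algebra.norm ℤ x).natAbs : ℕ) : R) ∈ Ideal.span {x} := by
    rw [← Ideal.Quotient.eq_zero_iff_mem]
    simpa using h1
  rw [Ideal.mem_span_singleton] at h2
  rcases Int.natAbs_eq (Algebra.norm ℤ x) with h3 | h3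
  · rw [h3]; simpa using h2
  · rw [h3]; simpa using h2

/-- If a finite quotient by a principal ideal is generated by `1` modulo each prime dividing the norm,
it is generated by `1`. -/
theorem exists_int_sub_mem_span {R : Type*} [CommRing R] [IsDomain R] [Module.Free ℤ R] [Module.Finite ℤ R] {x : R} (hx : x ≠ 0)
    (h : ∀ p : ℕ, p.Prime → (p : ℤ) ∣ Algebra.norm ℤ x → ∀ q : R, ∃ (a : ℤ) (c : R), q - a - p * c ∈ Ideal.span {x})
    (q : R) : ∃ a : ℤ, q - a ∈ Ideal.span {x} := by
  have key : ∀ m : ℕ, m ≠ 0 → (∀ p : ℕ, p.Prime → p ∣ m → (p : ℤ) ∣ Algebra.norm ℤ x) →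
      ∀ q : R, ∃ (a : ℤ) (c : R), q - a - m * c ∈ Ideal.span {x} := by
    intro m
    induction m using Nat.recOnMul with
    | zero => intro h0; exact absurd rfl h0
    | one => intro _ _ q; exact ⟨0, q, by simp⟩
    | prime p hp => intro _ hd q; exact h p hp (hd p hp dvd_rfl) q
    | mul a b iha ihb =>
      intro h0 hd q
      have ha : a ≠ 0 := fun h => h0 (by simp [h])
      have hb : b ≠ 0 := fun h => h0 (by simp [h])
      obtain ⟨u, c, huc⟩ := iha ha (fun p hp hpa => hd p hp (hpa.trans (Dvd.intro _ rfl))) q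
      obtain ⟨w, e, hwe⟩ := ihb hb (fun p hp hpa => hd p hp (hpa.trans (Dvd.intro_left _ rfl))) c
      refine ⟨u + a * w, e, ?_⟩
      have := Ideal.add_mem _ huc (Ideal.mul_mem_left _ (a : R) hwe)
      convert this using 1
      push_cast; ring
  have hN : Algebra.norm ℤ x ≠ 0 := by rwa [Ne, Algebra.norm_eq_zero_iff]
  obtain ⟨a, c, hac⟩ := key (Algebra.norm ℤ x).natAbs (by simpa using hN)
    (fun p hp hpd => Int.natCast_dvd.2 hpd) q
  refine ⟨a, ?_⟩
  have h1 : (((Algebra.norm ℤ x).natAbs : ℕ) : R) ∈ Ideal.span {x} := by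
    rw [Ideal.mem_span_singleton]
    have := dvd_norm_cast x
    rcases Int.natAbs_eq (Algebra.norm ℤ x) with h3 | h3
    · rw [h3] at this; simpa using this
    · rw [h3] at this; simpa using this
  have := Ideal.add_mem _ hac (Ideal.mul_mem_right c _ h1)
  simpa using this

theorem norm_dvd_of_int_mem_span {R : Type*} [CommRing R] [IsDomain R] [Module.Free ℤ R] [Module.Finite ℤ R] {x : R} (hx : x ≠ 0) (h : ∀ q : R, ∃ a : ℤ, q - a ∈ Ideal.span {x}) (n : ℤ)
    (hn : (n : R) ∈ Ideal.span {x}) : Algebra.norm ℤ x ∣ n := by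
  have hc := card_quotient_span_singleton hx
  have h1 : addOrderOf (1 : R ⧸ Ideal.span {x}) = Nat.card (R ⧸ Ideal.span {x}) := by
    refine addOrderOf_eq_card_of_forall_mem_zmultiples fun q => ?_
    obtain ⟨r, rfl⟩ := Ideal.Quotient.mk_surjective q
    obtain ⟨a, ha⟩ := h r
    refine ⟨a, ?_⟩
    have := Ideal.Quotient.eq.2 ha
    simpa using this.symm
  have h2 : n • (1 : R ⧸ Ideal.span {x}) = 0 := by
    have := Ideal.Quotient.eq_zero_iff_mem.2 hn
    simpa using this
  have h3 := addOrderOf_dvd_iff_zsmul_eq_zero.2 h2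
  rw [h1, hc] at h3
  exact Int.natAbs_dvd.1 h3

/-- the polynomial with coefficient vector `v` -/
noncomputable def pol {m : ℕ} (v : Fin m → ℤ) : Polynomial ℤ :=
  ∑ i, Polynomial.C (v i) * Polynomial.X ^ (i : ℕ)

/-- the norm form of `ℤ[t]/(G)` -/
noncomputable def nf (G : Polynomial ℤ) {m : ℕ} (v : Fin m → ℤ) : ℤ :=
  Algebra.norm ℤ (AdjoinRoot.mk G (pol v))

theorem pol_sub {m : ℕ} (v w : Fin m → ℤ) : pol (v - w) = pol v - pol w := by
  simp [pol, sub_mul, Finset.sum_sub_distrib]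

theorem coeff_pol {m : ℕ} (v : Fin m → ℤ) (i : Fin m) : (pol v).coeff i = v i := by
  simp [pol, Polynomial.coeff_X_pow, Fin.val_inj]

theorem degree_pol_lt {m : ℕ} (v : Fin m → ℤ) : (pol v).degree < m := by
  refine (Polynomial.degree_sum_le _ _).trans_lt ((Finset.sup_lt_iff (WithBot.bot_lt_coe m)).2 fun i _ => ?_)
  refine (Polynomial.degree_C_mul_X_pow_le _ _).trans_lt ?_
  exact Nat.cast_lt.2 i.2

theorem pol_eq_zero {m : ℕ} {v : Fin m → ℤ} (h : pol v = 0) : v = 0 := by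
  funext i
  rw [← coeff_pol v i, h]; simp

theorem exists_nf_eq_det {G : Polynomial ℤ} (hG : G.Monic) (m : ℕ) :
    ∃ M : Fin m → Matrix (Fin G.natDegree) (Fin G.natDegree) ℤ,
      (∀ v, nf G v = (∑ i, v i • M i).det) ∧ ∀ i : Fin m, (i : ℕ) = 0 → M i = 1 := by
  let b : Module.Basis (Fin G.natDegree) ℤ (AdjoinRoot G) := (AdjoinRoot.powerBasis' hG).basis
  refine ⟨fun i => Algebra.leftMulMatrix b (AdjoinRoot.root G ^ (i : ℕ)), fun v => ?_, fun i hi => ?_⟩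
  · rw [nf, Algebra.norm_eq_matrix_det b]
    congr 1
    simp only [pol, map_sum, map_mul, map_pow, AdjoinRoot.mk_X, AdjoinRoot.mk_C, zsmul_eq_mul]
    refine Finset.sum_congr rfl fun i _ => ?_
    simp
  · simp [hi]

theorem congPres_det {m g : ℕ} (M : Fin m → Matrix (Fin g) (Fin g) ℤ) :
    CongPres fun v => (∑ i, v i • M i).det := by
  intro d v w h
  rw [← Int.modEq_zero_iff_dvd]
  have h1 : ∀ u : Fin m → ℤ, (((∑ i, u i • M i).det : ℤ) : ZMod d.natAbs)
      = (∑ i, (u i : ZMod d.natAbs) • (M i).map (Int.castRingHom (ZMod d.natAbs))).det := by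
    intro u
    have := RingHom.map_det (Int.castRingHom (ZMod d.natAbs)) (∑ i, u i • M i)
    rw [eq_intCast] at this
    rw [this]
    congr 1
    ext a c
    simp [Matrix.sum_apply, -zsmul_eq_mul]
  have h2 : ((((∑ i, v i • M i).det - (∑ i, w i • M i).det : ℤ)) : ZMod d.natAbs) = 0 := by
    rw [Int.cast_sub, h1, h1, sub_eq_zero]
    congr 1
    refine Finset.sum_congr rfl fun i _ => ?_
    congr 1
    have h3 : ((v i - w i : ℤ) : ZMod d.natAbs) = 0 := by
      rw [ZMod.intCast_zmod_eq_zero_iff_dvd]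
      exact Int.natAbs_dvd.2 (h i)
    push_cast at h3
    exact sub_eq_zero.1 h3
  rw [Int.modEq_zero_iff_dvd]
  rw [ZMod.intCast_zmod_eq_zero_iff_dvd] at h2
  exact Int.natAbs_dvd.1 h2

theorem congPres_nf {G : Polynomial ℤ} (hG : G.Monic) (m : ℕ) : CongPres (nf G : (Fin m → ℤ) → ℤ) := by
  obtain ⟨M, hM, _⟩ := exists_nf_eq_det hG m
  have : (nf G : (Fin m → ℤ) → ℤ) = fun v => (∑ i, v i • M i).det := funext hM
  rw [this]; exact congPres_det M

theorem adjoinRoot_isDomain {G : Polynomial ℤ} (hirr : Irreducible G) : IsDomain (AdjoinRoot G) :=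
  AdjoinRoot.isDomain_of_prime hirr.prime

theorem mk_pol_ne_zero {G : Polynomial ℤ} (hG : G.Monic) {m : ℕ} (hm : m ≤ G.natDegree)
    {v : Fin m → ℤ} (hv : v ≠ 0) : AdjoinRoot.mk G (pol v) ≠ 0 := by
  intro h
  rw [AdjoinRoot.mk_eq_zero] at h
  refine hv (pol_eq_zero (by_contra fun h0 => ?_))
  have h1 := Polynomial.degree_le_of_dvd h h0
  rw [Polynomial.degree_eq_natDegree hG.ne_zero] at h1
  have := h1.trans_lt (degree_pol_lt v)
  have : G.natDegree < m := by exact_mod_cast this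
  omega

theorem nf_ne_zero {G : Polynomial ℤ} (hG : G.Monic) (hirr : Irreducible G) {m : ℕ} (hm : m ≤ G.natDegree)
    {v : Fin m → ℤ} (hv : v ≠ 0) : nf G v ≠ 0 := by
  have := adjoinRoot_isDomain hirr
  have := hG.free_adjoinRoot
  have := hG.finite_adjoinRoot
  rw [nf, Ne, Algebra.norm_eq_zero_iff]
  exact mk_pol_ne_zero hG hm hv

theorem dvd_nf_of_dvd_eval {G : Polynomial ℤ} (hG : G.Monic) (hirr : Irreducible G) {m : ℕ}
    {v : Fin m → ℤ} {P : ℕ} {n : ℤ} (h1 : (P : ℤ) ∣ G.eval n) (h2 : (P : ℤ) ∣ (pol v).eval n) :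
    (P : ℤ) ∣ nf G v := by
  have := adjoinRoot_isDomain hirr
  have := hG.free_adjoinRoot
  have := hG.finite_adjoinRoot
  have e : ∀ q : Polynomial ℤ, q.eval₂ (Int.castRingHom (ZMod P)) (n : ZMod P) = ((q.eval n : ℤ) : ZMod P) := by
    intro q
    simp
  have hroot : G.eval₂ (Int.castRingHom (ZMod P)) (n : ZMod P) = 0 := by
    rw [e, ZMod.intCast_zmod_eq_zero_iff_dvd]; exact h1
  let φ : AdjoinRoot G →+* ZMod P := AdjoinRoot.lift (Int.castRingHom (ZMod P)) (n : ZMod P) hroot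
  have h3 : φ (AdjoinRoot.mk G (pol v)) = 0 := by
    rw [AdjoinRoot.lift_mk, e, ZMod.intCast_zmod_eq_zero_iff_dvd]; exact h2
  have h4 := map_dvd φ (dvd_norm_cast (AdjoinRoot.mk G (pol v)))
  rw [h3, map_intCast] at h4
  rw [← ZMod.intCast_zmod_eq_zero_iff_dvd]
  exact zero_dvd_iff.1 h4

theorem eval_cast_eq_zero_iff {p : ℕ} (q : Polynomial ℤ) (n : ℤ) :
    (q.map (Int.castRingHom (ZMod p))).eval (n : ZMod p) = 0 ↔ (p : ℤ) ∣ q.eval n := by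
  rw [← ZMod.intCast_zmod_eq_zero_iff_dvd, ← eq_intCast (Int.castRingHom (ZMod p)) n, Polynomial.eval_map,
    Polynomial.eval₂_at_apply, eq_intCast]

theorem sq_dvd_nf {G : Polynomial ℤ} (hG : G.Monic) (hirr : Irreducible G) {m : ℕ} 
    {v : Fin m → ℤ} {p : ℕ} [Fact p.Prime] {f : Polynomial (ZMod p)} (hf : f.Monic) (hdeg : 2 ≤ f.natDegree)
    (h1 : f ∣ G.map (Int.castRingHom (ZMod p))) (h2 : f ∣ (pol v).map (Int.castRingHom (ZMod p))) :
    (p : ℤ) ^ 2 ∣ nf G v := by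
  have := adjoinRoot_isDomain hirr
  have := hG.free_adjoinRoot
  have := hG.finite_adjoinRoot
  by_cases hx : AdjoinRoot.mk G (pol v) = 0
  · rw [nf, hx, Algebra.norm_zero]; simp
  have hroot : G.eval₂ ((AdjoinRoot.of f).comp (Int.castRingHom (ZMod p))) (AdjoinRoot.root f) = 0 := by
    rw [← Polynomial.eval₂_map, ← AdjoinRoot.algebraMap_eq, ← Polynomial.aeval_def, AdjoinRoot.aeval_eq, AdjoinRoot.mk_eq_zero]
    exact h1
  let φ : AdjoinRoot G →+* AdjoinRoot f := AdjoinRoot.lift _ _ hroot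
  have hφ : ∀ q : Polynomial ℤ, φ (AdjoinRoot.mk G q) = AdjoinRoot.mk f (q.map (Int.castRingHom (ZMod p))) := by
    intro q
    rw [AdjoinRoot.lift_mk, ← Polynomial.eval₂_map, ← AdjoinRoot.aeval_eq, Polynomial.aeval_def]
    rfl
  have hsurj : Function.Surjective φ := by
    intro y
    obtain ⟨q, rfl⟩ := AdjoinRoot.mk_surjective y
    obtain ⟨r, rfl⟩ := Polynomial.map_surjective (Int.castRingHom (ZMod p)) (ZMod.ringHom_surjective _) q
    exact ⟨AdjoinRoot.mk G r, hφ r⟩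
  have hle : (Ideal.span {AdjoinRoot.mk G (pol v)}).toAddSubgroup ≤ (φ : AdjoinRoot G →+ AdjoinRoot f).ker := by
    intro y hy
    rw [Submodule.mem_toAddSubgroup, Ideal.mem_span_singleton] at hy
    obtain ⟨c, rfl⟩ := hy
    rw [AddMonoidHom.mem_ker]
    change φ _ = 0
    rw [map_mul, hφ, AdjoinRoot.mk_eq_zero.2 h2, zero_mul]
  have hidx := AddSubgroup.index_dvd_of_le hle
  have h3 : (Ideal.span {AdjoinRoot.mk G (pol v)}).toAddSubgroup.index = (nf G v).natAbs :=
    card_quotient_span_singleton hx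
  have h4 : (φ : AdjoinRoot G →+ AdjoinRoot f).ker.index = p ^ f.natDegree := by
    have hr : (φ : AdjoinRoot G →+ AdjoinRoot f).range = ⊤ := AddMonoidHom.range_eq_top.2 hsurj
    rw [AddSubgroup.index_ker, hr]
    have e := Nat.card_congr (AdjoinRoot.powerBasis' hf).basis.equivFun.toEquiv
    rw [Nat.card_fun, Nat.card_zmod, Nat.card_fin] at e
    simpa using e
  rw [h3, h4] at hidx
  have h5 : p ^ 2 ∣ (nf G v).natAbs := (pow_dvd_pow p hdeg).trans hidx
  exact_mod_cast Int.natCast_dvd.2 h5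

theorem not_isCoprime_of_dvd_nf {G : Polynomial ℤ} (hG : G.Monic) {m : ℕ} 
    {v : Fin m → ℤ} {p : ℕ} [Fact p.Prime] (hp : (p : ℤ) ∣ nf G v) :
    ¬ IsCoprime ((pol v).map (Int.castRingHom (ZMod p))) (G.map (Int.castRingHom (ZMod p))) := by
  rintro ⟨a, b, hab⟩
  have hs := Polynomial.map_surjective (Int.castRingHom (ZMod p)) (ZMod.ringHom_surjective _)
  obtain ⟨A, rfl⟩ := hs a
  obtain ⟨B, rfl⟩ := hs b
  have h1 : (A * pol v + B * G - 1).map (Int.castRingHom (ZMod p)) = 0 := by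
    simp [hab]
  have h2 : Polynomial.C (p : ℤ) ∣ A * pol v + B * G - 1 := by
    rw [Polynomial.C_dvd_iff_dvd_coeff]
    intro i
    have := congrArg (fun q => Polynomial.coeff q i) h1
    simp only [Polynomial.coeff_map, Polynomial.coeff_zero, eq_intCast] at this
    exact (ZMod.intCast_zmod_eq_zero_iff_dvd _ _).1 this
  obtain ⟨c, hc⟩ := h2
  have h3 : AdjoinRoot.mk G A * AdjoinRoot.mk G (pol v) = 1 + (p : ℤ) • AdjoinRoot.mk G c := by
    have := congrArg (AdjoinRoot.mk G) hc
    simp only [map_sub, map_add, map_mul, AdjoinRoot.mk_self, mul_zero, add_zero, map_one] at this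
    rw [sub_eq_iff_eq_add] at this
    rw [this, zsmul_eq_mul]
    simp [add_comm]
  let bs : Module.Basis (Fin G.natDegree) ℤ (AdjoinRoot G) := (AdjoinRoot.powerBasis' hG).basis
  have h4 := congrArg (Algebra.norm ℤ) h3
  rw [map_mul, Algebra.norm_eq_matrix_det bs (1 + _)] at h4
  have h5 : (Algebra.leftMulMatrix bs (1 + (p : ℤ) • AdjoinRoot.mk G c)).det
      ≡ (1 : Matrix (Fin G.natDegree) (Fin G.natDegree) ℤ).det [ZMOD p] := by
    have := congPres_det ![Algebra.leftMulMatrix bs 1, Algebra.leftMulMatrix bs (AdjoinRoot.mk G c)]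
      p ![1, (p : ℤ)] ![1, 0] (by intro i; fin_cases i <;> simp)
    simp only [Fin.sum_univ_two, Matrix.cons_val_zero, Matrix.cons_val_one, one_smul, zero_smul, add_zero] at this
    have := (Int.modEq_iff_dvd.2 this).symm
    rw [map_add, map_zsmul]
    rw [map_one] at this
    rwa [map_one]
  rw [← h4, Matrix.det_one] at h5
  have h6 := h5.dvd.mul_left 1
  have h7 : (p : ℤ) ∣ 1 := by
    have := dvd_add h6 ((hp.mul_left (Algebra.norm ℤ (AdjoinRoot.mk G A))))
    simpa [nf] using this
  have hp1 := (Fact.out : p.Prime)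
  exact hp1.one_lt.ne' (by exact_mod_cast Int.eq_one_of_dvd_one (by positivity) h7)

theorem exists_monic_dvd_of_dvd_nf {G : Polynomial ℤ} (hG : G.Monic) {m : ℕ} 
    {v : Fin m → ℤ} {p : ℕ} [Fact p.Prime] (hp : (p : ℤ) ∣ nf G v) :
    ∃ f : Polynomial (ZMod p), f.Monic ∧ 1 ≤ f.natDegree ∧ f ∣ G.map (Int.castRingHom (ZMod p)) ∧
      f ∣ (pol v).map (Int.castRingHom (ZMod p)) := by
  have h := not_isCoprime_of_dvd_nf hG hp
  have hG0 : G.map (Int.castRingHom (ZMod p)) ≠ 0 := (hG.map _).ne_zero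
  set d := EuclideanDomain.gcd ((pol v).map (Int.castRingHom (ZMod p))) (G.map (Int.castRingHom (ZMod p))) with hd
  have hu : ¬ IsUnit d := fun h' => h (EuclideanDomain.gcd_isUnit_iff.1 h')
  have hd0 : d ≠ 0 := fun h' => hG0 (EuclideanDomain.gcd_eq_zero_iff.1 h').2
  have hass : Associated (normalize d) d := normalize_associated d
  refine ⟨normalize d, Polynomial.monic_normalize hd0, ?_, ?_, ?_⟩
  · by_contra hlt
    have h0 : (normalize d).natDegree = 0 := by omega
    have := (Polynomial.monic_normalize hd0).natDegree_eq_zero.1 h0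
    rw [this] at hass
    exact hu (hass.isUnit isUnit_one)
  · exact hass.dvd.trans (EuclideanDomain.gcd_dvd_right _ _)
  · exact hass.dvd.trans (EuclideanDomain.gcd_dvd_left _ _)

theorem exists_root_of_dvd_nf {G : Polynomial ℤ} (hG : G.Monic) (hirr : Irreducible G) {m : ℕ}
    (hm : m ≤ G.natDegree) {v : Fin m → ℤ} (hv : v ≠ 0)
    (h : ∀ (p : ℕ) [Fact p.Prime], (p : ℤ) ∣ nf G v → ∀ f : Polynomial (ZMod p), f.Monic →
      f ∣ G.map (Int.castRingHom (ZMod p)) → f ∣ (pol v).map (Int.castRingHom (ZMod p)) → f.natDegree < 2) :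
    ∃ n : ℤ, nf G v ∣ G.eval n ∧ nf G v ∣ (pol v).eval n := by
  have := adjoinRoot_isDomain hirr
  have := hG.free_adjoinRoot
  have := hG.finite_adjoinRoot
  have hx := mk_pol_ne_zero hG hm hv
  set x := AdjoinRoot.mk G (pol v) with hxdef
  have key : ∀ p : ℕ, p.Prime → (p : ℤ) ∣ Algebra.norm ℤ x → ∀ q : AdjoinRoot G,
      ∃ (a : ℤ) (c : AdjoinRoot G), q - a - p * c ∈ Ideal.span {x} := by
    intro p hp hpd q
    have : Fact p.Prime := ⟨hp⟩
    have hG0 : G.map (Int.castRingHom (ZMod p)) ≠ 0 := (hG.map _).ne_zero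
    set d := EuclideanDomain.gcd ((pol v).map (Int.castRingHom (ZMod p))) (G.map (Int.castRingHom (ZMod p))) with hd
    have hd0 : d ≠ 0 := fun h' => hG0 (EuclideanDomain.gcd_eq_zero_iff.1 h').2
    have hass : Associated (normalize d) d := normalize_associated d
    have hmon := Polynomial.monic_normalize hd0
    have hdeg := h p hpd (normalize d) hmon
      (hass.dvd.trans (EuclideanDomain.gcd_dvd_right _ _)) (hass.dvd.trans (EuclideanDomain.gcd_dvd_left _ _))
    obtain ⟨r, hr⟩ : ∃ r : ZMod p, d ∣ Polynomial.X - Polynomial.C r := by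
      rcases Nat.lt_succ_iff_lt_or_eq.1 hdeg with h0 | h1
      · have h2 : normalize d = 1 := Polynomial.eq_one_of_monic_natDegree_zero hmon (by omega)
        exact ⟨0, hass.dvd'.trans (by rw [h2]; exact one_dvd _)⟩
      · obtain ⟨r, hr⟩ : ∃ r : ZMod p, normalize d = Polynomial.X - Polynomial.C r := by
          refine ⟨-(normalize d).coeff 0, ?_⟩
          have := hmon.eq_X_add_C h1
          rw [this]; simp
        exact ⟨r, hr ▸ hass.dvd'⟩
    obtain ⟨e, he⟩ := hr
    rw [hd, EuclideanDomain.gcd_eq_gcd_ab] at he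
    have hs := Polynomial.map_surjective (Int.castRingHom (ZMod p)) (ZMod.ringHom_surjective _)
    obtain ⟨A, hA⟩ := hs (EuclideanDomain.gcdA ((pol v).map (Int.castRingHom (ZMod p))) (G.map (Int.castRingHom (ZMod p))) * e)
    obtain ⟨B, hB⟩ := hs (EuclideanDomain.gcdB ((pol v).map (Int.castRingHom (ZMod p))) (G.map (Int.castRingHom (ZMod p))) * e)
    obtain ⟨s, hs'⟩ := ZMod.intCast_surjective r
    have h1 : (Polynomial.X - Polynomial.C s - (A * pol v + B * G)).map (Int.castRingHom (ZMod p)) = 0 := by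
      simp only [Polynomial.map_sub, Polynomial.map_add, Polynomial.map_mul, Polynomial.map_X, Polynomial.map_C, hA, hB]
      rw [eq_intCast, hs', he]
      ring
    have h2 : Polynomial.C (p : ℤ) ∣ Polynomial.X - Polynomial.C s - (A * pol v + B * G) := by
      rw [Polynomial.C_dvd_iff_dvd_coeff]
      intro i
      have := congrArg (fun q => Polynomial.coeff q i) h1
      simp only [Polynomial.coeff_map, Polynomial.coeff_zero, eq_intCast] at this
      exact (ZMod.intCast_zmod_eq_zero_iff_dvd _ _).1 this
    obtain ⟨c, hc⟩ := h2
    obtain ⟨Q, rfl⟩ := AdjoinRoot.mk_surjective q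
    have h3 := Polynomial.X_sub_C_dvd_sub_C_eval (a := s) (p := Q)
    obtain ⟨E, hE⟩ := h3
    refine ⟨Q.eval s, AdjoinRoot.mk G (c * E), ?_⟩
    rw [Ideal.mem_span_singleton]
    have h4 : Q - Polynomial.C (Q.eval s) - Polynomial.C (p : ℤ) * (c * E) = pol v * (A * E) + G * (B * E) := by
      rw [hE]; linear_combination E * hc
    have h5 := congrArg (AdjoinRoot.mk G) h4
    simp only [map_sub, map_add, map_mul, AdjoinRoot.mk_self, zero_mul, add_zero] at h5
    refine ⟨AdjoinRoot.mk G (A * E), ?_⟩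
    rw [hxdef, map_mul _ A E, ← h5, map_mul _ c E]
    simp
  have hall := exists_int_sub_mem_span hx key
  obtain ⟨n, hn⟩ := hall (AdjoinRoot.root G)
  have hev : ∀ q : Polynomial ℤ, AdjoinRoot.mk G q ∈ Ideal.span {x} → Algebra.norm ℤ x ∣ q.eval n := by
    intro q hq
    refine norm_dvd_of_int_mem_span hx hall _ ?_
    obtain ⟨E, hE⟩ := Polynomial.X_sub_C_dvd_sub_C_eval (a := n) (p := q)
    have h5 := congrArg (AdjoinRoot.mk G) hE
    simp only [map_sub, map_mul, AdjoinRoot.mk_X, AdjoinRoot.mk_C] at h5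
    have h6 : ((q.eval n : ℤ) : AdjoinRoot G) = AdjoinRoot.mk G q - (AdjoinRoot.root G - (n : AdjoinRoot G)) * AdjoinRoot.mk G E := by
      simp only [eq_intCast] at h5
      rw [← h5]; simp
    rw [h6]
    exact Ideal.sub_mem _ hq (Ideal.mul_mem_right _ _ hn)
  refine ⟨n, hev G ?_, hev (pol v) (Ideal.mem_span_singleton_self _)⟩
  rw [AdjoinRoot.mk_self]; exact Ideal.zero_mem _

theorem card_filter_dvd_pol_le {m k p : ℕ} [Fact p.Prime] (f : Polynomial (ZMod p)) (hf : f ≠ 0)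
    (hk : k ≤ f.natDegree) :
    ((ibox (0 : Fin m → ℤ) p).filter fun v => f ∣ (pol v).map (Int.castRingHom (ZMod p))).card ≤ p ^ (m - k) := by
  have hcard : (Fintype.piFinset fun _ : {i : Fin m // k ≤ (i : ℕ)} => Finset.Ico (0 : ℤ) p).card = p ^ (m - k) := by
    rw [Fintype.card_piFinset]
    have h1 : Fintype.card {i : Fin m // k ≤ (i : ℕ)} = m - k := by
      rw [Fintype.card_subtype, ← Finset.card_map Fin.valEmbedding]
      have : ((Finset.univ.filter fun i : Fin m => k ≤ (i : ℕ)).map Fin.valEmbedding) = Finset.Ico k m := by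
        ext a
        simp only [Finset.mem_map, Finset.mem_filter, Finset.mem_univ, true_and, Fin.valEmbedding_apply, Finset.mem_Ico]
        constructor
        · rintro ⟨i, h, rfl⟩; exact ⟨h, i.2⟩
        · rintro ⟨h1, h2⟩; exact ⟨⟨a, h2⟩, h1, rfl⟩
      rw [this, Nat.card_Ico]
    simp [h1]
  rw [← hcard]
  refine Finset.card_le_card_of_injOn (fun v i => v i.1) ?_ ?_
  · intro v hv
    rw [Finset.mem_coe, Finset.mem_filter, mem_ibox] at hv
    simp only [Finset.mem_coe, Fintype.mem_piFinset, Finset.mem_Ico]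
    intro i
    simpa using hv.1 i.1
  · intro v hv w hw hvw
    rw [Finset.mem_coe, Finset.mem_filter, mem_ibox] at hv hw
    have h1 : f ∣ (pol (v - w)).map (Int.castRingHom (ZMod p)) := by
      rw [pol_sub, Polynomial.map_sub]; exact dvd_sub hv.2 hw.2
    have h2 : (pol (v - w)).degree < k := by
      rw [Polynomial.degree_lt_iff_coeff_zero]
      intro i hi
      by_cases him : i < m
      · have := congrFun hvw ⟨⟨i, him⟩, hi⟩
        have e := coeff_pol (v - w) ⟨i, him⟩
        simp only at e
        rw [e, Pi.sub_apply, sub_eq_zero]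
        exact this
      · refine Polynomial.coeff_eq_zero_of_degree_lt ((degree_pol_lt _).trans_le ?_)
        exact_mod_cast not_lt.1 him
    have h3 : (pol (v - w)).map (Int.castRingHom (ZMod p)) = 0 := by
      by_contra h0
      have a1 := Polynomial.degree_le_of_dvd h1 h0
      have a2 := a1.trans_lt ((Polynomial.degree_map_le).trans_lt h2)
      rw [Polynomial.degree_eq_natDegree hf] at a2
      have : f.natDegree < k := by exact_mod_cast a2
      omega
    funext i
    have h4 := congrArg (fun q => Polynomial.coeff q (i : ℕ)) h3
    simp only [Polynomial.coeff_map, Polynomial.coeff_zero, eq_intCast, coeff_pol] at h4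
    rw [ZMod.intCast_zmod_eq_zero_iff_dvd] at h4
    have a1 := hv.1 i
    have a2 := hw.1 i
    simp at a1 a2
    have h5 : |(v - w) i| < (p : ℤ) := by
      rw [Pi.sub_apply, abs_lt]; constructor <;> linarith
    have := Int.eq_zero_of_abs_lt_dvd h4 h5
    rw [Pi.sub_apply] at this
    linarith

/-- the monic divisors of a polynomial over a field -/
noncomputable def monicDivisors {K : Type*} [Field K] (q : Polynomial K) : Finset (Polynomial K) :=
  ((UniqueFactorizationMonoid.normalizedFactors q).powerset.map Multiset.prod).toFinset

theorem card_monicDivisors_le {K : Type*} [Field K] {q : Polynomial K} (hq : q ≠ 0) :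
    (monicDivisors q).card ≤ 2 ^ q.natDegree := by
  refine (Multiset.toFinset_card_le _).trans ?_
  rw [Multiset.card_map, Multiset.card_powerset]
  refine Nat.pow_le_pow_right (by norm_num) ?_
  have h1 := UniqueFactorizationMonoid.prod_normalizedFactors hq
  have h2 := Polynomial.natDegree_eq_of_degree_eq (Polynomial.degree_eq_degree_of_associated h1)
  rw [← h2, Polynomial.natDegree_multiset_prod _ (UniqueFactorizationMonoid.zero_notMem_normalizedFactors q),
    ← Multiset.card_map Polynomial.natDegree]
  have h3 : ∀ n ∈ (UniqueFactorizationMonoid.normalizedFactors q).map Polynomial.natDegree, 1 ≤ n := by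
    intro n hn
    obtain ⟨a, ha, rfl⟩ := Multiset.mem_map.1 hn
    exact (UniqueFactorizationMonoid.irreducible_of_normalized_factor a ha).natDegree_pos
  simpa using Multiset.card_nsmul_le_sum h3

theorem mem_monicDivisors {K : Type*} [Field K] {q f : Polynomial K} (hq : q ≠ 0) (hf : f.Monic) (hfq : f ∣ q) :
    f ∈ monicDivisors q := by
  rw [monicDivisors, Multiset.mem_toFinset, Multiset.mem_map]
  refine ⟨UniqueFactorizationMonoid.normalizedFactors f, ?_, ?_⟩
  · rw [Multiset.mem_powerset]
    exact (UniqueFactorizationMonoid.dvd_iff_normalizedFactors_le_normalizedFactors hf.ne_zero hq).1 hfq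
  · rw [UniqueFactorizationMonoid.prod_normalizedFactors_eq hf.ne_zero]
    exact hf.normalize_eq_self

theorem polyRho_eq (F : Polynomial ℤ) (d : ℕ) :
    polyRho F d = ((Finset.range d).filter fun n : ℕ => (d : ℤ) ∣ F.eval (n : ℤ)).card := by
  rw [polyRho, eq_comm]
  refine Finset.card_bij (fun n _ => (n : ℤ)) ?_ ?_ ?_
  · intro n hn
    rw [Finset.mem_filter] at hn ⊢
    refine ⟨?_, hn.2⟩
    simp only [Finset.bind_def, Finset.mem_sup]
    exact ⟨n, hn.1, by simp⟩
  · intro a _ b _ h; exact_mod_cast h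
  · intro b hb
    rw [Finset.mem_filter] at hb
    obtain ⟨h1, h2⟩ := hb
    simp only [Finset.bind_def, Finset.mem_sup] at h1
    obtain ⟨n, hn, hb⟩ := h1
    have : b = n := by simpa using hb
    subst this
    exact ⟨n, Finset.mem_filter.2 ⟨hn, h2⟩, rfl⟩

theorem numZeros_nf_le {G : Polynomial ℤ} (hG : G.Monic) {m p : ℕ} [Fact p.Prime] :
    numZeros (nf G : (Fin m → ℤ) → ℤ) p ≤ polyRho G p * p ^ (m - 1) + 2 ^ G.natDegree * p ^ (m - 2) := by
  have hp := (Fact.out : p.Prime)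
  set Gp := G.map (Int.castRingHom (ZMod p)) with hGp
  have hG0 : Gp ≠ 0 := (hG.map _).ne_zero
  have hsub : ((ibox (0 : Fin m → ℤ) p).filter fun v => (p : ℤ) ∣ nf G v) ⊆
      (((Finset.range p).filter fun n : ℕ => (p : ℤ) ∣ G.eval (n : ℤ)).biUnion fun n : ℕ =>
        (ibox (0 : Fin m → ℤ) p).filter fun v => (Polynomial.X - Polynomial.C (n : ZMod p)) ∣ (pol v).map (Int.castRingHom (ZMod p)))
      ∪ ((monicDivisors Gp).filter fun f => f ≠ 0 ∧ 2 ≤ f.natDegree).biUnion fun f =>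
        (ibox (0 : Fin m → ℤ) p).filter fun v => f ∣ (pol v).map (Int.castRingHom (ZMod p)) := by
    intro v hv
    rw [Finset.mem_filter] at hv
    obtain ⟨f, hf, hdeg, hfG, hfv⟩ := exists_monic_dvd_of_dvd_nf hG hv.2
    rw [Finset.mem_union, Finset.mem_biUnion, Finset.mem_biUnion]
    by_cases h2 : 2 ≤ f.natDegree
    · right
      exact ⟨f, Finset.mem_filter.2 ⟨mem_monicDivisors hG0 hf hfG, hf.ne_zero, h2⟩, Finset.mem_filter.2 ⟨hv.1, hfv⟩⟩
    · left
      have h1 : f.natDegree = 1 := by omega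
      have hfe := hf.eq_X_add_C h1
      set r : ZMod p := -f.coeff 0 with hr
      have hfe' : f = Polynomial.X - Polynomial.C ((r.val : ℕ) : ZMod p) := by
        rw [ZMod.natCast_zmod_val, hr]; rw [hfe]; simp
      refine ⟨r.val, Finset.mem_filter.2 ⟨Finset.mem_range.2 (ZMod.val_lt r), ?_⟩, Finset.mem_filter.2 ⟨hv.1, hfe' ▸ hfv⟩⟩
      rw [← eval_cast_eq_zero_iff, Int.cast_natCast, ← Polynomial.IsRoot.def, ← Polynomial.dvd_iff_isRoot]
      exact hfe' ▸ hfG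
  refine (Finset.card_le_card hsub).trans ((Finset.card_union_le _ _).trans (add_le_add ?_ ?_))
  · rw [polyRho_eq]
    refine Finset.card_biUnion_le_card_mul _ _ (p ^ (m - 1)) fun n _ => ?_
    exact card_filter_dvd_pol_le _ (Polynomial.X_sub_C_ne_zero _) (by rw [Polynomial.natDegree_X_sub_C])
  · refine (Finset.card_biUnion_le_card_mul _ _ (p ^ (m - 2)) fun f hf => ?_).trans ?_
    · rw [Finset.mem_filter] at hf
      exact card_filter_dvd_pol_le _ hf.2.1 hf.2.2
    · refine Nat.mul_le_mul_right _ ((Finset.card_filter_le _ _).trans ((card_monicDivisors_le hG0).trans ?_))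
      exact Nat.pow_le_pow_right (by norm_num) Polynomial.natDegree_map_le

theorem congPres_eval (F : Polynomial ℤ) : CongPres fun v : Fin 1 → ℤ => F.eval (v 0) := by
  intro d v w h
  exact (h 0).trans (Polynomial.sub_dvd_eval_sub _ _ F)

theorem polyRho_eq_numZeros (F : Polynomial ℤ) (d : ℕ) :
    polyRho F d = numZeros (fun v : Fin 1 → ℤ => F.eval (v 0)) d := by
  rw [polyRho_eq, numZeros]
  refine Finset.card_bij (fun n _ => fun _ => (n : ℤ)) ?_ ?_ ?_
  · intro n hn
    rw [Finset.mem_filter, Finset.mem_range] at hn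
    rw [Finset.mem_filter, mem_ibox]
    refine ⟨fun i => ?_, hn.2⟩
    have := hn.1
    simp only [Pi.zero_apply]
    omega
  · intro a _ b _ h
    have := congrFun h 0
    exact_mod_cast this
  · intro v hv
    rw [Finset.mem_filter, mem_ibox] at hv
    obtain ⟨h1, h2⟩ := hv
    have := h1 0
    simp only [Pi.zero_apply] at this
    have e : ((v 0).toNat : ℤ) = v 0 := Int.toNat_of_nonneg this.1
    refine ⟨(v 0).toNat, ?_, ?_⟩
    · rw [Finset.mem_filter, Finset.mem_range, e]
      exact ⟨by omega, h2⟩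
    · funext i
      rw [Subsingleton.elim i 0, e]

theorem polyRho_le (F : Polynomial ℤ) (d : ℕ) : polyRho F d ≤ d := by
  rw [polyRho_eq_numZeros]; simpa using numZeros_le (fun v : Fin 1 → ℤ => F.eval (v 0)) d

theorem polyRho_mul (F : Polynomial ℤ) {d e : ℕ} (hd : 0 < d) (he : 0 < e) (h : Nat.Coprime d e) :
    polyRho F (d * e) = polyRho F d * polyRho F e := by
  simp only [polyRho_eq_numZeros]
  exact numZeros_mul (congPres_eval F) hd he h

theorem polyRho_prod (F : Polynomial ℤ) (S : Finset ℕ) (hS : ∀ p ∈ S, p.Prime) :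
    polyRho F (∏ p ∈ S, p) = ∏ p ∈ S, polyRho F p := by
  simp only [polyRho_eq_numZeros]
  exact numZeros_prod (congPres_eval F) S hS

theorem polyRho_prime_le (F : Polynomial ℤ) {p : ℕ} (hp : p.Prime) (h : ¬ (p : ℤ) ∣ F.leadingCoeff) :
    polyRho F p ≤ F.natDegree := by
  have := Fact.mk hp
  rw [polyRho_eq]
  have h0 : F.map (Int.castRingHom (ZMod p)) ≠ 0 := by
    intro h0
    have : (F.map (Int.castRingHom (ZMod p))).coeff F.natDegree = 0 := by rw [h0]; simp
    rw [Polynomial.coeff_map, eq_intCast, ZMod.intCast_zmod_eq_zero_iff_dvd] at this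
    exact h this
  have h1 : (((Finset.range p).filter fun n : ℕ => (p : ℤ) ∣ F.eval (n : ℤ)).image fun n : ℕ => (n : ZMod p)) ⊆
      (F.map (Int.castRingHom (ZMod p))).roots.toFinset := by
    intro z hz
    obtain ⟨n, hn, rfl⟩ := Finset.mem_image.1 hz
    rw [Multiset.mem_toFinset, Polynomial.mem_roots h0, Polynomial.IsRoot]
    have := (eval_cast_eq_zero_iff (p := p) F (n : ℤ)).2 (Finset.mem_filter.1 hn).2
    simpa using this
  rw [← Finset.card_image_of_injOn (f := fun n : ℕ => (n : ZMod p))]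
  · refine (Finset.card_le_card h1).trans ((Multiset.toFinset_card_le _).trans ?_)
    exact (Polynomial.card_roots' _).trans Polynomial.natDegree_map_le
  · intro a ha b hb hab
    have ha := Finset.mem_range.1 (Finset.mem_filter.1 ha).1
    have hb := Finset.mem_range.1 (Finset.mem_filter.1 hb).1
    have := (ZMod.natCast_eq_natCast_iff' a b p).1 hab
    rwa [Nat.mod_eq_of_lt ha, Nat.mod_eq_of_lt hb] at this

theorem eval_integralNormalization (F : Polynomial ℤ) (h : 1 ≤ F.natDegree) (n : ℤ) :
    F.integralNormalization.eval (F.leadingCoeff * n) = F.leadingCoeff ^ (F.natDegree - 1) * F.eval n := by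
  have := Polynomial.integralNormalization_eval₂_leadingCoeff_mul h (RingHom.id ℤ) n
  simpa [Polynomial.eval₂_id] using this

theorem polyRho_integralNormalization (F : Polynomial ℤ) (h : 1 ≤ F.natDegree) {d : ℕ} (hd : 0 < d)
    (hcop : IsCoprime F.leadingCoeff (d : ℤ)) : polyRho F.integralNormalization d = polyRho F d := by
  obtain ⟨u, w, huw⟩ := hcop
  set l := F.leadingCoeff with hl
  have hG : ∀ n : ℤ, (d : ℤ) ∣ F.integralNormalization.eval (l * n) ↔ (d : ℤ) ∣ F.eval n := by
    intro n
    rw [eval_integralNormalization F h n]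
    have hc : IsCoprime (d : ℤ) (l ^ (F.natDegree - 1)) := (IsCoprime.pow_left ⟨u, w, huw⟩).symm
    exact ⟨fun h => hc.dvd_of_dvd_mul_left h, fun h => h.mul_left _⟩
  have hmod : ∀ (Q : Polynomial ℤ) (a b : ℤ), (d : ℤ) ∣ a - b → ((d : ℤ) ∣ Q.eval a ↔ (d : ℤ) ∣ Q.eval b) := by
    intro Q a b hab
    have := hab.trans (Polynomial.sub_dvd_eval_sub a b Q)
    exact (dvd_iff_dvd_of_dvd_sub this)
  have hd' : (0 : ℤ) < d := by exact_mod_cast hd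
  have hnn : ∀ a : ℤ, ((a % d).toNat : ℤ) = a % d := fun a => Int.toNat_of_nonneg (Int.emod_nonneg _ hd'.ne')
  have hlt : ∀ a : ℤ, (a % d).toNat < d := fun a => by
    have := Int.emod_lt_of_pos a hd'
    have := hnn a
    omega
  have hdv : ∀ a : ℤ, (d : ℤ) ∣ a % d - a := fun a => by
    rw [Int.emod_def]; exact ⟨-(a / d), by ring⟩
  have key : ∀ a b : ℕ, a < d → b < d → (d : ℤ) ∣ (a : ℤ) - b → a = b := by
    intro a b ha hb hab
    have := Int.eq_zero_of_abs_lt_dvd hab (by rw [abs_lt]; constructor <;> omega)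
    omega
  rw [polyRho_eq, polyRho_eq]
  refine Finset.card_nbij' (fun n => ((u * n : ℤ) % d).toNat) (fun n => ((l * n : ℤ) % d).toNat) ?_ ?_ ?_ ?_
  · intro n hn
    simp only [Finset.coe_filter, Finset.mem_range, Set.mem_ofPred_eq] at hn ⊢
    refine ⟨hlt _, ?_⟩
    rw [hnn, hmod F _ _ (hdv _), ← hG, hmod _ _ (n : ℤ)]
    · exact hn.2
    · exact ⟨-(w * n), by linear_combination (n : ℤ) * huw⟩
  · intro n hn
    simp only [Finset.coe_filter, Finset.mem_range, Set.mem_ofPred_eq] at hn ⊢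
    refine ⟨hlt _, ?_⟩
    rw [hnn, hmod _ _ _ (hdv _), hG]
    exact hn.2
  · intro n hn
    have hn := Finset.mem_range.1 (Finset.mem_filter.1 hn).1
    refine key _ _ (hlt _) hn ?_
    simp only [hnn]
    obtain ⟨a, ha⟩ := hdv (l * ((u * n) % d))
    obtain ⟨b, hb⟩ := hdv (u * n)
    exact ⟨a + l * b - w * n, by linear_combination ha + l * hb + (n : ℤ) * huw⟩
  · intro n hn
    have hn := Finset.mem_range.1 (Finset.mem_filter.1 hn).1
    refine key _ _ (hlt _) hn ?_
    simp only [hnn]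
    obtain ⟨a, ha⟩ := hdv (u * ((l * n) % d))
    obtain ⟨b, hb⟩ := hdv (l * n)
    exact ⟨a + u * b - w * n, by linear_combination ha + u * hb + (n : ℤ) * huw⟩

theorem irreducible_integralNormalization {F : Polynomial ℤ} (hF : Irreducible F) (h : 1 ≤ F.natDegree) :
    Irreducible F.integralNormalization := by
  have hm : F.integralNormalization.Monic := Polynomial.monic_integralNormalization hF.ne_zero
  rw [hm.irreducible_iff_irreducible_map_fraction_map (K := ℚ)]
  have hprim := hF.isPrimitive (by omega)
  have hQ := (hprim.irreducible_iff_irreducible_map_fraction_map (K := ℚ)).1 hF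
  have hl : (F.leadingCoeff : ℚ) ≠ 0 := by exact_mod_cast Polynomial.leadingCoeff_ne_zero.2 hF.ne_zero
  let _ : Invertible (F.leadingCoeff : ℚ) := invertibleOfNonzero hl
  rw [← MulEquiv.irreducible_iff (Polynomial.algEquivCMulXAddC (F.leadingCoeff : ℚ) 0)]
  have : Polynomial.algEquivCMulXAddC (F.leadingCoeff : ℚ) 0 (F.integralNormalization.map (algebraMap ℤ ℚ))
      = Polynomial.C ((F.leadingCoeff : ℚ) ^ (F.natDegree - 1)) * F.map (algebraMap ℤ ℚ) := by
    refine Polynomial.funext fun x => ?_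
    have := Polynomial.integralNormalization_eval₂_leadingCoeff_mul h (algebraMap ℤ ℚ) x
    rw [← Polynomial.eval_map, ← Polynomial.eval_map] at this
    simpa [Polynomial.algEquivCMulXAddC, Polynomial.aeval_def, ← Polynomial.comp.eq_1] using this
  rw [this, irreducible_isUnit_mul (Polynomial.isUnit_C.2 (pow_ne_zero _ hl).isUnit)]
  exact hQ

theorem exists_real_nf {G : Polynomial ℤ} (hG : G.Monic) (m : ℕ) :
    ∃ Nr : (Fin m → ℝ) → ℝ, (∀ v : Fin m → ℤ, Nr (fun i => (v i : ℝ)) = nf G v) ∧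
      (∀ (t : ℝ) x, Nr (t • x) = t ^ G.natDegree * Nr x) ∧
      (∀ i : Fin m, (i : ℕ) = 0 → Nr (Pi.single i 1) = 1) ∧
      ∃ Λ : ℝ, 1 ≤ Λ ∧ ∀ x y, ‖x‖ ≤ 2 → ‖y‖ ≤ 2 → |Nr x - Nr y| ≤ Λ * ‖x - y‖ := by
  obtain ⟨M, hM, hM0⟩ := exists_nf_eq_det hG m
  have hC : ContDiff ℝ 1 fun x : Fin m → ℝ => (∑ i, x i • (M i).map (Int.cast : ℤ → ℝ)).det := by
    simp only [Matrix.det_apply]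
    refine ContDiff.sum fun σ _ => ?_
    refine ContDiff.const_smul _ ?_
    refine contDiff_prod fun i _ => ?_
    simp only [Matrix.sum_apply, Matrix.smul_apply]
    fun_prop
  refine ⟨fun x => (∑ i, x i • (M i).map (Int.cast : ℤ → ℝ)).det, fun v => ?_, fun t x => ?_, fun i hi => ?_, ?_⟩
  · rw [hM]
    have := RingHom.map_det (Int.castRingHom ℝ) (∑ i, v i • M i)
    rw [eq_intCast] at this
    rw [this]
    change Matrix.det _ = Matrix.det _
    congr 1
    ext a c
    simp [Matrix.sum_apply, -zsmul_eq_mul]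
  · have : (∑ i, (t • x) i • (M i).map (Int.cast : ℤ → ℝ)) = t • ∑ i, x i • (M i).map (Int.cast : ℤ → ℝ) := by
      rw [Finset.smul_sum]
      refine Finset.sum_congr rfl fun i _ => ?_
      rw [Pi.smul_apply, smul_assoc]
    simp only [this, Matrix.det_smul, Fintype.card_fin]
  · have : (∑ j, (Pi.single i (1 : ℝ) : Fin m → ℝ) j • (M j).map (Int.cast : ℤ → ℝ)) = 1 := by
      rw [Finset.sum_eq_single i]
      · rw [hM0 i hi]; simp
      · intro b _ hb
        simp [hb]
      · simp
    simp only [this, Matrix.det_one]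
  · obtain ⟨K, hK⟩ := (hC.locallyLipschitz.locallyLipschitzOn (s := Metric.closedBall 0 2)).exists_lipschitzOnWith_of_compact
      (isCompact_closedBall _ _)
    refine ⟨max K 1, le_max_right _ _, fun x y hx hy => ?_⟩
    have := hK.dist_le_mul x (by simpa using hx) y (by simpa using hy)
    rw [Real.dist_eq, dist_eq_norm] at this
    exact this.trans (mul_le_mul_of_nonneg_right (le_max_left _ _) (norm_nonneg _))

theorem exists_abs_nf_le {G : Polynomial ℤ} (hG : G.Monic) (hg : 1 ≤ G.natDegree) (m : ℕ) :
    ∃ c : ℕ, 1 ≤ c ∧ ∀ (v : Fin m → ℤ) (B : ℝ), 0 ≤ B → (∀ i, |(v i : ℝ)| ≤ B) → |(nf G v : ℝ)| ≤ c * B ^ G.natDegree := by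
  obtain ⟨Nr, h1, h2, -, Λ, hΛ, h3⟩ := exists_real_nf hG m
  refine ⟨⌈Λ⌉₊, Nat.ceil_pos.2 (by linarith), fun v B hB hv => ?_⟩
  have h0 : Nr 0 = 0 := by
    have := h2 0 0
    rwa [zero_pow (by omega), zero_mul, smul_zero] at this
  have hu : ∀ u : Fin m → ℝ, ‖u‖ ≤ 1 → |Nr u| ≤ Λ := by
    intro u hu
    have := h3 u 0 (by linarith) (by simp)
    rw [h0, sub_zero, sub_zero] at this
    nlinarith [norm_nonneg u]
  set x : Fin m → ℝ := fun i => (v i : ℝ) with hx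
  have hxB : ‖x‖ ≤ B := (pi_norm_le_iff_of_nonneg hB).2 fun i => by simpa using hv i
  rw [← h1, ← hx]
  rcases hB.eq_or_lt with rfl | hB
  · have : x = 0 := by simpa using hxB
    rw [this, h0]; simp [zero_pow (show G.natDegree ≠ 0 by omega)]
  · have e : x = B • (B⁻¹ • x) := by rw [smul_smul, mul_inv_cancel₀ hB.ne', one_smul]
    have h4 : |Nr (B⁻¹ • x)| ≤ Λ := by
      apply hu
      rw [norm_smul, norm_inv, Real.norm_of_nonneg hB.le]
      rw [inv_mul_le_iff₀ hB]; linarith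
    rw [e, h2, abs_mul, abs_pow, abs_of_pos hB, mul_comm]
    exact mul_le_mul_of_nonneg_right (h4.trans (Nat.le_ceil _)) (by positivity)

theorem exists_pow_le_lt {g : ℕ} (hg : 1 ≤ g) (d : ℕ) : ∃ B : ℕ, B ^ g ≤ d ∧ d < (B + 1) ^ g := by
  induction d with
  | zero => exact ⟨0, by simp; omega, by simp⟩
  | succ d ih =>
    obtain ⟨B, h1, h2⟩ := ih
    by_cases h : d + 1 < (B + 1) ^ g
    · exact ⟨B, by omega, h⟩
    · refine ⟨B + 1, by omega, ?_⟩
      have : (B + 1) ^ g < (B + 1 + 1) ^ g := Nat.pow_lt_pow_left (by omega) (by omega)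
      omega

theorem exists_short_vector {g d B : ℕ} (hd : 0 < d) (hB : d < (B + 1) ^ g) (n : ℤ) :
    ∃ w : Fin g → ℤ, w ≠ 0 ∧ (∀ i, |w i| ≤ B) ∧ (d : ℤ) ∣ (pol w).eval n := by
  have hd' : (0 : ℤ) < d := by exact_mod_cast hd
  obtain ⟨u, hu, u', hu', hne, he⟩ := Finset.exists_ne_map_eq_of_card_lt_of_maps_to
    (s := ibox (0 : Fin g → ℤ) (B + 1)) (t := Finset.Ico (0 : ℤ) d) (f := fun u => (pol u).eval n % d)
    (by rw [card_ibox]; simpa using hB) (fun u _ => by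
      simp only [Finset.coe_Ico, Set.mem_Ico]
      exact ⟨Int.emod_nonneg _ hd'.ne', Int.emod_lt_of_pos _ hd'⟩)
  rw [mem_ibox] at hu hu'
  refine ⟨u - u', sub_ne_zero.2 hne, fun i => ?_, ?_⟩
  · have h1 := hu i
    have h2 := hu' i
    simp only [Pi.zero_apply, Pi.sub_apply] at h1 h2 ⊢
    push_cast at h1 h2
    rw [abs_le]; constructor <;> omega
  · rw [pol_sub, Polynomial.eval_sub]
    exact Int.ModEq.dvd he.symm

theorem sq_dvd_nf_of_two_roots {G : Polynomial ℤ} (hG : G.Monic) (hirr : Irreducible G) {m : ℕ}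
    {w : Fin m → ℤ} {p : ℕ} (hp : p.Prime) {n n' : ℤ} (hn : ¬ (p : ℤ) ∣ n - n') (h1 : (p : ℤ) ∣ G.eval n)
    (h2 : (p : ℤ) ∣ G.eval n') (h3 : (p : ℤ) ∣ (pol w).eval n) (h4 : (p : ℤ) ∣ (pol w).eval n') :
    (p : ℤ) ^ 2 ∣ nf G w := by
  have := Fact.mk hp
  have hne : (n : ZMod p) ≠ (n' : ZMod p) := by
    intro h
    rw [← sub_eq_zero, ← Int.cast_sub, ZMod.intCast_zmod_eq_zero_iff_dvd] at h
    exact hn h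
  have hcop : IsCoprime (Polynomial.X - Polynomial.C (n : ZMod p)) (Polynomial.X - Polynomial.C (n' : ZMod p)) :=
    Polynomial.isCoprime_X_sub_C_of_isUnit_sub (sub_ne_zero.2 hne).isUnit
  have hdv : ∀ Q : Polynomial ℤ, (p : ℤ) ∣ Q.eval n → (p : ℤ) ∣ Q.eval n' →
      (Polynomial.X - Polynomial.C (n : ZMod p)) * (Polynomial.X - Polynomial.C (n' : ZMod p)) ∣
        Q.map (Int.castRingHom (ZMod p)) := by
    intro Q ha hb
    refine hcop.mul_dvd ?_ ?_
    · rw [Polynomial.dvd_iff_isRoot]; exact (eval_cast_eq_zero_iff Q n).2 ha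
    · rw [Polynomial.dvd_iff_isRoot]; exact (eval_cast_eq_zero_iff Q n').2 hb
  refine sq_dvd_nf hG hirr ((Polynomial.monic_X_sub_C _).mul (Polynomial.monic_X_sub_C _)) ?_ (hdv _ h1 h2) (hdv _ h3 h4)
  rw [(Polynomial.monic_X_sub_C _).natDegree_mul (Polynomial.monic_X_sub_C _), Polynomial.natDegree_X_sub_C,
    Polynomial.natDegree_X_sub_C]

/-- Roots of `G` to squarefree moduli are, on average, boundedly many. -/
theorem sum_polyRho_le {G : Polynomial ℤ} (hG : G.Monic) (hirr : Irreducible G) (hg : 1 ≤ G.natDegree) :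
    ∃ D₀ C : ℕ, ∀ D v X : ℕ, D₀ ≤ D → 1 ≤ X →
      ∑ S ∈ (prs D v).powerset.filter (fun S => ∏ p ∈ S, p ≤ X), polyRho G (∏ p ∈ S, p) ≤ C * X := by
  obtain ⟨c, hc1, hc⟩ := exists_abs_nf_le hG hg G.natDegree
  refine ⟨c, 3 ^ G.natDegree * (2 * c + 1), fun D v X hD hX => ?_⟩
  obtain ⟨BX, hBX1, hBX2⟩ := exists_pow_le_lt hg X
  have hprime : ∀ {S : Finset ℕ}, S ⊆ prs D v → ∀ p ∈ S, p.Prime := fun h p hp => (mem_prs.1 (h hp)).2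
  have hpos : ∀ {S : Finset ℕ}, S ⊆ prs D v → 0 < ∏ p ∈ S, p := fun h => Finset.prod_pos fun p hp => (hprime h p hp).pos
  set s : Finset (Σ _ : Finset ℕ, ℕ) := ((prs D v).powerset.filter (fun S => ∏ p ∈ S, p ≤ X)).sigma fun S =>
    (Finset.range (∏ p ∈ S, p)).filter fun n : ℕ => ((∏ p ∈ S, p : ℕ) : ℤ) ∣ G.eval (n : ℤ) with hs
  have hcard : ∑ S ∈ (prs D v).powerset.filter (fun S => ∏ p ∈ S, p ≤ X), polyRho G (∏ p ∈ S, p) = s.card := by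
    rw [hs, Finset.card_sigma]
    exact Finset.sum_congr rfl fun S _ => polyRho_eq G _
  rw [hcard]
  let t : Finset ((Fin G.natDegree → ℤ) × ℤ) := ibox (fun _ => -(BX : ℤ)) (2 * BX + 1) ×ˢ Finset.Icc (-(c : ℤ)) c
  have ht : t.card ≤ 3 ^ G.natDegree * (2 * c + 1) * X := by
    have hB1 : 1 ≤ BX := by
      by_contra h
      have : BX = 0 := by omega
      rw [this] at hBX2
      simp at hBX2
      omega
    rw [Finset.card_product, card_ibox]
    have h1 : (Finset.Icc (-(c : ℤ)) c).card = 2 * c + 1 := by rw [Int.card_Icc]; omega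
    rw [h1]
    have h2 : (2 * BX + 1) ^ G.natDegree ≤ 3 ^ G.natDegree * X := by
      calc (2 * BX + 1) ^ G.natDegree ≤ (3 * BX) ^ G.natDegree := Nat.pow_le_pow_left (by omega) _
        _ = 3 ^ G.natDegree * BX ^ G.natDegree := mul_pow _ _ _
        _ ≤ _ := Nat.mul_le_mul_left _ hBX1
    calc _ ≤ 3 ^ G.natDegree * X * (2 * c + 1) := Nat.mul_le_mul_right _ h2
      _ = _ := by ring
  refine le_trans ?_ ht
  refine Finset.card_le_card_of_forall_subsingleton
    (fun a b => b.2 ≠ 0 ∧ nf G b.1 = b.2 * ((∏ p ∈ a.1, p : ℕ) : ℤ) ∧ ((∏ p ∈ a.1, p : ℕ) : ℤ) ∣ (pol b.1).eval (a.2 : ℤ)) ?_ ?_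
  · rintro ⟨S, n⟩ ha
    simp only [hs, Finset.mem_sigma, Finset.mem_filter, Finset.mem_powerset, Finset.mem_range] at ha
    obtain ⟨⟨hS, hSX⟩, hn, hdn⟩ := ha
    set d := ∏ p ∈ S, p with hd
    have hd0 : 0 < d := hpos hS
    obtain ⟨B, hB1, hB2⟩ := exists_pow_le_lt hg d
    obtain ⟨w, hw0, hwB, hw⟩ := exists_short_vector hd0 hB2 (n : ℤ)
    have hBB : B ≤ BX := by
      by_contra h
      have : (BX + 1) ^ G.natDegree ≤ B ^ G.natDegree := Nat.pow_le_pow_left (by omega) _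
      omega
    obtain ⟨k, hk⟩ := dvd_nf_of_dvd_eval hG hirr hdn hw
    have hnf := nf_ne_zero hG hirr le_rfl hw0
    have hk0 : k ≠ 0 := by rintro rfl; simp at hk; exact hnf hk
    have hkc : |(k : ℝ)| ≤ c := by
      have h1 := hc w B (by positivity) (fun i => by exact_mod_cast hwB i)
      rw [hk] at h1
      push_cast at h1
      rw [abs_mul, Nat.abs_cast] at h1
      have h2 : (B : ℝ) ^ G.natDegree ≤ d := by exact_mod_cast hB1
      have h3 : (0 : ℝ) < d := by exact_mod_cast hd0
      have h4 : (d : ℝ) * |(k : ℝ)| ≤ d * c := by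
        calc _ ≤ _ := h1
          _ ≤ c * d := by gcongr
          _ = _ := mul_comm _ _
      exact le_of_mul_le_mul_left h4 h3
    have hkc' : |k| ≤ c := by exact_mod_cast hkc
    refine ⟨(w, k), ?_, hk0, by rw [hk, mul_comm], hw⟩
    rw [Finset.mem_product, mem_ibox, Finset.mem_Icc]
    refine ⟨fun i => ?_, abs_le.1 hkc'⟩
    have := abs_le.1 (hwB i)
    push_cast
    constructor <;> omega
  · rintro ⟨w, k⟩ hb
    have hkc := Finset.mem_Icc.1 (Finset.mem_product.1 hb).2
    simp only at hkc
    rintro ⟨S, n⟩ ha ⟨S', n'⟩ ha'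
    simp only [hs, Finset.mem_sigma, Finset.mem_filter, Finset.mem_powerset, Finset.mem_range] at ha ha'
    obtain ⟨⟨⟨hS, hSX⟩, hn, hdn⟩, hk0, hnf, hw⟩ := ha
    obtain ⟨⟨⟨hS', hSX'⟩, hn', hdn'⟩, -, hnf', hw'⟩ := ha'
    have e : S = S' := by
      refine prod_injOn hS hS' ?_
      have := hnf.symm.trans hnf'
      exact_mod_cast mul_left_cancel₀ hk0 this
    subst e
    have : n = n' := by
      by_contra hnn
      have h1 : ¬ ((∏ p ∈ S, p : ℕ) : ℤ) ∣ (n : ℤ) - n' := by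
        intro h
        change n < ∏ p ∈ S, p at hn
        change n' < ∏ p ∈ S, p at hn'
        have := Int.eq_zero_of_abs_lt_dvd h (by rw [abs_lt]; constructor <;> omega)
        omega
      rw [prod_primes_dvd_iff S (hprime hS)] at h1
      push Not at h1
      obtain ⟨p, hp, hpn⟩ := h1
      have hpp := hprime hS p hp
      have hpd : (p : ℤ) ∣ ((∏ p ∈ S, p : ℕ) : ℤ) := Int.natCast_dvd_natCast.2 (Finset.dvd_prod_of_mem _ hp)
      have h2 := sq_dvd_nf_of_two_roots hG hirr hpp hpn (hpd.trans hdn) (hpd.trans hdn') (hpd.trans hw) (hpd.trans hw')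
      rw [hnf, ← Finset.mul_prod_erase S _ hp] at h2
      push_cast at h2
      have hp0 : (p : ℤ) ≠ 0 := by exact_mod_cast hpp.ne_zero
      have h3 : (p : ℤ) ∣ k * ∏ q ∈ S.erase p, (q : ℤ) := by
        rw [sq, mul_left_comm] at h2
        exact (mul_dvd_mul_iff_left hp0).1 h2
      have hpi : Prime (p : ℤ) := Nat.prime_iff_prime_int.1 hpp
      rcases hpi.dvd_or_dvd h3 with h4 | h4
      · have h5 := Int.le_of_dvd (abs_pos.2 hk0) ((dvd_abs _ _).2 h4)
        have h6 := (mem_prs.1 (hS hp)).1.1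
        have h7 := abs_le.2 hkc
        omega
      · rw [hpi.dvd_finsetProd_iff] at h4
        obtain ⟨q, hq, hpq⟩ := h4
        rw [Finset.mem_erase] at hq
        have := (Nat.prime_dvd_prime_iff_eq hpp (hprime hS q hq.2)).1 (Int.natCast_dvd_natCast.1 hpq)
        exact hq.1 this.symm
    rw [this]

theorem sum_inv_sq_prs_le (D v : ℕ) : ∑ p ∈ prs D v, ((p : ℝ) ^ 2)⁻¹ ≤ 2 := by
  have h1 := sum_Ioo_inv_sq_le (α := ℝ) 0 (v + 1)
  refine (Finset.sum_le_sum_of_subset_of_nonneg ?_ fun i _ _ => by positivity).trans (h1.trans (by norm_num))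
  intro p hp
  have := mem_prs.1 hp
  rw [Finset.mem_Ioo]
  have := this.2.pos
  omega

theorem polyRho_prime_le_of_monic {G : Polynomial ℤ} (hG : G.Monic) {p : ℕ} (hp : p.Prime) :
    polyRho G p ≤ G.natDegree := by
  refine polyRho_prime_le G hp ?_
  rw [hG.leadingCoeff]
  intro hd
  exact hp.one_lt.ne' (by exact_mod_cast Int.eq_one_of_dvd_one (by positivity) hd)

theorem log_le_of_two_le {v : ℕ} (hv : 2 ≤ v) : (1 : ℝ) / 2 ≤ log v := by
  have h1 : log 2 ≤ log v := log_le_log (by norm_num) (by exact_mod_cast hv)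
  have := Real.log_two_gt_d9
  linarith

theorem sum_polyRho_div_le {G : Polynomial ℤ} (hG : G.Monic) (hirr : Irreducible G) (hg : 1 ≤ G.natDegree) :
    ∃ D₀ : ℕ, ∃ C : ℝ, 0 ≤ C ∧ ∀ D v : ℕ, ∀ Y : ℝ, D₀ ≤ D → 1 ≤ Y →
      ∑ S ∈ (prs D v).powerset.filter (fun S => ((∏ p ∈ S, p : ℕ) : ℝ) ≤ Y),
        (polyRho G (∏ p ∈ S, p) : ℝ) / ((∏ p ∈ S, p : ℕ) : ℝ) ≤ C * (1 + log Y) := by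
  obtain ⟨D₀, C, h⟩ := sum_polyRho_le hG hirr hg
  refine ⟨D₀, 4 * C, by positivity, fun D v Y hD hY => ?_⟩
  set A := (prs D v).powerset.filter (fun S => ((∏ p ∈ S, p : ℕ) : ℝ) ≤ Y) with hA
  have hpos : ∀ S ∈ A, 0 < ∏ p ∈ S, p := fun S hS => Finset.prod_pos fun p hp =>
    (mem_prs.1 (Finset.mem_powerset.1 (Finset.mem_filter.1 hS).1 hp)).2.pos
  have hmaps : ∀ S ∈ A, Nat.log 2 (∏ p ∈ S, p) ∈ Finset.range (Nat.log 2 ⌊Y⌋₊ + 1) := by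
    intro S hS
    rw [Finset.mem_range, Nat.lt_succ_iff]
    exact Nat.log_mono_right (Nat.le_floor (Finset.mem_filter.1 hS).2)
  rw [← Finset.sum_fiberwise_of_maps_to hmaps]
  have hfib : ∀ j ∈ Finset.range (Nat.log 2 ⌊Y⌋₊ + 1), ∑ S ∈ A.filter (fun S => Nat.log 2 (∏ p ∈ S, p) = j),
      (polyRho G (∏ p ∈ S, p) : ℝ) / ((∏ p ∈ S, p : ℕ) : ℝ) ≤ 2 * C := by
    intro j _
    have h1 : ∑ S ∈ A.filter (fun S => Nat.log 2 (∏ p ∈ S, p) = j),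
        (polyRho G (∏ p ∈ S, p) : ℝ) / ((∏ p ∈ S, p : ℕ) : ℝ) ≤
        ∑ S ∈ A.filter (fun S => Nat.log 2 (∏ p ∈ S, p) = j), (polyRho G (∏ p ∈ S, p) : ℝ) / 2 ^ j := by
      refine Finset.sum_le_sum fun S hS => ?_
      rw [Finset.mem_filter] at hS
      have h2 : 2 ^ j ≤ ∏ p ∈ S, p := by
        rw [← hS.2]; exact Nat.pow_log_le_self 2 (hpos S hS.1).ne'
      have h3 : (2 : ℝ) ^ j ≤ ((∏ p ∈ S, p : ℕ) : ℝ) := by exact_mod_cast h2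
      gcongr
    refine h1.trans ?_
    rw [← Finset.sum_div, div_le_iff₀ (by positivity)]
    have h4 := h D v (2 ^ (j + 1)) hD Nat.one_le_two_pow
    have h5 : ∑ S ∈ A.filter (fun S => Nat.log 2 (∏ p ∈ S, p) = j), polyRho G (∏ p ∈ S, p) ≤ C * 2 ^ (j + 1) := by
      refine (Finset.sum_le_sum_of_subset ?_).trans h4
      intro S hS
      rw [Finset.mem_filter, hA, Finset.mem_filter] at hS
      rw [Finset.mem_filter]
      refine ⟨hS.1.1, ?_⟩
      have := Nat.lt_pow_succ_log_self (b := 2) (by norm_num) (∏ p ∈ S, p)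
      rw [hS.2] at this
      exact this.le
    have h6 : ∑ S ∈ A.filter (fun S => Nat.log 2 (∏ p ∈ S, p) = j), (polyRho G (∏ p ∈ S, p) : ℝ) ≤ C * 2 ^ (j + 1) := by
      exact_mod_cast h5
    refine h6.trans (le_of_eq ?_)
    ring
  refine (Finset.sum_le_sum hfib).trans ?_
  rw [Finset.sum_const, Finset.card_range, nsmul_eq_mul]
  have h7 : (Nat.log 2 ⌊Y⌋₊ : ℝ) ≤ 2 * log Y := by
    have hf : ⌊Y⌋₊ ≠ 0 := (Nat.floor_pos.2 hY).ne'
    have h8 : ((2 ^ Nat.log 2 ⌊Y⌋₊ : ℕ) : ℝ) ≤ Y :=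
      (Nat.cast_le.2 (Nat.pow_log_le_self 2 hf)).trans (Nat.floor_le (by linarith))
    have h9 := log_le_log (by positivity) h8
    push_cast at h9
    rw [log_pow] at h9
    have := Real.log_two_gt_d9
    have h10 : (0 : ℝ) ≤ Nat.log 2 ⌊Y⌋₊ := by positivity
    nlinarith
  have hl : 0 ≤ log Y := log_nonneg hY
  push_cast
  nlinarith [Nat.cast_nonneg (α := ℝ) C]

theorem prod_one_add_polyRho_le {G : Polynomial ℤ} (hG : G.Monic) (hirr : Irreducible G) (hg : 1 ≤ G.natDegree) :
    ∃ D₀ : ℕ, ∃ C : ℝ, 0 < C ∧ ∀ D v : ℕ, D₀ ≤ D → 2 ≤ v →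
      ∏ p ∈ prs D v, (1 + (polyRho G p : ℝ) / p) ≤ C * log v := by
  obtain ⟨D₀, C, hC, h⟩ := sum_polyRho_div_le hG hirr hg
  have hg' : (1 : ℝ) ≤ G.natDegree := by exact_mod_cast hg
  refine ⟨D₀, (2 * C + 1) * (10 * G.natDegree), by positivity, fun D v hD hv => ?_⟩
  have hprime : ∀ p ∈ prs D v, p.Prime := fun p hp => (mem_prs.1 hp).2
  have hv' : (2 : ℝ) ≤ v := by exact_mod_cast hv
  have hlv := log_le_of_two_le hv
  set Y : ℝ := ((4 : ℝ) * v) ^ (2 * G.natDegree) with hY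
  have hY1 : 1 < Y := one_lt_pow₀ (by linarith) (by omega)
  have hlY : log Y = 2 * G.natDegree * (log 4 + log v) := by
    rw [hY, log_pow, log_mul (by norm_num) (by positivity)]; push_cast; ring
  have h4 : log 4 ≤ 1.4 := by
    rw [show (4 : ℝ) = 2 ^ 2 by norm_num, log_pow]
    have := Real.log_two_lt_d9
    push_cast; linarith
  have hlc : ∀ p ∈ prs D v, (polyRho G p : ℝ) ≤ G.natDegree := fun p hp =>
    Nat.cast_le.2 (polyRho_prime_le_of_monic hG (hprime p hp))
  have key := sum_powerset_le_two_mul (prs D v) (fun p hp => (hprime p hp).one_le)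
    (fun S => (polyRho G (∏ p ∈ S, p) : ℝ) / ((∏ p ∈ S, p : ℕ) : ℝ)) (fun p => (polyRho G p : ℝ) / p)
    (fun p _ => by positivity) (fun S _ => by positivity)
    (fun S hS p hp hpS => by
      rw [polyRho_prod G _ (fun q hq => hprime q (Finset.insert_subset hp hS hq)),
        polyRho_prod G _ (fun q hq => hprime q (hS hq)), Finset.prod_insert hpS, Finset.prod_insert hpS]
      push_cast
      rw [mul_div_mul_comm]) Y hY1
    (by
      rw [hlY]
      have h1 : ∑ p ∈ prs D v, (polyRho G p : ℝ) / p * log p ≤ ∑ p ∈ prs D v, G.natDegree * (log p / p) := by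
        refine Finset.sum_le_sum fun p hp => ?_
        have : 0 ≤ log (p : ℝ) := log_natCast_nonneg p
        rw [div_mul_eq_mul_div, ← mul_div_assoc]
        gcongr
        exact_mod_cast hlc p hp
      refine h1.trans ?_
      rw [← Finset.mul_sum]
      have h2 := sum_log_div_prs D v (by omega)
      nlinarith)
  have hprod : ∏ p ∈ prs D v, (1 + (polyRho G p : ℝ) / p) = ∑ S ∈ (prs D v).powerset, (polyRho G (∏ p ∈ S, p) : ℝ) / ((∏ p ∈ S, p : ℕ) : ℝ) := by
    rw [Finset.prod_one_add]
    refine Finset.sum_congr rfl fun S hS => ?_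
    rw [polyRho_prod G _ (fun q hq => hprime q (Finset.mem_powerset.1 hS hq))]
    push_cast
    rw [Finset.prod_div_distrib]
  rw [hprod]
  refine key.trans ?_
  have h5 := h D v Y hD hY1.le
  have h6 : 2 * (1 + log Y) ≤ 2 * (10 * G.natDegree * log v) := by
    rw [hlY]; nlinarith
  nlinarith [mul_le_mul_of_nonneg_left h6 hC, mul_nonneg (mul_nonneg (by norm_num : (0:ℝ) ≤ 10) (by linarith : (0:ℝ) ≤ G.natDegree)) (by linarith : (0:ℝ) ≤ log v)]

/-- Mertens-type lower bound for sieve products. -/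
theorem prod_one_sub_ge {G : Polynomial ℤ} (hG : G.Monic) (hirr : Irreducible G) (hg : 1 ≤ G.natDegree) {E : ℝ}
    (hE : 0 ≤ E) : ∃ D₀ : ℕ, ∃ c : ℝ, 0 < c ∧ ∀ D v : ℕ, D₀ ≤ D → 2 ≤ v → ∀ γ : ℕ → ℝ,
      (∀ p ∈ prs D v, γ p ≤ (polyRho G p : ℝ) / p + E / (p : ℝ) ^ 2) → c / log v ≤ ∏ p ∈ prs D v, (1 - γ p) := by
  obtain ⟨D₀, C, hC, h⟩ := prod_one_add_polyRho_le hG hirr hg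
  set K : ℝ := (G.natDegree : ℝ) ^ 2 + 2 * E with hK
  have hK1 : 1 ≤ K := by
    have : (1 : ℝ) ≤ G.natDegree := by exact_mod_cast hg
    nlinarith
  refine ⟨max D₀ ⌈2 * K⌉₊, (C * exp (4 * K))⁻¹, by positivity, fun D v hD hv γ hγ => ?_⟩
  have hprime : ∀ p ∈ prs D v, p.Prime := fun p hp => (mem_prs.1 hp).2
  have hlv := log_le_of_two_le hv
  have h1 := h D v ((le_max_left _ _).trans hD) hv
  have hDK : ∀ p ∈ prs D v, 2 * K ≤ p := by
    intro p hp
    have h1 := (mem_prs.1 hp).1.1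
    exact (Nat.le_ceil _).trans (Nat.cast_le.2 (((le_max_right _ _).trans hD).trans h1.le))
  have hlc : ∀ p ∈ prs D v, (polyRho G p : ℝ) ≤ G.natDegree := fun p hp =>
    Nat.cast_le.2 (polyRho_prime_le_of_monic hG (hprime p hp))
  have hterm : ∀ p ∈ prs D v, 1 ≤ (1 - γ p) * ((1 + (polyRho G p : ℝ) / p) * (1 + 2 * K * ((p : ℝ) ^ 2)⁻¹)) := by
    intro p hp
    have hp0 : (0 : ℝ) < p := by exact_mod_cast (hprime p hp).pos
    have hpK := hDK p hp
    have hgp := hγ p hp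
    have hl := hlc p hp
    set t := (polyRho G p : ℝ) / p with ht
    set s := E / (p : ℝ) ^ 2 with hs
    set u := K * ((p : ℝ) ^ 2)⁻¹ with hu
    have ht0 : 0 ≤ t := by positivity
    have hs0 : 0 ≤ s := by positivity
    have hgK : (G.natDegree : ℝ) ≤ K := by
      have : (1 : ℝ) ≤ G.natDegree := by exact_mod_cast hg
      nlinarith
    have ht1 : t ≤ 1 := by rw [ht, div_le_one hp0]; linarith
    have hu0 : 0 ≤ u := by positivity
    have hu1 : u ≤ 1 / 2 := by
      rw [hu, ← div_eq_mul_inv, div_le_iff₀ (by positivity)]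
      nlinarith
    have htu : t ^ 2 + 2 * s ≤ u := by
      rw [ht, hs, hu, div_pow, ← mul_div_assoc, ← add_div, div_eq_mul_inv]
      have : (polyRho G p : ℝ) ^ 2 ≤ (G.natDegree : ℝ) ^ 2 := by gcongr
      gcongr
      linarith
    have h2 : 1 - u ≤ (1 - γ p) * (1 + t) := by nlinarith
    have h3 : (1 - u) * (1 + 2 * u) ≤ (1 - γ p) * (1 + t) * (1 + 2 * u) := by gcongr
    have : 2 * K * ((p : ℝ) ^ 2)⁻¹ = 2 * u := by rw [hu]; ring
    rw [this]
    nlinarith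
  have hone : (1 : ℝ) ≤ ∏ p ∈ prs D v, ((1 - γ p) * ((1 + (polyRho G p : ℝ) / p) * (1 + 2 * K * ((p : ℝ) ^ 2)⁻¹))) := by
    have := Finset.prod_le_prod (s := prs D v) (f := fun _ => (1 : ℝ)) (fun _ _ => by norm_num) hterm
    simpa using this
  rw [Finset.prod_mul_distrib, Finset.prod_mul_distrib] at hone
  have h2 : ∏ p ∈ prs D v, (1 + 2 * K * ((p : ℝ) ^ 2)⁻¹) ≤ exp (4 * K) := by
    refine (prod_one_add_le_exp _ (fun p : ℕ => 2 * K * ((p : ℝ) ^ 2)⁻¹) (fun p _ => by positivity)).trans ?_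
    rw [exp_le_exp, ← Finset.mul_sum]
    have := sum_inv_sq_prs_le D v
    nlinarith
  have hP1 : 0 < ∏ p ∈ prs D v, (1 + (polyRho G p : ℝ) / p) := Finset.prod_pos fun p _ => by positivity
  have hP2 : 0 < ∏ p ∈ prs D v, (1 + 2 * K * ((p : ℝ) ^ 2)⁻¹) := Finset.prod_pos fun p _ => by positivity
  have h3 : (∏ p ∈ prs D v, (1 + (polyRho G p : ℝ) / p)) * ∏ p ∈ prs D v, (1 + 2 * K * ((p : ℝ) ^ 2)⁻¹) ≤
      C * log v * exp (4 * K) := mul_le_mul h1 h2 hP2.le (by positivity)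
  have h4 : 0 < ∏ p ∈ prs D v, (1 - γ p) := by
    by_contra hneg
    have := mul_nonpos_of_nonpos_of_nonneg (not_lt.1 hneg) (mul_pos hP1 hP2).le
    linarith
  rw [inv_eq_one_div, div_div, div_le_iff₀ (by positivity)]
  refine hone.trans ((mul_le_mul_of_nonneg_left h3 h4.le).trans (le_of_eq (by ring)))

/-- Packing bound: a bounded set of vectors whose differences have norm divisible by `r`. -/
theorem card_le_of_dvd_nf_sub {G : Polynomial ℤ} (hG : G.Monic) (hirr : Irreducible G) {m c : ℕ} (hm : G.natDegree = m)
    (hm1 : 1 ≤ m) (hc1 : 1 ≤ c)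
    (hc : ∀ (v : Fin m → ℤ) (B : ℝ), 0 ≤ B → (∀ i, |(v i : ℝ)| ≤ B) → |(nf G v : ℝ)| ≤ c * B ^ m)
    (V : Finset (Fin m → ℤ)) {B : ℝ} (hB : 0 ≤ B) (hV : ∀ v ∈ V, ∀ i, |(v i : ℝ)| ≤ B) {r : ℕ}
    (hr : ∀ v ∈ V, ∀ v' ∈ V, (r : ℤ) ∣ nf G (v - v')) (hrB : (r : ℝ) ≤ B ^ m) (hrc : 2 * c ≤ r) :
    (V.card : ℝ) ≤ 10 ^ m * (2 * c) * (B ^ m / r) := by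
  obtain ⟨q, hq1, hq2⟩ := exists_pow_le_lt hm1 (r / (2 * c))
  have hd : 1 ≤ r / (2 * c) := (Nat.one_le_div_iff (by omega)).2 hrc
  have hq0 : 1 ≤ q := by
    by_contra h
    have : q = 0 := by omega
    rw [this] at hq2
    simp at hq2
    omega
  have hqr : (q : ℝ) ^ m * (2 * c) ≤ r := by
    have : q ^ m * (2 * c) ≤ r := (Nat.mul_le_mul_right _ hq1).trans (Nat.div_mul_le_self _ _)
    exact_mod_cast this
  have hr0 : (0 : ℝ) < r := by
    have : 0 < r := by omega
    exact_mod_cast this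
  have hc0 : (1 : ℝ) ≤ c := by exact_mod_cast hc1
  have hq0' : (1 : ℝ) ≤ q := by exact_mod_cast hq0
  have hrq : (r : ℝ) ≤ (2 * q) ^ m * (2 * c) := by
    have h1 : r < (r / (2 * c) + 1) * (2 * c) := by
      have := Nat.lt_div_mul_add (a := r) (b := 2 * c) (by omega)
      rw [add_mul, one_mul]; exact this
    have h2 : (r / (2 * c) + 1) ≤ (2 * q) ^ m := by
      have : (q + 1) ^ m ≤ (2 * q) ^ m := Nat.pow_le_pow_left (by omega) _
      omega
    have h3 : r ≤ (2 * q) ^ m * (2 * c) := h1.le.trans (Nat.mul_le_mul_right _ h2)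
    exact_mod_cast h3
  have hqB : (q : ℝ) ≤ B := by
    by_contra h
    have h1 : B ^ m < (q : ℝ) ^ m := pow_lt_pow_left₀ (not_le.1 h) hB (by omega)
    have h2 : (q : ℝ) ^ m ≤ (q : ℝ) ^ m * (2 * c) := le_mul_of_one_le_right (by positivity) (by linarith)
    linarith
  have hq0i : (0 : ℤ) < q := by exact_mod_cast hq0
  set k : ℕ := ⌊B / q⌋₊ + 1 with hk
  have hcard : V.card ≤ (2 * k + 1) ^ m := by
    rw [← card_ibox (m := m) (fun _ => -(k : ℤ)) (2 * k + 1)]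
    refine Finset.card_le_card_of_injOn (fun v i => v i / (q : ℤ)) (fun v hv => ?_) ?_
    · rw [Finset.mem_coe, mem_ibox]
      intro i
      have h1 := abs_le.1 (hV v hv i)
      have h2 : B / q < k := by rw [hk]; push_cast; exact Nat.lt_floor_add_one _
      have h3 : B < k * q := by rwa [div_lt_iff₀ (by linarith)] at h2
      have h4 : (-(k * q : ℤ) : ℤ) < v i := by
        have : (-(k * q : ℝ)) < v i := by linarith
        exact_mod_cast this
      have h5 : v i < (k * q : ℤ) := by
        have : (v i : ℝ) < (k * q : ℝ) := by linarith
        exact_mod_cast this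
      constructor
      · rw [Int.le_ediv_iff_mul_le hq0i]; linarith
      · rw [Int.ediv_lt_iff_lt_mul hq0i]
        push_cast
        nlinarith
    · intro v hv v' hv' h
      by_contra hne
      have h0 : v - v' ≠ 0 := sub_ne_zero.2 hne
      have h1 : ∀ i, |((v - v') i : ℝ)| ≤ q := by
        intro i
        have h2 : v i / (q : ℤ) = v' i / (q : ℤ) := congrFun h i
        have h3 := Int.mul_ediv_add_emod (v i) q
        have h4 := Int.mul_ediv_add_emod (v' i) q
        have h5 := Int.emod_nonneg (v i) hq0i.ne'
        have h6 := Int.emod_nonneg (v' i) hq0i.ne'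
        have h7 := Int.emod_lt_of_pos (v i) hq0i
        have h8 := Int.emod_lt_of_pos (v' i) hq0i
        rw [← h2] at h4
        have : |(v - v') i| ≤ (q : ℤ) := by
          rw [Pi.sub_apply, abs_le]; constructor <;> linarith
        exact_mod_cast this
      have h2 := hc (v - v') q (by positivity) h1
      have h3 := hr v hv v' hv'
      have h4 : (r : ℤ) ≤ |nf G (v - v')| :=
        Int.le_of_dvd (abs_pos.2 (nf_ne_zero hG hirr hm.ge h0)) ((dvd_abs _ _).2 h3)
      have h5 : (r : ℝ) ≤ |(nf G (v - v') : ℝ)| := by exact_mod_cast h4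
      have h6 : 0 < (c : ℝ) * q ^ m := by positivity
      linarith
  have h1 : (V.card : ℝ) ≤ (2 * k + 1 : ℝ) ^ m := by exact_mod_cast hcard
  have h2 : (2 * k + 1 : ℝ) ≤ 5 * (B / q) := by
    have h3 : (⌊B / q⌋₊ : ℝ) ≤ B / q := Nat.floor_le (by positivity)
    have h4 : 1 ≤ B / q := by rwa [le_div_iff₀ (by linarith), one_mul]
    rw [hk]; push_cast; linarith
  calc (V.card : ℝ) ≤ (5 * (B / q)) ^ m := h1.trans (by gcongr)
    _ = (5 * B) ^ m / (q : ℝ) ^ m := by rw [← div_pow]; ring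
    _ ≤ _ := by
      rw [div_le_iff₀ (by positivity)]
      have h5 : (10 : ℝ) ^ m = 5 ^ m * 2 ^ m := by rw [← mul_pow]; norm_num
      have h6 : B ^ m * r ≤ B ^ m * ((2 * q) ^ m * (2 * c)) := by gcongr
      rw [h5, mul_pow]
      rw [show 5 ^ m * 2 ^ m * (2 * (c : ℝ)) * (B ^ m / r) * q ^ m = 5 ^ m * (B ^ m * ((2 * q) ^ m * (2 * c))) / r by
        rw [mul_pow]; ring]
      rw [le_div_iff₀ hr0, mul_assoc]
      gcongr

/-- Few bounded vectors have a common factor of degree at least two with `G` modulo a large prime. -/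
theorem card_bad_le {G : Polynomial ℤ} (hG : G.Monic) (hirr : Irreducible G) {m c : ℕ} (hm : G.natDegree = m)
    (hm1 : 1 ≤ m) (hc1 : 1 ≤ c)
    (hc : ∀ (v : Fin m → ℤ) (B : ℝ), 0 ≤ B → (∀ i, |(v i : ℝ)| ≤ B) → |(nf G v : ℝ)| ≤ c * B ^ m)
    (V : Finset (Fin m → ℤ)) {B : ℝ} (hB : 0 ≤ B) (hV : ∀ v ∈ V, ∀ i, |(v i : ℝ)| ≤ B)
    (hV0 : ∀ v ∈ V, v ≠ 0) (hVB : ∀ v ∈ V, |(nf G v : ℝ)| ≤ B ^ m) {w : ℕ} (hw : 2 * c ≤ w ^ 2) :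
    ((V.filter fun v => ∃ p : ℕ, ∃ _ : Fact p.Prime, w < p ∧ ∃ f : Polynomial (ZMod p), f.Monic ∧ 2 ≤ f.natDegree ∧
      f ∣ G.map (Int.castRingHom (ZMod p)) ∧ f ∣ (pol v).map (Int.castRingHom (ZMod p))).card : ℝ) ≤
      2 ^ m * (10 ^ m * (2 * c)) * B ^ m * (2 / (w + 1)) := by
  set Bad : ℕ → Finset (Fin m → ℤ) := fun p => V.filter fun v => ∃ _ : Fact p.Prime, ∃ f : Polynomial (ZMod p), f.Monic ∧
    2 ≤ f.natDegree ∧ f ∣ G.map (Int.castRingHom (ZMod p)) ∧ f ∣ (pol v).map (Int.castRingHom (ZMod p)) with hBad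
  have hsq : ∀ p v, v ∈ Bad p → ((p : ℝ)) ^ 2 ≤ B ^ m := by
    intro p v hv
    rw [hBad, Finset.mem_filter] at hv
    obtain ⟨hvV, hp, f, hf, hf2, hfG, hfv⟩ := hv
    have h1 := sq_dvd_nf hG hirr hf hf2 hfG hfv
    have h2 : ((p : ℤ)) ^ 2 ≤ |nf G v| :=
      Int.le_of_dvd (abs_pos.2 (nf_ne_zero hG hirr hm.ge (hV0 v hvV))) ((dvd_abs _ _).2 h1)
    have h3 : ((p : ℝ)) ^ 2 ≤ |(nf G v : ℝ)| := by exact_mod_cast h2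
    exact h3.trans (hVB v hvV)
  have hbadp : ∀ p : ℕ, w < p → ((Bad p).card : ℝ) ≤ 2 ^ m * (10 ^ m * (2 * c)) * B ^ m * ((p : ℝ) ^ 2)⁻¹ := by
    intro p hp
    by_cases hne : (Bad p).Nonempty
    swap
    · rw [Finset.not_nonempty_iff_eq_empty.1 hne]
      simp only [Finset.card_empty, Nat.cast_zero]; positivity
    obtain ⟨v0, hv0⟩ := hne
    have hpB := hsq p v0 hv0
    have hpr : Fact p.Prime := by
      rw [hBad, Finset.mem_filter] at hv0
      exact hv0.2.1
    have hGp : G.map (Int.castRingHom (ZMod p)) ≠ 0 := (hG.map _).ne_zero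
    have hsub : Bad p ⊆ ((monicDivisors (G.map (Int.castRingHom (ZMod p)))).filter fun f => f.Monic ∧ 2 ≤ f.natDegree ∧
        f ∣ G.map (Int.castRingHom (ZMod p))).biUnion fun f =>
        V.filter fun v => f ∣ (pol v).map (Int.castRingHom (ZMod p)) := by
      intro v hv
      rw [hBad, Finset.mem_filter] at hv
      obtain ⟨hvV, _, f, hf, hf2, hfG, hfv⟩ := hv
      rw [Finset.mem_biUnion]
      exact ⟨f, Finset.mem_filter.2 ⟨mem_monicDivisors hGp hf hfG, hf, hf2, hfG⟩, Finset.mem_filter.2 ⟨hvV, hfv⟩⟩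
    have hF : ∀ f ∈ ((monicDivisors (G.map (Int.castRingHom (ZMod p)))).filter fun f => f.Monic ∧ 2 ≤ f.natDegree ∧
        f ∣ G.map (Int.castRingHom (ZMod p))), ((V.filter fun v => f ∣ (pol v).map (Int.castRingHom (ZMod p))).card : ℝ)
          ≤ 10 ^ m * (2 * c) * (B ^ m / ((p ^ 2 : ℕ) : ℝ)) := by
      intro f hf
      obtain ⟨_, hf, hf2, hfG⟩ := Finset.mem_filter.1 hf
      refine card_le_of_dvd_nf_sub hG hirr hm hm1 hc1 hc _ hB (fun v hv => hV v (Finset.mem_filter.1 hv).1) ?_ ?_ ?_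
      · intro v hv v' hv'
        push_cast
        refine sq_dvd_nf hG hirr hf hf2 hfG ?_
        rw [pol_sub, Polynomial.map_sub]
        exact dvd_sub (Finset.mem_filter.1 hv).2 (Finset.mem_filter.1 hv').2
      · push_cast; exact hpB
      · nlinarith
    have h1 : ((Bad p).card : ℝ) ≤ ∑ f ∈ ((monicDivisors (G.map (Int.castRingHom (ZMod p)))).filter fun f => f.Monic ∧ 2 ≤ f.natDegree ∧
        f ∣ G.map (Int.castRingHom (ZMod p))), ((V.filter fun v => f ∣ (pol v).map (Int.castRingHom (ZMod p))).card : ℝ) := by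
      exact_mod_cast (Finset.card_le_card hsub).trans Finset.card_biUnion_le
    refine h1.trans ((Finset.sum_le_sum hF).trans ?_)
    rw [Finset.sum_const, nsmul_eq_mul]
    have h2 : (((monicDivisors (G.map (Int.castRingHom (ZMod p)))).filter fun f => f.Monic ∧ 2 ≤ f.natDegree ∧
        f ∣ G.map (Int.castRingHom (ZMod p))).card : ℝ) ≤ 2 ^ m := by
      have := (Finset.card_filter_le (monicDivisors (G.map (Int.castRingHom (ZMod p)))) (fun f => f.Monic ∧ 2 ≤ f.natDegree ∧
        f ∣ G.map (Int.castRingHom (ZMod p)))).trans (card_monicDivisors_le hGp)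
      rw [hG.natDegree_map, hm] at this
      exact_mod_cast this
    calc _ ≤ 2 ^ m * (10 ^ m * (2 * c) * (B ^ m / ((p ^ 2 : ℕ) : ℝ))) := by gcongr
      _ = _ := by push_cast; ring
  set N : ℕ := ⌊B ^ m⌋₊ + 1 with hN
  have hcov : (V.filter fun v => ∃ p : ℕ, ∃ _ : Fact p.Prime, w < p ∧ ∃ f : Polynomial (ZMod p), f.Monic ∧ 2 ≤ f.natDegree ∧
      f ∣ G.map (Int.castRingHom (ZMod p)) ∧ f ∣ (pol v).map (Int.castRingHom (ZMod p))) ⊆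
      (Finset.Ioo w N).biUnion Bad := by
    intro v hv
    rw [Finset.mem_filter] at hv
    obtain ⟨hvV, p, hp, hwp, h⟩ := hv
    have hvb : v ∈ Bad p := Finset.mem_filter.2 ⟨hvV, hp, h⟩
    rw [Finset.mem_biUnion]
    refine ⟨p, Finset.mem_Ioo.2 ⟨hwp, ?_⟩, hvb⟩
    have h1 := hsq p v hvb
    rw [hN, Nat.lt_succ_iff]
    refine Nat.le_floor (le_trans ?_ h1)
    have : (1 : ℝ) ≤ p := by exact_mod_cast hp.out.one_le
    nlinarith
  calc _ ≤ ∑ p ∈ Finset.Ioo w N, ((Bad p).card : ℝ) := by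
        exact_mod_cast (Finset.card_le_card hcov).trans Finset.card_biUnion_le
    _ ≤ ∑ p ∈ Finset.Ioo w N, 2 ^ m * (10 ^ m * (2 * c)) * B ^ m * ((p : ℝ) ^ 2)⁻¹ :=
        Finset.sum_le_sum fun p hp => hbadp p (Finset.mem_Ioo.1 hp).1
    _ = 2 ^ m * (10 ^ m * (2 * c)) * B ^ m * ∑ p ∈ Finset.Ioo w N, ((p : ℝ) ^ 2)⁻¹ := by rw [Finset.mul_sum]
    _ ≤ _ := by
      gcongr
      exact sum_Ioo_inv_sq_le w N

theorem numZeros_comp_affine_le {m : ℕ} {f : (Fin m → ℤ) → ℤ} (hf : CongPres f) (e : Fin m → ℤ) {Q p : ℕ} (hp : 0 < p)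
    (hQ : IsCoprime (Q : ℤ) (p : ℤ)) : numZeros (fun u => f fun i => e i + Q * u i) p ≤ numZeros f p := by
  have hp' : (0 : ℤ) < p := by exact_mod_cast hp
  have hdv : ∀ a : ℤ, (p : ℤ) ∣ a % p - a := fun a => by
    rw [Int.emod_def]; exact ⟨-(a / p), by ring⟩
  unfold numZeros
  refine Finset.card_le_card_of_injOn (fun u i => (e i + Q * u i) % (p : ℤ)) ?_ ?_
  · intro u hu
    simp only [Finset.coe_filter, Set.mem_ofPred_eq] at hu ⊢
    refine ⟨emod_mem_ibox hp _, ?_⟩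
    refine (hf.dvd_iff fun i => ?_).2 hu.2
    exact hdv _
  · intro u hu u' hu' h
    simp only [Finset.coe_filter, Set.mem_ofPred_eq, mem_ibox] at hu hu'
    funext i
    have h1 : (e i + Q * u i) % (p : ℤ) = (e i + Q * u' i) % (p : ℤ) := congrFun h i
    have h2 : (p : ℤ) ∣ (Q : ℤ) * (u i - u' i) := by
      have := Int.ModEq.dvd (n := (p : ℤ)) h1.symm
      convert this using 1; ring
    have h3 : (p : ℤ) ∣ u i - u' i := hQ.symm.dvd_of_dvd_mul_left h2
    have h4 := hu.1 i
    have h5 := hu'.1 i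
    simp only [Pi.zero_apply] at h4 h5
    have := Int.eq_zero_of_abs_lt_dvd h3 (by rw [abs_lt]; constructor <;> omega)
    omega

theorem sieve_box {G : Polynomial ℤ} (hG : G.Monic) (hirr : Irreducible G) {m : ℕ} (hm : G.natDegree = m)
    (hm2 : 2 ≤ m) (e : Fin m → ℤ) (he : nf G e = 1) :
    ∃ Q K : ℕ, ∃ c : ℝ, 1 ≤ Q ∧ 0 < c ∧ ∀ w : ℕ, 2 ≤ w → ∀ (s : Fin m → ℤ) (b : ℕ), 1 ≤ b →
      c * (b : ℝ) ^ m / log w - (w : ℝ) ^ K * (b : ℝ) ^ (m - 1) ≤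
        (((ibox s b).filter fun u => ∀ p : ℕ, p.Prime → p ≤ w → ¬ (p : ℤ) ∣ nf G (fun i => e i + Q * u i)).card : ℝ) := by
  obtain ⟨D₀, c, hc, hprod⟩ := prod_one_sub_ge hG hirr (by omega) (E := 2 ^ m) (by positivity)
  set k : ℕ := m + 2 ^ m with hk
  obtain ⟨K, hsieve⟩ := sieve_lower (k : ℝ) (by positivity)
  set D : ℕ := max D₀ (2 * k) with hD
  set Q : ℕ := ∏ p ∈ prs 0 D, p with hQ
  have hQ1 : 1 ≤ Q := Finset.prod_pos fun p hp => (mem_prs.1 hp).2.pos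
  set f : (Fin m → ℤ) → ℤ := fun u => nf G fun i => e i + Q * u i with hf
  have hnf := congPres_nf hG m
  have hfc : CongPres f := by
    intro d v w h
    refine hnf d _ _ fun i => ?_
    have : e i + Q * v i - (e i + Q * w i) = Q * (v i - w i) := by ring
    rw [this]
    exact (h i).mul_left _
  refine ⟨Q, 2 + K + K * m + 2 * m, c / 2, hQ1, by positivity, fun w hw s b hb => ?_⟩
  have hw' : (2 : ℝ) ≤ w := by exact_mod_cast hw
  have hb' : (1 : ℝ) ≤ b := by exact_mod_cast hb
  have hlw := log_le_of_two_le hw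
  have hprime : ∀ p ∈ prs D w, p.Prime := fun p hp => (mem_prs.1 hp).2
  have hgle : ∀ p ∈ prs D w, (numZeros f p : ℝ) / (p : ℝ) ^ m ≤ (polyRho G p : ℝ) / p + 2 ^ m / (p : ℝ) ^ 2 := by
    intro p hp
    have hpp := hprime p hp
    have := Fact.mk hpp
    have hp0 : (0 : ℝ) < p := by exact_mod_cast hpp.pos
    have hcop : IsCoprime (Q : ℤ) (p : ℤ) := by
      rw [Nat.isCoprime_iff_coprime, hQ, Nat.coprime_prod_left_iff]
      intro q hq
      rw [Nat.coprime_primes (mem_prs.1 hq).2 hpp]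
      have h1 := (mem_prs.1 hq).1.2
      have h2 := (mem_prs.1 hp).1.1
      omega
    have h1 := (numZeros_comp_affine_le hnf e hpp.pos hcop).trans (numZeros_nf_le hG)
    rw [hm] at h1
    have h2 : (numZeros f p : ℝ) ≤ polyRho G p * (p : ℝ) ^ (m - 1) + 2 ^ m * (p : ℝ) ^ (m - 2) := by exact_mod_cast h1
    rw [div_le_iff₀ (by positivity)]
    refine h2.trans (le_of_eq ?_)
    obtain ⟨n, rfl⟩ : ∃ n, m = n + 2 := ⟨m - 2, by omega⟩
    simp only [Nat.add_sub_cancel, show n + 2 - 1 = n + 1 by omega]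
    field_simp
    ring
  have hkp : ∀ p ∈ prs D w, (polyRho G p : ℝ) / p + 2 ^ m / (p : ℝ) ^ 2 ≤ k / p := by
    intro p hp
    have hpp := hprime p hp
    have hp1 : (1 : ℝ) ≤ p := by exact_mod_cast hpp.one_le
    have h1 : (polyRho G p : ℝ) ≤ m := by
      have := polyRho_prime_le_of_monic hG hpp
      rw [hm] at this
      exact_mod_cast this
    have h2 : (2 : ℝ) ^ m / (p : ℝ) ^ 2 ≤ 2 ^ m / p := by
      gcongr
      nlinarith
    calc _ ≤ (m : ℝ) / p + 2 ^ m / p := by gcongr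
      _ = _ := by rw [hk]; push_cast; ring
  have hk2 : ∀ p ∈ prs D w, (k : ℝ) / p ≤ 1 / 2 := by
    intro p hp
    have hpp := hprime p hp
    have hp1 : (0 : ℝ) < p := by exact_mod_cast hpp.pos
    have h1 := (mem_prs.1 hp).1.1
    have h2 : 2 * k ≤ p := (le_max_right D₀ _).trans h1.le
    have h3 : (2 : ℝ) * k ≤ p := by exact_mod_cast h2
    rw [div_le_iff₀ hp1]; linarith
  have hmain := hsieve w (by omega) (prs D w) (fun p hp => mem_prs.2 ⟨⟨(hprime p hp).pos, (mem_prs.1 hp).1.2⟩, hprime p hp⟩)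
    (fun p => (numZeros f p : ℝ) / (p : ℝ) ^ m)
    (fun p hp => ⟨by positivity, (hgle p hp).trans (hkp p hp), (hgle p hp).trans ((hkp p hp).trans (hk2 p hp))⟩)
    (ibox s b) (fun p u => (p : ℤ) ∣ f u) ((b : ℝ) ^ m) (((w : ℝ) ^ K) ^ m * (m * (2 * b) ^ (m - 1))) (by positivity) (by positivity)
    (fun S hS hSK => by
      have hSp : ∀ p ∈ S, p.Prime := fun p hp => hprime p (hS hp)
      set d := ∏ p ∈ S, p with hd
      have hd0 : 0 < d := Finset.prod_pos fun p hp => (hSp p hp).pos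
      have hd1 : (1 : ℝ) ≤ d := by exact_mod_cast hd0
      have h1 := abs_card_ibox_dvd_sub_le hfc s b hd0
      have h3 : (b : ℝ) ^ m * ∏ p ∈ S, (numZeros f p : ℝ) / (p : ℝ) ^ m = numZeros f d * ((b : ℝ) / d) ^ m := by
        rw [Finset.prod_div_distrib, Finset.prod_pow, hd, numZeros_prod hfc S hSp, div_pow]
        push_cast
        ring
      suffices h2 : (numZeros f d * (m * ((b : ℝ) / d + 1) ^ (m - 1)) : ℝ) ≤ ((w : ℝ) ^ K) ^ m * (m * (2 * b) ^ (m - 1)) by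
        refine le_trans (le_of_eq ?_) (h1.trans h2)
        rw [h3]
        congr 4
        ext a
        simp only [Finset.mem_filter]
        rw [hd, prod_primes_dvd_iff S hSp]
      have h4 : (numZeros f d : ℝ) ≤ (d : ℝ) ^ m := by exact_mod_cast numZeros_le f d
      have h5 : (d : ℝ) ≤ (w : ℝ) ^ K := by exact_mod_cast hSK
      have h6 : (b : ℝ) / d + 1 ≤ 2 * b := by
        have : (b : ℝ) / d ≤ b := div_le_self (by positivity) hd1
        linarith
      gcongr
      exact h4.trans (by gcongr))
  have hP := hprod D w (le_max_left _ _) hw _ hgle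
  have h1 : c / 2 * (b : ℝ) ^ m / log w ≤ (b : ℝ) ^ m / 2 * ∏ p ∈ prs D w, (1 - (numZeros f p : ℝ) / (p : ℝ) ^ m) := by
    calc c / 2 * (b : ℝ) ^ m / log w = (b : ℝ) ^ m / 2 * (c / log w) := by ring
      _ ≤ _ := by gcongr
  have h2 : ((w : ℝ) + 1) * (w : ℝ) ^ K * (((w : ℝ) ^ K) ^ m * (m * (2 * b) ^ (m - 1))) ≤
      (w : ℝ) ^ (2 + K + K * m + 2 * m) * (b : ℝ) ^ (m - 1) := by
    have a1 : (w : ℝ) + 1 ≤ (w : ℝ) ^ 2 := by nlinarith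
    have a2 : (m : ℝ) ≤ (w : ℝ) ^ m := by
      have : m < 2 ^ m := Nat.lt_two_pow_self
      have : (m : ℝ) ≤ 2 ^ m := by exact_mod_cast this.le
      exact this.trans (by gcongr)
    have a3 : (2 : ℝ) ^ (m - 1) ≤ (w : ℝ) ^ m := by
      calc (2 : ℝ) ^ (m - 1) ≤ 2 ^ m := pow_le_pow_right₀ (by norm_num) (by omega)
        _ ≤ _ := by gcongr
    calc _ ≤ (w : ℝ) ^ 2 * (w : ℝ) ^ K * (((w : ℝ) ^ K) ^ m * ((w : ℝ) ^ m * ((w : ℝ) ^ m * (b : ℝ) ^ (m - 1)))) := by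
          rw [mul_pow]; gcongr
      _ = _ := by rw [← pow_mul]; ring
  refine le_trans (by linarith) (hmain.trans (Nat.cast_le.2 (Finset.card_le_card fun u hu => ?_)))
  have hu := (@Finset.mem_filter _ _ (_) _ _).1 hu
  refine Finset.mem_filter.2 ⟨hu.1, fun p hp hpw hdiv => ?_⟩
  by_cases hpD : D < p
  · exact hu.2 p (mem_prs.2 ⟨⟨hpD, hpw⟩, hp⟩) hdiv
  · have hpQ : (p : ℤ) ∣ Q := Int.natCast_dvd_natCast.2
      (Finset.dvd_prod_of_mem _ (mem_prs.2 ⟨⟨hp.pos, not_lt.1 hpD⟩, hp⟩))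
    have h4 : (p : ℤ) ∣ nf G e := by
      refine (hnf.dvd_iff fun i => ?_).1 hdiv
      rw [add_sub_cancel_left]
      exact hpQ.mul_right _
    rw [he] at h4
    exact hp.one_lt.ne' (by exact_mod_cast Int.eq_one_of_dvd_one (by positivity) h4)

theorem card_le_sum_polyRho {G : Polynomial ℤ} (hG : G.Monic) (hirr : Irreducible G) {m : ℕ} (hm : m ≤ G.natDegree)
    (V : Finset (Fin m → ℤ)) {L R : ℝ} {w : ℕ} (hL : 0 ≤ L) (hV0 : ∀ v ∈ V, v ≠ 0)
    (hVL : ∀ v ∈ V, L < (nf G v : ℝ) ∧ (nf G v : ℝ) ≤ R)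
    (hrough : ∀ v ∈ V, ∀ p : ℕ, p.Prime → p ≤ w → ¬ (p : ℤ) ∣ nf G v)
    (hgood : ∀ v ∈ V, ∀ (p : ℕ) (_ : Fact p.Prime), w < p → ∀ f : Polynomial (ZMod p), f.Monic → f ∣ G.map (Int.castRingHom (ZMod p)) →
      f ∣ (pol v).map (Int.castRingHom (ZMod p)) → f.natDegree < 2)
    (hsep : ∀ v ∈ V, ∀ v' ∈ V, |(nf G (v - v') : ℝ)| ≤ L) :
    V.card ≤ ∑ P ∈ (Finset.Ioc ⌊L⌋₊ ⌊R⌋₊).filter (fun P => ∀ p : ℕ, p.Prime → p ∣ P → w < p), polyRho G P := by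
  have hcard : ∑ P ∈ (Finset.Ioc ⌊L⌋₊ ⌊R⌋₊).filter (fun P => ∀ p : ℕ, p.Prime → p ∣ P → w < p), polyRho G P =
      (((Finset.Ioc ⌊L⌋₊ ⌊R⌋₊).filter (fun P => ∀ p : ℕ, p.Prime → p ∣ P → w < p)).sigma fun P =>
        (Finset.range P).filter fun n : ℕ => (P : ℤ) ∣ G.eval (n : ℤ)).card := by
    rw [Finset.card_sigma]
    exact Finset.sum_congr rfl fun P _ => polyRho_eq G P
  rw [hcard]
  have hpos : ∀ v ∈ V, 0 < nf G v := fun v hv => by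
    have : (0 : ℝ) < nf G v := hL.trans_lt (hVL v hv).1
    exact_mod_cast this
  refine Finset.card_le_card_of_forall_subsingleton
    (fun v a => nf G v = (a.1 : ℤ) ∧ (a.1 : ℤ) ∣ (pol v).eval (a.2 : ℤ)) ?_ ?_
  · intro v hv
    have h0 := hpos v hv
    obtain ⟨n, hn1, hn2⟩ := exists_root_of_dvd_nf hG hirr hm (hV0 v hv) (fun p hp hpv f hf h1 h2 => by
      refine hgood v hv p hp ?_ f hf h1 h2
      by_contra h
      exact hrough v hv p hp.out (not_lt.1 h) hpv)
    set P : ℕ := (nf G v).toNat with hP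
    have hPe : (P : ℤ) = nf G v := Int.toNat_of_nonneg h0.le
    have hPr : (P : ℝ) = nf G v := by rw [← hPe]; simp
    have hr : (((n % (P : ℤ)).toNat : ℕ) : ℤ) = n % P := Int.toNat_of_nonneg (Int.emod_nonneg _ (by omega))
    have hlt := Int.emod_lt_of_pos n (show (0 : ℤ) < P by omega)
    have hdv : ∀ H : Polynomial ℤ, (P : ℤ) ∣ H.eval n → (P : ℤ) ∣ H.eval (n % (P : ℤ)) := by
      intro H hH
      have h1 : (P : ℤ) ∣ n % P - n := by rw [Int.emod_def]; exact ⟨-(n / P), by ring⟩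
      exact (dvd_iff_dvd_of_dvd_sub (h1.trans (Polynomial.sub_dvd_eval_sub _ _ H))).2 hH
    refine ⟨⟨P, (n % (P : ℤ)).toNat⟩, ?_, hPe.symm, ?_⟩
    · rw [Finset.mem_sigma, Finset.mem_filter, Finset.mem_Ioc, Finset.mem_filter, Finset.mem_range]
      refine ⟨⟨⟨?_, ?_⟩, ?_⟩, ?_, ?_⟩
      · rw [Nat.floor_lt hL, hPr]; exact (hVL v hv).1
      · exact Nat.le_floor (by rw [hPr]; exact (hVL v hv).2)
      · intro p hp hpP
        by_contra h
        exact hrough v hv p hp (not_lt.1 h) (by rw [← hPe]; exact_mod_cast hpP)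
      · simp only; omega
      · simp only
        rw [hr]
        exact hdv G (by rw [hPe]; exact hn1)
    · simp only
      rw [hr]
      exact hdv _ (by rw [hPe]; exact hn2)
  · rintro ⟨P, n⟩ ha v ⟨hv, hv1, hv2⟩ v' ⟨hv', hv1', hv2'⟩
    simp only at hv1 hv2 hv1' hv2'
    simp only [Finset.mem_sigma, Finset.mem_filter] at ha
    by_contra hne
    have h1 : (P : ℤ) ∣ (pol (v - v')).eval (n : ℤ) := by
      rw [pol_sub, Polynomial.eval_sub]; exact dvd_sub hv2 hv2'
    have h2 := dvd_nf_of_dvd_eval hG hirr ha.2.2 h1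
    have h3 : (P : ℤ) ≤ |nf G (v - v')| :=
      Int.le_of_dvd (abs_pos.2 (nf_ne_zero hG hirr hm (sub_ne_zero.2 hne))) ((dvd_abs _ _).2 h2)
    have h4 : (P : ℝ) ≤ |(nf G (v - v') : ℝ)| := by exact_mod_cast h3
    have h5 := hsep v hv v' hv'
    have h6 := (hVL v hv).1
    rw [hv1] at h6
    push_cast at h6
    linarith

theorem exists_box_start {n : ℕ} {Nr : (Fin (n + 1) → ℝ) → ℝ} (hhom : ∀ (t : ℝ) x, Nr (t • x) = t ^ (n + 1) * Nr x)
    (h1 : Nr (Pi.single 0 1) = 1) {Λ : ℝ} (hΛ : 1 ≤ Λ) (hLip : ∀ x y, ‖x‖ ≤ 2 → ‖y‖ ≤ 2 → |Nr x - Nr y| ≤ Λ * ‖x - y‖)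
    {β h T : ℝ} (hβ : 0 < β) (hβ1 : β ≤ 1 / 2) (hh : 0 < h) (hhβ : h ≤ β / 2) (hT : 0 < T) {Q b : ℕ} (hQ : 1 ≤ Q) (hb : 1 ≤ b)
    (hbT : 12 * Λ * (Q * b) ≤ h * T) (s : Fin n → ℤ) (hs : ∀ i, 0 ≤ s i ∧ (Q * s i : ℝ) ≤ β / (2 * Λ) * T) :
    ∃ s0 : ℤ, ∀ u ∈ ibox (Fin.cons s0 s : Fin (n + 1) → ℤ) b, ∀ v : Fin (n + 1) → ℝ,
      (∀ i, v i = ((Pi.single 0 1 + fun i => (Q : ℤ) * u i : Fin (n + 1) → ℤ) i : ℝ)) →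
      T ^ (n + 1) < Nr v ∧ Nr v ≤ T ^ (n + 1) * exp h ∧ ∀ i, |v i - T * (Pi.single 0 1 : Fin (n + 1) → ℝ) i| ≤ 2 * β * T := by
  set τ : Fin n → ℝ := fun i => Q * s i / T with hτ
  have hQ' : (1 : ℝ) ≤ Q := by exact_mod_cast hQ
  have hb' : (1 : ℝ) ≤ b := by exact_mod_cast hb
  have hκ : β / (2 * Λ) ≤ β / 2 := by
    rw [div_le_div_iff₀ (by positivity) (by positivity)]; nlinarith
  have hτ0 : ∀ i, 0 ≤ τ i := fun i => by
    have : (0 : ℝ) ≤ s i := by exact_mod_cast (hs i).1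
    positivity
  have hτ1 : ∀ i, τ i ≤ β / (2 * Λ) := fun i => by
    rw [hτ]; simp only; rw [div_le_iff₀ hT]; exact (hs i).2
  have hnorm : ∀ t : ℝ, |t| ≤ 3 / 2 → ‖(Fin.cons t τ : Fin (n + 1) → ℝ)‖ ≤ 3 / 2 := by
    intro t ht
    rw [pi_norm_le_iff_of_nonneg (by norm_num), Fin.forall_fin_succ]
    refine ⟨by simpa using ht, fun i => ?_⟩
    rw [Fin.cons_succ, Real.norm_of_nonneg (hτ0 i)]
    linarith [hτ1 i]
  set φ : ℝ → ℝ := fun t => Nr (Fin.cons t τ) with hφ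
  have hφL : ∀ t t', |t| ≤ 3 / 2 → |t'| ≤ 3 / 2 → |φ t - φ t'| ≤ Λ * |t - t'| := by
    intro t t' ht ht'
    refine (hLip _ _ ((hnorm t ht).trans (by norm_num)) ((hnorm t' ht').trans (by norm_num))).trans ?_
    gcongr
    rw [pi_norm_le_iff_of_nonneg (abs_nonneg _), Fin.forall_fin_succ]
    simp
  have hφ0 : ∀ t, |t| ≤ 3 / 2 → |φ t - t ^ (n + 1)| ≤ β / 2 := by
    intro t ht
    have e : t ^ (n + 1) = Nr (t • Pi.single 0 1) := by rw [hhom, h1, mul_one]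
    rw [e]
    refine (hLip _ _ ((hnorm t ht).trans (by norm_num)) ?_).trans ?_
    · rw [norm_smul, Pi.norm_single]; simp; linarith
    · have : ‖(Fin.cons t τ : Fin (n + 1) → ℝ) - t • Pi.single 0 1‖ ≤ β / (2 * Λ) := by
        rw [pi_norm_le_iff_of_nonneg (by positivity), Fin.forall_fin_succ]
        refine ⟨?_, fun i => ?_⟩
        · simp; positivity
        · simp only [Pi.sub_apply, Fin.cons_succ, Pi.smul_apply, Pi.single_apply, Fin.succ_ne_zero, if_false, smul_zero,
            sub_zero]
          rw [Real.norm_of_nonneg (hτ0 i)]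
          exact hτ1 i
      calc _ ≤ Λ * (β / (2 * Λ)) := by gcongr
        _ = _ := by field_simp
  have hex : exp (h / 2) ≤ 1 + h := by
    have h2 := Real.exp_bound_div_one_sub_of_interval (x := h / 2) (by linarith) (by linarith)
    refine h2.trans ?_
    rw [div_le_iff₀ (by linarith)]
    nlinarith
  have hex1 : 1 + h / 2 ≤ exp (h / 2) := by linarith [Real.add_one_le_exp (h / 2)]
  have hivt : exp (h / 2) ∈ φ '' Set.Icc (1 - β) (1 + β) := by
    refine intermediate_value_Icc (by linarith) ?_ ⟨?_, ?_⟩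
    · refine LipschitzOnWith.continuousOn (K := Λ.toNNReal) (LipschitzOnWith.of_dist_le_mul fun x hx y hy => ?_)
      rw [Real.dist_eq, Real.dist_eq, Real.coe_toNNReal _ (by linarith)]
      refine hφL x y ?_ ?_
      · rw [abs_le]; constructor <;> linarith [hx.1, hx.2]
      · rw [abs_le]; constructor <;> linarith [hy.1, hy.2]
    · have h2 := abs_le.1 (hφ0 (1 - β) (by rw [abs_le]; constructor <;> linarith))
      have h3 : (1 - β) ^ (n + 1) ≤ 1 - β := pow_le_of_le_one (by linarith) (by linarith) (by omega)
      linarith [h2.2]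
    · have h2 := abs_le.1 (hφ0 (1 + β) (by rw [abs_le]; constructor <;> linarith))
      have h3 : 1 + β ≤ (1 + β) ^ (n + 1) := le_self_pow₀ (by linarith) (by omega)
      linarith [h2.1]
  obtain ⟨t, ht, hφt⟩ := hivt
  refine ⟨⌊t * T / Q⌋, fun u hu v hv => ?_⟩
  rw [mem_ibox] at hu
  set δ : ℝ := 3 * (Q * b) / T with hδ
  have hδh : Λ * δ ≤ h / 4 := by
    rw [hδ, ← mul_div_assoc, div_le_iff₀ hT]; linarith
  have hδ0 : 0 ≤ δ := by positivity
  have hδh' : δ ≤ h / 4 := by nlinarith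
  have htabs : |t| ≤ 3 / 2 := by rw [abs_le]; constructor <;> linarith [ht.1, ht.2]
  have hcoord : ∀ i, |v i - T * (Fin.cons t τ : Fin (n + 1) → ℝ) i| ≤ 3 * (Q * b) := by
    rw [Fin.forall_fin_succ]
    have hQb : (Q : ℝ) ≤ Q * b := le_mul_of_one_le_right (by linarith) hb'
    refine ⟨?_, fun i => ?_⟩
    · rw [hv 0]
      have h2 := hu 0
      simp only [Fin.cons_zero] at h2
      have h3 : ((⌊t * T / Q⌋ : ℤ) : ℝ) ≤ t * T / Q := Int.floor_le _
      have h4 : t * T / Q < (⌊t * T / Q⌋ : ℤ) + 1 := Int.lt_floor_add_one _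
      have h5 : ((⌊t * T / Q⌋ : ℤ) : ℝ) ≤ u 0 := by exact_mod_cast h2.1
      have h6 : (u 0 : ℝ) ≤ (⌊t * T / Q⌋ : ℤ) + b := by exact_mod_cast h2.2.le
      have h7 : (Q : ℝ) * (t * T / Q) = t * T := by field_simp
      have h8 : (Q : ℝ) * u 0 ≤ t * T + Q * b := by nlinarith
      have h9 : t * T - Q ≤ (Q : ℝ) * u 0 := by nlinarith
      simp only [Pi.add_apply, Pi.single_eq_same, Fin.cons_zero]
      push_cast
      rw [abs_le]; constructor <;> linarith
    · rw [hv i.succ]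
      have h2 := hu i.succ
      simp only [Fin.cons_succ] at h2
      have h5 : (s i : ℝ) ≤ u i.succ := by exact_mod_cast h2.1
      have h6 : (u i.succ : ℝ) ≤ s i + b := by exact_mod_cast h2.2.le
      have h7 : T * τ i = Q * s i := by rw [hτ]; field_simp
      simp only [Pi.add_apply, Pi.single_apply, Fin.succ_ne_zero, if_false, Fin.cons_succ, zero_add]
      rw [h7]
      push_cast
      rw [abs_le]; constructor <;> nlinarith
  have hvT : v = T • (T⁻¹ • v) := by rw [smul_smul, mul_inv_cancel₀ hT.ne', one_smul]
  have hdist : ‖T⁻¹ • v - Fin.cons t τ‖ ≤ δ := by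
    rw [pi_norm_le_iff_of_nonneg hδ0]
    intro i
    rw [Pi.sub_apply, Pi.smul_apply, smul_eq_mul, Real.norm_eq_abs, hδ, le_div_iff₀ hT, ← abs_of_pos hT, ← abs_mul, abs_of_pos hT]
    have : (T⁻¹ * v i - (Fin.cons t τ : Fin (n + 1) → ℝ) i) * T = v i - T * (Fin.cons t τ : Fin (n + 1) → ℝ) i := by
      field_simp
    rw [this]; exact hcoord i
  have hN := hLip (T⁻¹ • v) (Fin.cons t τ) (by
    have h2 := norm_le_norm_add_norm_sub' (T⁻¹ • v) (Fin.cons t τ : Fin (n + 1) → ℝ)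
    have h3 := hnorm t htabs
    linarith) ((hnorm t htabs).trans (by norm_num))
  have hN2 : |Nr (T⁻¹ • v) - exp (h / 2)| ≤ h / 4 := by
    rw [← hφt]
    refine hN.trans (le_trans ?_ hδh)
    gcongr
  have hN3 := abs_le.1 hN2
  have hTp : 0 < T ^ (n + 1) := by positivity
  have hexh : exp (h / 2) + h / 2 ≤ exp h := by
    have : exp h = exp (h / 2) * exp (h / 2) := by rw [← exp_add]; ring_nf
    rw [this]; nlinarith
  refine ⟨?_, ?_, fun i => ?_⟩
  · rw [hvT, hhom]
    nlinarith [hN3.1]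
  · rw [hvT, hhom]
    gcongr
    linarith [hN3.2]
  · have h2 : |T * (Fin.cons t τ : Fin (n + 1) → ℝ) i - T * (Pi.single 0 1 : Fin (n + 1) → ℝ) i| ≤ β * T := by
      rw [← mul_sub, abs_mul, abs_of_pos hT, mul_comm]
      gcongr
      revert i
      rw [Fin.forall_fin_succ]
      refine ⟨?_, fun i => ?_⟩
      · simp only [Fin.cons_zero, Pi.single_eq_same]
        rw [abs_le]; constructor <;> linarith [ht.1, ht.2]
      · simp only [Fin.cons_succ, Pi.single_apply, Fin.succ_ne_zero, if_false, sub_zero]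
        rw [abs_of_nonneg (hτ0 i)]; linarith [hτ1 i]
    have h3 := hcoord i
    have h4 : 3 * ((Q : ℝ) * b) ≤ β * T := by
      have : δ * T ≤ β * T := by gcongr; linarith
      rwa [hδ, div_mul_cancel₀ _ hT.ne'] at this
    have h5 := abs_sub_le (v i) (T * (Fin.cons t τ : Fin (n + 1) → ℝ) i) (T * (Pi.single 0 1 : Fin (n + 1) → ℝ) i)
    linarith

theorem rough_sum_ge_grid {G : Polynomial ℤ} (hG : G.Monic) (hirr : Irreducible G) {n : ℕ} (hn : G.natDegree = n + 1)
    (hn1 : 1 ≤ n) :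
    ∃ Q K c₀ : ℕ, ∃ c β Λ : ℝ, 1 ≤ Q ∧ 0 < c ∧ 0 < β ∧ β ≤ 1 / 2 ∧ 1 ≤ Λ ∧
      ∀ w : ℕ, 2 ≤ w → 2 * c₀ ≤ w ^ 2 → ∀ (T h : ℝ) (b M : ℕ), 0 < T → 0 < h → h ≤ β / 2 → 1 ≤ b →
        12 * Λ * (Q * b) ≤ h * T → (Q * (b * M) : ℝ) ≤ β / (2 * Λ) * T →
        (M : ℝ) ^ n * (c * (b : ℝ) ^ (n + 1) / log w - (w : ℝ) ^ K * (b : ℝ) ^ n) -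
          2 ^ (n + 1) * (10 ^ (n + 1) * (2 * c₀)) * (2 * T) ^ (n + 1) * (2 / (w + 1)) ≤
        ((∑ P ∈ (Finset.Ioc ⌊T ^ (n + 1)⌋₊ ⌊T ^ (n + 1) * exp h⌋₊).filter (fun P => ∀ p : ℕ, p.Prime → p ∣ P → w < p),
          polyRho G P : ℕ) : ℝ) := by
  obtain ⟨Nr, hNr, hhom, hone, Λ, hΛ, hLip⟩ := exists_real_nf hG (n + 1)
  rw [hn] at hhom
  set e : Fin (n + 1) → ℤ := Pi.single 0 1 with he
  have heR : (fun i => (e i : ℝ)) = Pi.single 0 1 := by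
    funext i
    rw [he]
    by_cases hi : i = 0
    · subst hi; simp
    · simp [Pi.single_eq_of_ne hi]
  have hNr1 : Nr (Pi.single 0 1) = 1 := hone 0 rfl
  have hee : nf G e = 1 := by
    have := hNr e
    rw [heR, hNr1] at this
    exact_mod_cast this.symm
  obtain ⟨c₀, hc₀, hnfle⟩ := exists_abs_nf_le hG (by omega) (n + 1)
  obtain ⟨Q, K, c, hQ, hc, hbox⟩ := sieve_box hG hirr hn (by omega) e hee
  set β : ℝ := 1 / (8 * c₀) with hβ
  have hc₀' : (1 : ℝ) ≤ c₀ := by exact_mod_cast hc₀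
  have hβ0 : 0 < β := by positivity
  have hβ1 : β ≤ 1 / 8 := by rw [hβ, div_le_div_iff₀ (by positivity) (by norm_num)]; linarith
  have hβc : c₀ * (4 * β) ^ (n + 1) ≤ 1 := by
    have h1 : (4 * β) ^ (n + 1) ≤ 4 * β := by
      rw [pow_succ]
      have : (4 * β) ^ n ≤ 1 := pow_le_one₀ (by positivity) (by linarith)
      nlinarith
    have h2 : c₀ * (4 * β) = 1 / 2 := by rw [hβ]; field_simp; norm_num
    nlinarith
  refine ⟨Q, K, c₀, c, β, Λ, hQ, hc, hβ0, by linarith, hΛ, ?_⟩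
  intro w hw hwc T h b M hT hh hhβ hb hbT hM
  have hQ' : (1 : ℝ) ≤ Q := by exact_mod_cast hQ
  have hstart := fun (k : Fin n → Fin M) => exists_box_start hhom hNr1 hΛ hLip hβ0 (by linarith) hh hhβ hT hQ hb hbT
    (fun i => (b : ℤ) * (k i : ℕ)) (fun i => by
      refine ⟨by positivity, le_trans ?_ hM⟩
      push_cast
      have : ((k i : ℕ) : ℝ) ≤ M := by exact_mod_cast (k i).2.le
      gcongr)
  choose s0 hs0 using hstart
  set st : (Fin n → Fin M) → Fin (n + 1) → ℤ := fun k => Fin.cons (s0 k) (fun i => (b : ℤ) * (k i : ℕ)) with hst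
  set fb : (Fin n → Fin M) → Finset (Fin (n + 1) → ℤ) := fun k =>
    (ibox (st k) b).filter fun u => ∀ p : ℕ, p.Prime → p ≤ w → ¬ (p : ℤ) ∣ nf G (fun i => e i + Q * u i) with hfb
  set Us := (Finset.univ : Finset (Fin n → Fin M)).biUnion fb with hUs
  have hdisj : (↑(Finset.univ : Finset (Fin n → Fin M)) : Set (Fin n → Fin M)).PairwiseDisjoint fb := by
    intro k _ k' _ hkk'
    refine Finset.disjoint_left.2 fun u hu hu' => hkk' ?_
    have h1 := mem_ibox.1 (Finset.mem_filter.1 hu).1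
    have h2 := mem_ibox.1 (Finset.mem_filter.1 hu').1
    funext i
    have h3 := h1 i.succ
    have h4 := h2 i.succ
    simp only [hst, Fin.cons_succ] at h3 h4
    have hb' : (0 : ℤ) < b := by exact_mod_cast hb
    have h5 : ((k i : ℕ) : ℤ) < (k' i : ℕ) + 1 := by nlinarith
    have h6 : ((k' i : ℕ) : ℤ) < (k i : ℕ) + 1 := by nlinarith
    apply Fin.ext
    omega
  have hcardU : (M : ℝ) ^ n * (c * (b : ℝ) ^ (n + 1) / log w - (w : ℝ) ^ K * (b : ℝ) ^ n) ≤ (Us.card : ℝ) := by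
    rw [hUs, Finset.card_biUnion (fun k hk k' hk' => hdisj hk hk')]
    push_cast
    have h1 : ∀ k ∈ (Finset.univ : Finset (Fin n → Fin M)),
        c * (b : ℝ) ^ (n + 1) / log w - (w : ℝ) ^ K * (b : ℝ) ^ n ≤ ((fb k).card : ℝ) := fun k _ => hbox w hw (st k) b hb
    have h2 := Finset.card_nsmul_le_sum _ _ _ h1
    rw [Finset.card_univ, Fintype.card_fun, Fintype.card_fin, Fintype.card_fin, nsmul_eq_mul] at h2
    push_cast at h2
    exact h2
  set φ : (Fin (n + 1) → ℤ) → (Fin (n + 1) → ℤ) := fun u => fun i => e i + Q * u i with hφ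
  have hφi : Function.Injective φ := by
    intro u u' huu
    funext i
    have := congrFun huu i
    simp only [hφ] at this
    have hq : (Q : ℤ) ≠ 0 := by exact_mod_cast (by omega : Q ≠ 0)
    exact mul_left_cancel₀ hq (by linarith)
  set V := Us.image φ with hV
  have hVcard : V.card = Us.card := Finset.card_image_of_injective _ hφi
  have hprop : ∀ v ∈ V, (T ^ (n + 1) < (nf G v : ℝ) ∧ (nf G v : ℝ) ≤ T ^ (n + 1) * exp h ∧
      ∀ i, |(v i : ℝ) - T * (Pi.single 0 1 : Fin (n + 1) → ℝ) i| ≤ 2 * β * T) ∧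
      ∀ p : ℕ, p.Prime → p ≤ w → ¬ (p : ℤ) ∣ nf G v := by
    intro v hv
    obtain ⟨u, hu, rfl⟩ := Finset.mem_image.1 hv
    obtain ⟨k, -, hk⟩ := Finset.mem_biUnion.1 hu
    obtain ⟨h1, h2⟩ := Finset.mem_filter.1 hk
    refine ⟨?_, h2⟩
    rw [← hNr]
    exact hs0 k u h1 _ fun i => rfl
  have hTp : 0 < T ^ (n + 1) := by positivity
  have hV0 : ∀ v ∈ V, v ≠ 0 := by
    rintro v hv rfl
    have h1 := (hprop 0 hv).1.1
    have h2 := hNr 0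
    have h3 := hhom 0 0
    simp only [smul_zero, ne_eq, Nat.add_eq_zero_iff, one_ne_zero, and_false, not_false_eq_true, zero_pow, zero_mul] at h3
    have h4 : (fun i => (((0 : Fin (n + 1) → ℤ) i : ℤ) : ℝ)) = 0 := by funext i; simp
    rw [h4, h3] at h2
    rw [← h2] at h1
    linarith
  have hVB : ∀ v ∈ V, ∀ i, |(v i : ℝ)| ≤ 2 * T := by
    intro v hv i
    have h1 := (hprop v hv).1.2.2 i
    have h2 : |T * (Pi.single 0 1 : Fin (n + 1) → ℝ) i| ≤ T := by
      by_cases hi : i = 0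
      · subst hi; simp [abs_of_pos hT]
      · simp [Pi.single_eq_of_ne hi, hT.le]
    have h3 := abs_add_le ((v i : ℝ) - T * (Pi.single 0 1 : Fin (n + 1) → ℝ) i) (T * (Pi.single 0 1 : Fin (n + 1) → ℝ) i)
    rw [sub_add_cancel] at h3
    nlinarith
  have hexp : exp h ≤ 2 := by
    have h1 : exp h ≤ exp (1 / 2) := exp_le_exp.2 (by linarith)
    have h2 : exp (1 / 2) * exp (1 / 2) < 4 := by
      rw [← exp_add]; norm_num
      linarith [exp_one_lt_d9]
    nlinarith [exp_pos (1 / 2 : ℝ)]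
  have hVN : ∀ v ∈ V, |(nf G v : ℝ)| ≤ (2 * T) ^ (n + 1) := by
    intro v hv
    obtain ⟨⟨h1, h2, -⟩, -⟩ := hprop v hv
    rw [abs_of_pos (hTp.trans h1), mul_pow]
    have h3 : (2 : ℝ) ≤ 2 ^ (n + 1) := by
      calc (2 : ℝ) = 2 ^ 1 := by norm_num
        _ ≤ _ := pow_le_pow_right₀ (by norm_num) (by omega)
    nlinarith
  rw [hn] at hnfle
  have hbad := card_bad_le hG hirr hn (by omega) hc₀ hnfle V (by positivity : 0 ≤ 2 * T) hVB hV0 hVN hwc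
  set bad := V.filter fun v => ∃ p : ℕ, ∃ _ : Fact p.Prime, w < p ∧ ∃ f : Polynomial (ZMod p), f.Monic ∧ 2 ≤ f.natDegree ∧
    f ∣ G.map (Int.castRingHom (ZMod p)) ∧ f ∣ (pol v).map (Int.castRingHom (ZMod p)) with hbadd
  have hfin := card_le_sum_polyRho hG hirr (by omega) (V \ bad) (L := T ^ (n + 1)) (R := T ^ (n + 1) * exp h) (w := w) hTp.le
    (fun v hv => hV0 v (Finset.mem_sdiff.1 hv).1)
    (fun v hv => ⟨(hprop v (Finset.mem_sdiff.1 hv).1).1.1, (hprop v (Finset.mem_sdiff.1 hv).1).1.2.1⟩)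
    (fun v hv => (hprop v (Finset.mem_sdiff.1 hv).1).2)
    (fun v hv p hp hwp f hf h1 h2 => by
      by_contra hcon
      exact (Finset.mem_sdiff.1 hv).2 (Finset.mem_filter.2 ⟨(Finset.mem_sdiff.1 hv).1, p, hp, hwp, f, hf, not_lt.1 hcon, h1, h2⟩))
    (fun v hv v' hv' => by
      have h1 := (hprop v (Finset.mem_sdiff.1 hv).1).1.2.2
      have h2 := (hprop v' (Finset.mem_sdiff.1 hv').1).1.2.2
      have h3 := hnfle (v - v') (4 * β * T) (by positivity) (fun i => by
        have h4 := abs_sub ((v i : ℝ) - T * (Pi.single 0 1 : Fin (n + 1) → ℝ) i)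
          ((v' i : ℝ) - T * (Pi.single 0 1 : Fin (n + 1) → ℝ) i)
        rw [Pi.sub_apply]
        push_cast
        rw [sub_sub_sub_cancel_right] at h4
        linarith [h1 i, h2 i])
      refine h3.trans ?_
      rw [mul_pow, ← mul_assoc]
      nlinarith)
  have hsd : V.card ≤ (V \ bad).card + bad.card := by
    have := Finset.card_sdiff_add_card V bad
    have h2 : V.card ≤ (V ∪ bad).card := Finset.card_le_card Finset.subset_union_left
    omega
  have hsd' : (Us.card : ℝ) ≤ ((V \ bad).card : ℝ) + bad.card := by rw [← hVcard]; exact_mod_cast hsd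
  have hfin' : ((V \ bad).card : ℝ) ≤ _ := Nat.cast_le.2 hfin
  linarith

theorem half_le_floor {x : ℝ} (hx : 1 ≤ x) : x / 2 ≤ (⌊x⌋₊ : ℝ) := by
  have h1 : (1 : ℝ) ≤ ⌊x⌋₊ := by exact_mod_cast (Nat.one_le_floor_iff x).2 hx
  linarith [Nat.lt_floor_add_one x]

theorem rough_sum_ge_card {G : Polynomial ℤ} (hG : G.Monic) (hirr : Irreducible G) {n : ℕ} (hn : G.natDegree = n + 1)
    (hn1 : 1 ≤ n) :
    ∃ w₀ K : ℕ, ∃ h₀ c₁ c₂ c₃ : ℝ, 0 < h₀ ∧ h₀ ≤ 1 ∧ 0 < c₁ ∧ 0 < c₂ ∧ 0 < c₃ ∧ 2 ≤ w₀ ∧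
      ∀ w : ℕ, w₀ ≤ w → ∀ T h : ℝ, 0 < T → 0 < h → h ≤ h₀ → c₃ ≤ h * T →
        c₁ * (h * T ^ (n + 1)) / log w - c₂ * ((w : ℝ) ^ K * T ^ n + T ^ (n + 1) / w) ≤
        ((∑ P ∈ (Finset.Ioc ⌊T ^ (n + 1)⌋₊ ⌊T ^ (n + 1) * exp h⌋₊).filter (fun P => ∀ p : ℕ, p.Prime → p ∣ P → w < p),
          polyRho G P : ℕ) : ℝ) := by
  obtain ⟨Q, K, c₀, c, β, Λ, hQ, hc, hβ, hβ1, hΛ, H⟩ := rough_sum_ge_grid hG hirr hn hn1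
  have hQ' : (1 : ℝ) ≤ Q := by exact_mod_cast hQ
  set κ : ℝ := β / (2 * Λ) with hκ
  have hκ0 : 0 < κ := by positivity
  set E : ℝ := 2 ^ (n + 1) * (10 ^ (n + 1) * (2 * c₀)) * 2 ^ (n + 1) * 2 with hE
  have hE0 : 0 ≤ E := by positivity
  refine ⟨2 + 2 * c₀, K, β / 2, (κ / (2 * Q)) ^ n * c / (24 * Λ * Q), (κ / Q) ^ n + E, 12 * Λ * Q, by positivity, by linarith,
    by positivity, by positivity, by positivity, by omega, ?_⟩
  intro w hw T h hT hh hh0 hhT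
  have hw2 : 2 ≤ w := by omega
  have hwr : (2 : ℝ) ≤ w := by exact_mod_cast hw2
  have hlog : 0 < log w := log_pos (by linarith)
  set x : ℝ := h * T / (12 * Λ * Q) with hx
  have hx1 : 1 ≤ x := by rw [hx, le_div_iff₀ (by positivity)]; linarith
  set b := ⌊x⌋₊ with hb
  have hb1 : 1 ≤ b := (Nat.one_le_floor_iff x).2 hx1
  have hb1' : (1 : ℝ) ≤ b := by exact_mod_cast hb1
  have hbx : (b : ℝ) ≤ x := Nat.floor_le (by linarith)
  have hxb : x / 2 ≤ b := half_le_floor hx1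
  have hbT : 12 * Λ * (Q * b) ≤ h * T := by
    calc 12 * Λ * (Q * b) ≤ 12 * Λ * (Q * x) := by gcongr
      _ = h * T := by rw [hx]; field_simp
  set y : ℝ := κ * T / (Q * b) with hy
  have hQb : (Q : ℝ) * b ≤ κ * T := by
    have h1 : κ * T = β * T / (2 * Λ) := by rw [hκ]; ring
    rw [h1, le_div_iff₀ (by positivity)]
    have : h * T ≤ β / 2 * T := by gcongr
    nlinarith
  have hy1 : 1 ≤ y := by rw [hy, le_div_iff₀ (by positivity)]; linarith
  set M := ⌊y⌋₊ with hM
  have hMy : (M : ℝ) ≤ y := Nat.floor_le (by linarith)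
  have hyM : y / 2 ≤ M := half_le_floor hy1
  have hyb : y * b = κ * T / Q := by rw [hy]; field_simp
  have hMb : (M : ℝ) * b ≤ κ / Q * T := by
    calc (M : ℝ) * b ≤ y * b := by gcongr
      _ = κ / Q * T := by rw [hyb]; ring
  have hMb' : κ / (2 * Q) * T ≤ (M : ℝ) * b := by
    calc κ / (2 * Q) * T = y / 2 * b := by rw [show y / 2 * b = y * b / 2 by ring, hyb]; field_simp
      _ ≤ (M : ℝ) * b := by gcongr
  have hmain := H w hw2 (by nlinarith) T h b M hT hh hh0 hb1 hbT (by
    calc (Q * (b * M) : ℝ) = Q * (M * b) := by ring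
      _ ≤ Q * (κ / Q * T) := by gcongr
      _ = κ * T := by field_simp)
  refine le_trans ?_ hmain
  have e1 : (M : ℝ) ^ n * (c * (b : ℝ) ^ (n + 1) / log w - (w : ℝ) ^ K * (b : ℝ) ^ n) =
      (M * b : ℝ) ^ n * (c * b / log w) - (M * b : ℝ) ^ n * (w : ℝ) ^ K := by rw [mul_pow]; ring
  have h1 : (κ / (2 * Q)) ^ n * c / (24 * Λ * Q) * (h * T ^ (n + 1)) / log w ≤ (M * b : ℝ) ^ n * (c * b / log w) := by
    calc (κ / (2 * Q)) ^ n * c / (24 * Λ * Q) * (h * T ^ (n + 1)) / log w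
        = (κ / (2 * Q) * T) ^ n * (c * (x / 2) / log w) := by rw [hx, mul_pow, pow_succ]; field_simp; ring
      _ ≤ _ := by gcongr
  have h2 : (M * b : ℝ) ^ n * (w : ℝ) ^ K ≤ ((κ / Q) ^ n + E) * ((w : ℝ) ^ K * T ^ n) := by
    calc (M * b : ℝ) ^ n * (w : ℝ) ^ K ≤ (κ / Q * T) ^ n * (w : ℝ) ^ K := by gcongr
      _ = (κ / Q) ^ n * ((w : ℝ) ^ K * T ^ n) := by rw [mul_pow]; ring
      _ ≤ _ := by gcongr; linarith
  have h3 : 2 ^ (n + 1) * (10 ^ (n + 1) * (2 * c₀)) * (2 * T) ^ (n + 1) * (2 / (w + 1)) ≤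
      ((κ / Q) ^ n + E) * (T ^ (n + 1) / w) := by
    have hk : 0 ≤ (κ / Q) ^ n := by positivity
    calc 2 ^ (n + 1) * (10 ^ (n + 1) * (2 * c₀)) * (2 * T) ^ (n + 1) * (2 / ((w : ℝ) + 1))
        = E * (T ^ (n + 1) / (w + 1)) := by rw [hE, mul_pow]; ring
      _ ≤ E * (T ^ (n + 1) / w) := by gcongr; linarith
      _ ≤ _ := by gcongr; linarith
  rw [e1]
  linarith

/-- Integers free of prime factors up to `y ^ ε` carry their expected share of the roots of `G` in short intervals. -/
theorem rough_sum_ge {G : Polynomial ℤ} (hG : G.Monic) (hirr : Irreducible G) (hg : 2 ≤ G.natDegree) (C : ℝ) :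
    ∃ h₀ ε₀ : ℝ, 0 < h₀ ∧ h₀ ≤ 1 ∧ 0 < ε₀ ∧ ∀ ε, 0 < ε → ε ≤ ε₀ → ∃ c y₀ : ℝ, 0 < c ∧ ∀ y, y₀ ≤ y → ∀ h U : ℝ,
      (log y) ^ (-C) / 2 ≤ h → h ≤ h₀ → √y ≤ U →
      c * h / log y ≤ ∑ P ∈ (Finset.Ioc ⌊U⌋₊ ⌊U * exp h⌋₊).filter (fun P => ∀ p : ℕ, p.Prime → p ∣ P → ⌊y ^ ε⌋₊ < p),
        (polyRho G P : ℝ) / P := by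
  obtain ⟨n, hn⟩ : ∃ n, G.natDegree = n + 1 := ⟨G.natDegree - 1, by omega⟩
  obtain ⟨w₀, K, h₀, c₁, c₂, c₃, hh₀, hh₀1, hc₁, hc₂, hc₃, hw₀, H⟩ := rough_sum_ge_card hG hirr hn (by omega)
  set m : ℝ := n + 1 with hm
  have hm0 : 0 < m := by positivity
  refine ⟨h₀, 1 / (4 * m * (K + 1)), hh₀, hh₀1, by positivity, fun ε hε hε0 => ?_⟩
  have hKε : K * ε ≤ 1 / (4 * m) := by
    calc K * ε ≤ (K + 1) * (1 / (4 * m * (K + 1))) := by gcongr; linarith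
      _ = 1 / (4 * m) := by field_simp
  have hlim : ∀ a : ℝ, 0 < a → ∀ r A : ℝ, 0 < A → ∀ᶠ y : ℝ in Filter.atTop, A * (log y) ^ r ≤ y ^ a := by
    intro a ha r A hA
    have := (isLittleO_log_rpow_rpow_atTop r ha).bound (c := A⁻¹) (by positivity)
    filter_upwards [this, Filter.eventually_gt_atTop 1] with y hy hy1
    rw [Real.norm_of_nonneg (rpow_nonneg (log_nonneg hy1.le) _), Real.norm_of_nonneg (rpow_nonneg (by linarith) _)] at hy
    rw [inv_mul_eq_div, le_div_iff₀ hA] at hy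
    linarith
  have hev : ∀ᶠ y : ℝ in Filter.atTop, (c₃ * 2) * (log y) ^ C ≤ y ^ (1 / (2 * m)) ∧
      (16 * c₂ * ε / c₁) * (log y) ^ (C + 1) ≤ y ^ (1 / (4 * m)) ∧
      (16 * c₂ * ε / c₁) * (log y) ^ (C + 1) ≤ y ^ ε / 2 ∧ (w₀ : ℝ) ≤ y ^ ε ∧ 1 < y := by
    filter_upwards [hlim (1 / (2 * m)) (by positivity) C (c₃ * 2) (by positivity),
      hlim (1 / (4 * m)) (by positivity) (C + 1) (16 * c₂ * ε / c₁) (by positivity),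
      hlim ε hε (C + 1) (2 * (16 * c₂ * ε / c₁)) (by positivity),
      (tendsto_rpow_atTop hε).eventually_ge_atTop (w₀ : ℝ), Filter.eventually_gt_atTop 1] with y h1 h2 h3 h4 h5
    exact ⟨h1, h2, by linarith, h4, h5⟩
  obtain ⟨y₀, hy₀⟩ := Filter.eventually_atTop.1 hev
  refine ⟨c₁ / (2 * ε) / 3, y₀, by positivity, fun y hy h U hh1 hh2 hU => ?_⟩
  obtain ⟨e1, e2, e3, e4, e5⟩ := hy₀ y hy
  have hy0 : 0 < y := by linarith
  have hlog : 0 < log y := log_pos e5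
  have hh : 0 < h := lt_of_lt_of_le (by positivity) hh1
  have hU0 : 0 < U := lt_of_lt_of_le (sqrt_pos.2 hy0) hU
  set w := ⌊y ^ ε⌋₊ with hw
  have hww : w₀ ≤ w := Nat.le_floor e4
  have hw2 : (2 : ℝ) ≤ w := by exact_mod_cast hw₀.trans hww
  have hwy : (w : ℝ) ≤ y ^ ε := Nat.floor_le (by positivity)
  have hwy' : y ^ ε / 2 ≤ w := half_le_floor (one_le_rpow e5.le hε.le)
  have hlogw : 0 < log w := log_pos (by linarith)
  have hlogwy : log w ≤ ε * log y := by
    rw [← log_rpow hy0]; exact log_le_log (by linarith) hwy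
  set T := U ^ (1 / m) with hT
  have hT0 : 0 < T := by positivity
  have hTU : T ^ (n + 1) = U := by
    rw [hT, ← rpow_natCast, ← rpow_mul hU0.le, show (1 / m * ((n + 1 : ℕ) : ℝ)) = 1 by push_cast; rw [← hm]; field_simp, rpow_one]
  have hTy : y ^ (1 / (2 * m)) ≤ T := by
    rw [hT]
    calc y ^ (1 / (2 * m)) = (√y) ^ (1 / m) := by
          rw [sqrt_eq_rpow, ← rpow_mul hy0.le]; congr 1; field_simp
      _ ≤ _ := rpow_le_rpow (sqrt_nonneg _) hU (by positivity)
  have hhC : 1 ≤ 2 * h * (log y) ^ C := by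
    have h1 : (log y) ^ (-C) * (log y) ^ C = 1 := by rw [← rpow_add hlog]; simp
    have h2 : 0 < (log y) ^ C := by positivity
    nlinarith
  have hcT : c₃ ≤ h * T := by
    have h2 : 0 < (log y) ^ C := by positivity
    have h3 : c₃ * 2 * log y ^ C ≤ T := e1.trans hTy
    calc c₃ = c₃ * 1 := by ring
      _ ≤ c₃ * (2 * h * (log y) ^ C) := by gcongr
      _ = h * (c₃ * 2 * log y ^ C) := by ring
      _ ≤ h * T := by gcongr
  have hmain := H w hww T h hT0 hh hh2 hcT
  rw [hTU] at hmain
  have hTn : U = T ^ n * T := by rw [← hTU, pow_succ]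
  have hd : (16 * c₂ * ε / c₁) * (log y) ^ (C + 1) ≥ 8 * c₂ * ε / c₁ * (log y / h) := by
    rw [rpow_add hlog, rpow_one]
    have : 1 / h ≤ 2 * log y ^ C := by rw [div_le_iff₀ hh]; linarith
    calc 8 * c₂ * ε / c₁ * (log y / h) = 8 * c₂ * ε / c₁ * log y * (1 / h) := by ring
      _ ≤ 8 * c₂ * ε / c₁ * log y * (2 * log y ^ C) := by gcongr
      _ = _ := by ring
  have hq0 : 0 < 8 * c₂ * ε / c₁ * (log y / h) := by positivity
  have hwK : (w : ℝ) ^ K * T ^ n ≤ U / (8 * c₂ * ε / c₁ * (log y / h)) := by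
    rw [le_div_iff₀ hq0]
    have h1 : (w : ℝ) ^ K ≤ y ^ (1 / (4 * m)) := by
      calc (w : ℝ) ^ K ≤ (y ^ ε) ^ K := by gcongr
        _ = y ^ (K * ε) := by rw [← rpow_natCast, ← rpow_mul hy0.le]; congr 1; ring
        _ ≤ _ := rpow_le_rpow_of_exponent_le e5.le hKε
    have h2 : y ^ (1 / (4 * m)) * y ^ (1 / (4 * m)) ≤ T := by
      rw [← rpow_add hy0]
      calc y ^ (1 / (4 * m) + 1 / (4 * m)) = y ^ (1 / (2 * m)) := by congr 1; field_simp; norm_num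
        _ ≤ T := hTy
    rw [hTn]
    calc (w : ℝ) ^ K * T ^ n * (8 * c₂ * ε / c₁ * (log y / h))
        ≤ y ^ (1 / (4 * m)) * T ^ n * y ^ (1 / (4 * m)) := by gcongr; linarith
      _ = T ^ n * (y ^ (1 / (4 * m)) * y ^ (1 / (4 * m))) := by ring
      _ ≤ _ := by gcongr
  have hUw : U / w ≤ U / (8 * c₂ * ε / c₁ * (log y / h)) := by
    gcongr
    linarith
  have hsum : c₁ / (2 * ε) * (h * U) / log y ≤
      ((∑ P ∈ (Finset.Ioc ⌊U⌋₊ ⌊U * exp h⌋₊).filter (fun P => ∀ p : ℕ, p.Prime → p ∣ P → w < p),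
          polyRho G P : ℕ) : ℝ) := by
    refine le_trans ?_ hmain
    have h1 : c₁ * (h * U) / (ε * log y) ≤ c₁ * (h * U) / log w := by gcongr
    have h2 : c₂ * ((w : ℝ) ^ K * T ^ n + U / w) ≤ c₂ * (2 * (U / (8 * c₂ * ε / c₁ * (log y / h)))) := by gcongr; linarith
    have h3 : c₂ * (2 * (U / (8 * c₂ * ε / c₁ * (log y / h)))) = c₁ * (h * U) / (ε * log y) / 4 := by field_simp; norm_num
    have h4 : c₁ / (2 * ε) * (h * U) / log y = c₁ * (h * U) / (ε * log y) / 2 := by field_simp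
    have h5 : 0 ≤ c₁ * (h * U) / (ε * log y) := by positivity
    rw [h4]
    linarith
  have hexp : exp h ≤ 3 := (exp_le_exp.2 (hh2.trans hh₀1)).trans (by linarith [exp_one_lt_d9])
  calc c₁ / (2 * ε) / 3 * h / log y = c₁ / (2 * ε) * (h * U) / log y / (3 * U) := by field_simp
    _ ≤ ((∑ P ∈ (Finset.Ioc ⌊U⌋₊ ⌊U * exp h⌋₊).filter (fun P => ∀ p : ℕ, p.Prime → p ∣ P → w < p),
          polyRho G P : ℕ) : ℝ) / (3 * U) := by gcongr
    _ ≤ _ := by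
      push_cast
      rw [Finset.sum_div]
      refine Finset.sum_le_sum fun P hP => ?_
      obtain ⟨hP1, hP2⟩ := Finset.mem_Ioc.1 (Finset.mem_filter.1 hP).1
      have h1 : (P : ℝ) ≤ U * exp h := (Nat.le_floor_iff (by positivity)).1 hP2
      have h2 : (0 : ℝ) < P := by exact_mod_cast (by omega : 0 < P)
      gcongr
      nlinarith

theorem near_divisors_subset {a : ℕ} (ha : 0 < a) (η : ℝ) :
    {x : ℝ | ∃ d : ℕ, d ∣ a ∧ Real.exp x < (d : ℝ) ∧ (d : ℝ) ≤ Real.exp (x + η)} ⊆ Set.Ico (-η) (log a) := by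
  rintro x ⟨d, hd, h1, h2⟩
  have hd0 : 0 < d := Nat.pos_of_dvd_of_pos hd ha
  have hd1 : (1 : ℝ) ≤ d := by exact_mod_cast hd0
  have hda : (d : ℝ) ≤ a := by exact_mod_cast Nat.le_of_dvd ha hd
  constructor
  · have : 0 ≤ x + η := by
      rw [← exp_le_exp, exp_zero]; linarith
    linarith
  · rw [lt_log_iff_exp_lt (by linarith)]; linarith

theorem Lfun_nonneg (a : ℕ) (η : ℝ) : 0 ≤ Lfun a η := ENNReal.toReal_nonneg

theorem Lfun_prime_mul_le {p a : ℕ} (hp : p.Prime) (ha : 0 < a) (η : ℝ) : Lfun (p * a) η ≤ 2 * Lfun a η := by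
  set A : Set ℝ := {x : ℝ | ∃ d : ℕ, d ∣ a ∧ Real.exp x < (d : ℝ) ∧ (d : ℝ) ≤ Real.exp (x + η)} with hA
  have hfin : volume A ≠ ⊤ := ((measure_mono (near_divisors_subset ha η)).trans_lt (by simp)).ne
  have hsub : {x : ℝ | ∃ d : ℕ, d ∣ p * a ∧ Real.exp x < (d : ℝ) ∧ (d : ℝ) ≤ Real.exp (x + η)} ⊆
      A ∪ (fun x => x + -log p) ⁻¹' A := by
    rintro x ⟨d, hd, h1, h2⟩
    have hp0 : (0 : ℝ) < p := by exact_mod_cast hp.pos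
    by_cases hpd : p ∣ d
    · right
      obtain ⟨e, rfl⟩ := hpd
      refine ⟨e, Nat.dvd_of_mul_dvd_mul_left hp.pos hd, ?_, ?_⟩
      · rw [exp_add, exp_neg, exp_log hp0, mul_inv_lt_iff₀ hp0]
        push_cast at h1; linarith
      · rw [show x + -log p + η = (x + η) + -log p by ring, exp_add, exp_neg, exp_log hp0, le_mul_inv_iff₀ hp0]
        push_cast at h2; linarith
    · left
      exact ⟨d, (Nat.Coprime.dvd_mul_left ((Nat.coprime_comm.1 ((Nat.Prime.coprime_iff_not_dvd hp).2 hpd)))).1 hd, h1, h2⟩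
  have h1 := measure_mono hsub (μ := volume)
  have h2 := h1.trans (measure_union_le _ _)
  rw [measure_preimage_add_right] at h2
  rw [Lfun, Lfun, ← hA]
  have h3 := ENNReal.toReal_mono (by simp [hfin]) h2
  rw [ENNReal.toReal_add hfin hfin] at h3
  linarith

theorem exists_cells {a : ℕ} (ha : 0 < a) {η h : ℝ} (hh : 0 < h) (hη : 2 * h ≤ η) :
    ∃ J : Finset ℤ, Lfun a η ≤ 3 * h * J.card ∧ ∀ j ∈ J, ∀ t : ℝ, j * h ≤ t → t < (j + 1) * h →
      ∃ d : ℕ, d ∣ a ∧ exp t < (d : ℝ) ∧ (d : ℝ) ≤ exp (t + η) := by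
  set A : Set ℝ := {x : ℝ | ∃ d : ℕ, d ∣ a ∧ Real.exp x < (d : ℝ) ∧ (d : ℝ) ≤ Real.exp (x + η)} with hA
  set J : Finset ℤ := (Finset.Icc ⌊-η / h⌋ ⌈log a / h⌉).filter fun j => ∀ t : ℝ, j * h ≤ t → t < (j + 1) * h → t ∈ A with hJ
  refine ⟨J, ?_, fun j hj => (Finset.mem_filter.1 hj).2⟩
  have hmemJ : ∀ j : ℤ, (∀ t : ℝ, j * h ≤ t → t < (j + 1) * h → t ∈ A) → j ∈ J := by
    intro j hj
    refine Finset.mem_filter.2 ⟨?_, hj⟩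
    have := near_divisors_subset ha η (hj (j * h) le_rfl (by nlinarith))
    rw [Finset.mem_Icc]
    constructor
    · have h1 : -η / h ≤ j := by rw [div_le_iff₀ hh]; exact this.1
      exact_mod_cast (Int.floor_le (-η / h)).trans h1
    · have h1 : (j : ℝ) ≤ log a / h := by rw [le_div_iff₀ hh]; exact this.2.le
      exact_mod_cast h1.trans (Int.le_ceil _)
  have hcover : A ⊆ ⋃ j ∈ J, Set.Ico (((j : ℝ) - 1) * h) ((j + 2) * h) := by
    rintro x ⟨d, hd, h1, h2⟩
    have hd0 : (0 : ℝ) < d := by exact_mod_cast Nat.pos_of_dvd_of_pos hd ha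
    have hx1 : x < log d := (lt_log_iff_exp_lt hd0).2 h1
    have hx2 : log d - η ≤ x := by
      have := (log_le_iff_le_exp hd0).2 h2
      linarith
    have hmem : ∀ t, log d - η ≤ t → t < log d → t ∈ A := fun t ht1 ht2 =>
      ⟨d, hd, (lt_log_iff_exp_lt hd0).1 ht2, (log_le_iff_le_exp hd0).1 (by linarith)⟩
    set i := ⌊x / h⌋ with hi
    have hi1 : i * h ≤ x := by rw [← le_div_iff₀ hh]; exact Int.floor_le _
    have hi2 : x < (i + 1) * h := by rw [← div_lt_iff₀ hh]; exact Int.lt_floor_add_one _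
    simp only [Set.mem_iUnion, Set.mem_Ico]
    by_cases c1 : log d - η ≤ i * h
    · by_cases c2 : (i + 1) * h ≤ log d
      · exact ⟨i, hmemJ i fun t ht1 ht2 => hmem t (by linarith) (by linarith), by nlinarith, by nlinarith⟩
      · refine ⟨i - 1, hmemJ _ fun t ht1 ht2 => hmem t ?_ ?_, ?_, ?_⟩ <;> push_cast at * <;> nlinarith
    · refine ⟨i + 1, hmemJ _ fun t ht1 ht2 => hmem t ?_ ?_, ?_, ?_⟩ <;> push_cast at * <;> nlinarith
  have h1 := (measure_mono hcover (μ := volume)).trans (measure_biUnion_finset_le J _)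
  simp only [Real.volume_Ico] at h1
  have h2 : ∀ j : ℤ, ENNReal.ofReal ((j + 2) * h - (j - 1) * h) = ENNReal.ofReal (3 * h) := fun j => by congr 1; ring
  simp only [h2, Finset.sum_const, nsmul_eq_mul] at h1
  have h3 := ENNReal.toReal_mono (ENNReal.mul_ne_top (ENNReal.natCast_ne_top _) ENNReal.ofReal_ne_top) h1
  rw [ENNReal.toReal_mul, ENNReal.toReal_natCast, ENNReal.toReal_ofReal (by positivity)] at h3
  rw [Lfun, ← hA]
  linarith

/-- For fixed `a`, the rough `P` such that some divisor of `a` times `P` lies in `(y, z]`. -/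
noncomputable def roughCofactors (a w : ℕ) (y z : ℝ) : Finset ℕ :=
  (Finset.Icc 1 ⌊z⌋₊).filter fun P => (∀ p : ℕ, p.Prime → p ∣ P → w < p) ∧
    ∃ d : ℕ, d ∣ a ∧ y < (d * P : ℕ) ∧ ((d * P : ℕ) : ℝ) ≤ z

theorem Lfun_le_sum_roughCofactors {G : Polynomial ℤ} (hG : G.Monic) (hirr : Irreducible G) (hg : 2 ≤ G.natDegree)
    {C : ℝ} (hC : 0 < C) :
    ∃ ε₀ : ℝ, 0 < ε₀ ∧ ∀ ε, 0 < ε → ε ≤ ε₀ → ∃ c y₀ : ℝ, 0 < c ∧ ∀ y z, y₀ ≤ y →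
      (log y) ^ (-C) ≤ log (z / y) → y < z → ∀ a : ℕ, 0 < a → (a : ℝ) ≤ y ^ (1 / 4 : ℝ) →
      c * Lfun a (log (z / y)) / log y ≤ ∑ P ∈ roughCofactors a ⌊y ^ ε⌋₊ y z, (polyRho G P : ℝ) / P := by
  obtain ⟨h₀, ε₀, hh₀, hh₀1, hε₀, H⟩ := rough_sum_ge hG hirr hg C
  refine ⟨ε₀, hε₀, fun ε hε hεε => ?_⟩
  obtain ⟨c, y₁, hc, H⟩ := H ε hε hεε
  have hev : ∀ᶠ y : ℝ in Filter.atTop, y₁ ≤ y ∧ exp 2 ≤ y ^ (1 / 4 : ℝ) ∧ 1 < y ∧ (log y) ^ (-C) ≤ h₀ := by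
    filter_upwards [Filter.eventually_ge_atTop y₁, (tendsto_rpow_atTop (show (0 : ℝ) < 1 / 4 by norm_num)).eventually_ge_atTop (exp 2),
      Filter.eventually_gt_atTop 1, ((tendsto_rpow_neg_atTop hC).comp tendsto_log_atTop).eventually_le_const hh₀] with y h1 h2 h3 h4
    exact ⟨h1, h2, h3, h4⟩
  obtain ⟨y₀, hy₀⟩ := Filter.eventually_atTop.1 hev
  refine ⟨c / 3, y₀, by positivity, fun y z hy hη hyz a ha hay => ?_⟩
  obtain ⟨e1, e2, e3, e4⟩ := hy₀ y hy
  have hy0 : 0 < y := by linarith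
  have hlog : 0 < log y := log_pos e3
  set η := log (z / y) with hηd
  have hlC : 0 < log y ^ (-C) := by positivity
  have hη0 : 0 < η := hlC.trans_le hη
  have hexpη : exp η = z / y := exp_log (by apply div_pos <;> linarith)
  set h := min (η / 2) h₀ with hh
  have hh1 : h ≤ η / 2 := min_le_left _ _
  have hh2 : h ≤ h₀ := min_le_right _ _
  have hh3 : log y ^ (-C) / 2 ≤ h := le_min (by linarith) (by linarith)
  have hhpos : 0 < h := lt_of_lt_of_le (by positivity) hh3
  obtain ⟨J, hJ1, hJ2⟩ := exists_cells ha hhpos (by linarith : 2 * h ≤ η)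
  set U : ℤ → ℝ := fun j => y * exp (-((j + 1) * h)) with hU
  have hUpos : ∀ j, 0 < U j := fun j => by positivity
  have hUe : ∀ j, U j * exp h = y * exp (-(j * h)) := fun j => by
    rw [hU]; simp only; rw [mul_assoc, ← exp_add]; congr 2; ring
  set cell : ℤ → Finset ℕ := fun j => (Finset.Ioc ⌊U j⌋₊ ⌊U j * exp h⌋₊).filter
    (fun P => ∀ p : ℕ, p.Prime → p ∣ P → ⌊y ^ ε⌋₊ < p) with hcell
  have hmem : ∀ j, ∀ P ∈ cell j, 0 < P ∧ j * h ≤ log (y / P) ∧ log (y / P) < (j + 1) * h ∧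
      ∀ p : ℕ, p.Prime → p ∣ P → ⌊y ^ ε⌋₊ < p := by
    intro j P hP
    obtain ⟨h1, h2⟩ := Finset.mem_filter.1 hP
    obtain ⟨h3, h4⟩ := Finset.mem_Ioc.1 h1
    have hP0 : 0 < P := by omega
    have hP0' : (0 : ℝ) < P := by exact_mod_cast hP0
    have h5 : U j < P := (Nat.floor_lt (hUpos j).le).1 h3
    have h6 : (P : ℝ) ≤ U j * exp h := (Nat.le_floor_iff (by positivity)).1 h4
    rw [hUe, exp_neg, ← div_eq_mul_inv, le_div_iff₀ (exp_pos _)] at h6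
    simp only [hU] at h5
    rw [exp_neg, ← div_eq_mul_inv, div_lt_iff₀ (exp_pos _)] at h5
    refine ⟨hP0, ?_, ?_, h2⟩
    · rw [le_log_iff_exp_le (by positivity), le_div_iff₀ hP0']; linarith
    · rw [log_lt_iff_lt_exp (by positivity), div_lt_iff₀ hP0']; linarith
  have hdisj : ∀ j ∈ J, ∀ k ∈ J, j ≠ k → Disjoint (cell j) (cell k) := by
    intro j _ k _ hjk
    refine Finset.disjoint_left.2 fun P hP hP' => hjk ?_
    obtain ⟨-, h1, h2, -⟩ := hmem j P hP
    obtain ⟨-, h3, h4, -⟩ := hmem k P hP'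
    have h5 : (j : ℝ) < k + 1 := lt_of_mul_lt_mul_right (by linarith) hhpos.le
    have h6 : (k : ℝ) < j + 1 := lt_of_mul_lt_mul_right (by linarith) hhpos.le
    have h5' : j < k + 1 := by exact_mod_cast h5
    have h6' : k < j + 1 := by exact_mod_cast h6
    omega
  have hsub : J.biUnion cell ⊆ roughCofactors a ⌊y ^ ε⌋₊ y z := by
    intro P hP
    obtain ⟨j, hj, hPj⟩ := Finset.mem_biUnion.1 hP
    obtain ⟨hP0, h1, h2, h3⟩ := hmem j P hPj
    have hP0' : (0 : ℝ) < P := by exact_mod_cast hP0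
    obtain ⟨d, hd, hd1, hd2⟩ := hJ2 j hj _ h1 h2
    rw [exp_log (by positivity), div_lt_iff₀ hP0'] at hd1
    rw [exp_add, exp_log (by positivity), hexpη, show y / P * (z / y) = z / P by field_simp, le_div_iff₀ hP0'] at hd2
    have hd0 : (1 : ℝ) ≤ d := by exact_mod_cast Nat.pos_of_dvd_of_pos hd ha
    refine Finset.mem_filter.2 ⟨Finset.mem_Icc.2 ⟨hP0, Nat.le_floor (by nlinarith)⟩, h3, d, hd, ?_, ?_⟩ <;> push_cast <;> assumption
  have hcells : ∀ j ∈ J, c * h / log y ≤ ∑ P ∈ cell j, (polyRho G P : ℝ) / P := by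
    intro j hj
    refine H y e1 h (U j) hh3 hh2 ?_
    have h1 := near_divisors_subset ha η (hJ2 j hj (j * h) le_rfl (by nlinarith))
    have ha0 : (0 : ℝ) < a := by exact_mod_cast ha
    have h2 : exp ((j + 1) * h) ≤ a * exp 2 := by
      rw [← exp_log ha0, ← exp_add, exp_le_exp]
      nlinarith [h1.2]
    have h3 : exp ((j + 1) * h) ≤ √y := by
      have h4 : y ^ (1 / 4 : ℝ) * y ^ (1 / 4 : ℝ) = √y := by
        rw [← rpow_add hy0, sqrt_eq_rpow]; norm_num
      rw [← h4]
      exact h2.trans (mul_le_mul hay e2 (exp_pos _).le (by positivity))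
    rw [hU]; simp only
    rw [exp_neg, ← div_eq_mul_inv, le_div_iff₀ (exp_pos _)]
    calc √y * exp ((j + 1) * h) ≤ √y * √y := by gcongr
      _ = y := mul_self_sqrt hy0.le
  calc c / 3 * Lfun a η / log y ≤ c / 3 * (3 * h * J.card) / log y := by gcongr
    _ = J.card • (c * h / log y) := by rw [nsmul_eq_mul]; ring
    _ ≤ ∑ j ∈ J, ∑ P ∈ cell j, (polyRho G P : ℝ) / P := Finset.card_nsmul_le_sum _ _ _ hcells
    _ = ∑ P ∈ J.biUnion cell, (polyRho G P : ℝ) / P := (Finset.sum_biUnion hdisj).symm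
    _ ≤ _ := Finset.sum_le_sum_of_subset_of_nonneg hsub fun _ _ _ => by positivity

theorem polyH_sub_half (F : Polynomial ℤ) {x : ℝ} (hx : 0 ≤ x) (y z : ℝ) :
    (polyH F x y z : ℝ) - (polyH F (x / 2) y z : ℝ) = (((Finset.Ioc ⌊x / 2⌋₊ ⌊x⌋₊).filter fun n : ℕ =>
      ∃ d : ℕ, 0 < d ∧ (d : ℤ) ∣ F.eval (n : ℤ) ∧ y < (d : ℝ) ∧ (d : ℝ) ≤ z).card : ℝ) := by
  have key : ∀ t : ℝ, 0 ≤ t → polyH F t y z = ((Finset.Ioc 0 ⌊t⌋₊).filter fun n : ℕ =>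
      ∃ d : ℕ, 0 < d ∧ (d : ℤ) ∣ F.eval (n : ℤ) ∧ y < (d : ℝ) ∧ (d : ℝ) ≤ z).card := by
    intro t ht
    rw [polyH, ← Set.ncard_coe_finset]
    congr 1
    ext n
    simp only [Set.mem_ofPred_eq, Finset.coe_filter, Finset.mem_Ioc, Nat.le_floor_iff ht, and_assoc]
  rw [key x hx, key (x / 2) (by positivity)]
  have hle : ⌊x / 2⌋₊ ≤ ⌊x⌋₊ := Nat.floor_mono (by linarith)
  have hu : Finset.Ioc 0 ⌊x⌋₊ = Finset.Ioc 0 ⌊x / 2⌋₊ ∪ Finset.Ioc ⌊x / 2⌋₊ ⌊x⌋₊ :=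
    (Finset.Ioc_union_Ioc_eq_Ioc (Nat.zero_le _) hle).symm
  rw [hu, Finset.filter_union, Finset.card_union_of_disjoint]
  · push_cast; ring
  · refine Finset.disjoint_filter_filter (Finset.disjoint_left.2 fun n h1 h2 => ?_)
    rw [Finset.mem_Ioc] at h1 h2
    omega

theorem Psf_eq_image (D : ℕ) {z : ℝ} (hz : 0 ≤ z) :
    Psf D z = ↑((prs D ⌊z⌋₊).powerset.image fun S => ∏ p ∈ S, p) := by
  ext a
  simp only [Psf, Set.mem_ofPred_eq, Finset.coe_image, Set.mem_image, Finset.mem_coe, Finset.mem_powerset]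
  constructor
  · rintro ⟨ha, hsq, hp⟩
    refine ⟨a.primeFactors, fun p hp' => mem_prs.2 ?_, Nat.prod_primeFactors_of_squarefree hsq⟩
    have h1 := Nat.prime_of_mem_primeFactors hp'
    have h2 := hp p h1 (Nat.dvd_of_mem_primeFactors hp')
    exact ⟨⟨by exact_mod_cast h2.1, Nat.le_floor h2.2⟩, h1⟩
  · rintro ⟨S, hS, rfl⟩
    have hprime : ∀ p ∈ S, p.Prime := fun p hp => (mem_prs.1 (hS hp)).2
    refine ⟨Finset.prod_pos fun p hp => (hprime p hp).pos, ?_, fun p hp hpd => ?_⟩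
    · refine Finset.squarefree_prod_of_pairwise_isCoprime (fun p hp q hq hpq => ?_)
        fun p hp => (hprime p hp).prime.squarefree
      exact Nat.coprime_iff_isRelPrime.1 ((Nat.coprime_primes (hprime p hp) (hprime q hq)).2 hpq)
    · obtain ⟨q, hq, hpq⟩ := (hp.prime.dvd_finsetProd_iff _).1 hpd
      rw [(Nat.prime_dvd_prime_iff_eq hp (hprime q hq)).1 hpq]
      have := mem_prs.1 (hS hq)
      exact ⟨by exact_mod_cast this.1.1, (Nat.le_floor_iff hz).1 this.1.2⟩

theorem tsum_Psf_eq (D : ℕ) {z : ℝ} (hz : 0 ≤ z) (f : ℕ → ℝ) :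
    ∑' a : (Psf D z), f a = ∑ S ∈ (prs D ⌊z⌋₊).powerset, f (∏ p ∈ S, p) := by
  rw [Psf_eq_image D hz, Finset.tsum_subtype', Finset.sum_image]
  intro S hS T hT h
  exact prod_injOn (Finset.mem_powerset.1 hS) (Finset.mem_powerset.1 hT) h

/-- The Lebesgue weight attached to `a` in the main sum. -/
noncomputable def weight (F : Polynomial ℤ) (η : ℝ) (a : ℕ) : ℝ := Lfun a η * (polyRho F a : ℝ) / (a : ℝ)

theorem weight_nonneg (F : Polynomial ℤ) (η : ℝ) (a : ℕ) : 0 ≤ weight F η a := by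
  have := Lfun_nonneg a η
  unfold weight; positivity

theorem not_dvd_leadingCoeff {F : Polynomial ℤ} (hF : F ≠ 0) {p : ℕ} (hp : F.leadingCoeff.natAbs < p) :
    ¬ (p : ℤ) ∣ F.leadingCoeff := by
  intro h
  have h1 := Int.natAbs_dvd_natAbs.2 h
  rw [Int.natAbs_natCast] at h1
  have := Nat.le_of_dvd (Int.natAbs_pos.2 (Polynomial.leadingCoeff_ne_zero.2 hF)) h1
  omega

theorem weight_insert_le {F : Polynomial ℤ} (hF : F ≠ 0) {D v : ℕ} (hD : F.leadingCoeff.natAbs ≤ D) (η : ℝ) {S : Finset ℕ}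
    (hS : S ⊆ prs D v) {p : ℕ} (hp : p ∈ prs D v) (hpS : p ∉ S) :
    weight F η (∏ q ∈ insert p S, q) ≤ (2 * F.natDegree / p : ℝ) * weight F η (∏ q ∈ S, q) := by
  have hprime : ∀ q ∈ S, q.Prime := fun q hq => (mem_prs.1 (hS hq)).2
  obtain ⟨⟨hpD, -⟩, hpp⟩ := mem_prs.1 hp
  rw [Finset.prod_insert hpS]
  set a := ∏ q ∈ S, q with ha
  have ha0 : 0 < a := Finset.prod_pos fun q hq => (hprime q hq).pos
  have hcop : Nat.Coprime p a := by
    rw [ha]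
    exact Nat.Coprime.prod_right fun q hq => (Nat.coprime_primes hpp (hprime q hq)).2 fun h => hpS (h ▸ hq)
  have h1 := Lfun_prime_mul_le hpp ha0 η
  have h2 : (polyRho F p : ℝ) ≤ F.natDegree := by
    exact_mod_cast polyRho_prime_le F hpp (not_dvd_leadingCoeff hF (by omega))
  have hL := Lfun_nonneg a η
  have hp0 : (0 : ℝ) < p := by exact_mod_cast hpp.pos
  have ha0' : (0 : ℝ) < a := by exact_mod_cast ha0
  unfold weight
  rw [polyRho_mul F hpp.pos ha0 hcop]
  push_cast
  calc Lfun (p * a) η * ((polyRho F p : ℝ) * polyRho F a) / (p * a)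
      ≤ (2 * Lfun a η) * (F.natDegree * polyRho F a) / (p * a) := by gcongr
    _ = _ := by field_simp

theorem sum_weight_le {F : Polynomial ℤ} (hF : F ≠ 0) {D w v : ℕ} (hD : F.leadingCoeff.natAbs ≤ D) (hD1 : 1 ≤ D)
    (hDw : D ≤ w) (hwv : w ≤ v) (η : ℝ) {A Y : ℝ} (hv2 : 2 ≤ v) (hA : log v ≤ A * log (w + 1 : ℕ)) (hY : 1 < Y)
    (hwY : 2 * F.natDegree * (log w + log 4) ≤ log Y / 2) :
    ∑ S ∈ (prs D v).powerset, weight F η (∏ p ∈ S, p) ≤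
      2 * exp (6 * F.natDegree * A) *
        ∑ S ∈ (prs D w).powerset.filter (fun S => ((∏ p ∈ S, p : ℕ) : ℝ) ≤ Y), weight F η (∏ p ∈ S, p) := by
  have hpos : ∀ S : Finset ℕ, 0 ≤ weight F η (∏ p ∈ S, p) := fun S => weight_nonneg _ _ _
  have h1 := sum_powerset_union_le (A := prs D w) (B := prs w v) prs_disjoint (fun S => weight F η (∏ p ∈ S, p))
    (fun p => (2 * F.natDegree / p : ℝ)) (fun p _ => by positivity) (fun S hS p hp hpS => by
      rw [prs_union hDw hwv] at hS
      refine weight_insert_le hF hD η hS ?_ hpS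
      rw [← prs_union hDw hwv]
      exact Finset.mem_union_right _ hp)
  rw [prs_union hDw hwv] at h1
  have h2 : ∏ p ∈ prs w v, (1 + (2 * F.natDegree / p : ℝ)) ≤ exp (6 * F.natDegree * A) := by
    refine (prod_one_add_le_exp _ _ fun p _ => by positivity).trans (exp_le_exp.2 ?_)
    have := sum_inv_prs w v A (hD1.trans hDw) hv2 hA
    calc ∑ p ∈ prs w v, (2 * F.natDegree / p : ℝ) = 2 * F.natDegree * ∑ p ∈ prs w v, (1 : ℝ) / p := by
          rw [Finset.mul_sum]; exact Finset.sum_congr rfl fun p _ => by ring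
      _ ≤ 2 * F.natDegree * (3 * A) := by gcongr
      _ = _ := by ring
  have h3 := sum_powerset_le_two_mul (prs D w) (fun p hp => (mem_prs.1 hp).2.one_le) (fun S => weight F η (∏ p ∈ S, p))
    (fun p => (2 * F.natDegree / p : ℝ)) (fun p _ => by positivity) (fun S _ => hpos S)
    (fun S hS p hp hpS => weight_insert_le hF hD η hS hp hpS) Y hY (by
      have := sum_log_div_prs D w (hD1.trans hDw)
      calc ∑ p ∈ prs D w, (2 * F.natDegree / p : ℝ) * log p = 2 * F.natDegree * ∑ p ∈ prs D w, log p / p := by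
            rw [Finset.mul_sum]; exact Finset.sum_congr rfl fun p _ => by ring
        _ ≤ 2 * F.natDegree * (log w + log 4) := by gcongr
        _ ≤ _ := hwY)
  calc _ ≤ _ := h1
    _ ≤ exp (6 * F.natDegree * A) * (2 * ∑ S ∈ (prs D w).powerset.filter (fun S => ((∏ p ∈ S, p : ℕ) : ℝ) ≤ Y),
        weight F η (∏ p ∈ S, p)) := mul_le_mul h2 h3 (Finset.sum_nonneg fun S _ => hpos S) (exp_pos _).le
    _ = _ := by ring

theorem abs_card_Ioc_dvd_sub_le (F : Polynomial ℤ) (A b : ℕ) {d : ℕ} (hd : 0 < d) :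
    |(((Finset.Ioc A (A + b)).filter fun n : ℕ => (d : ℤ) ∣ F.eval (n : ℤ)).card : ℝ) - b * (polyRho F d / d)| ≤
      polyRho F d := by
  have h := abs_card_ibox_dvd_sub_le (congPres_eval F) (fun _ => ((A + 1 : ℕ) : ℤ)) b hd
  have hcard : ((Finset.Ioc A (A + b)).filter fun n : ℕ => (d : ℤ) ∣ F.eval (n : ℤ)).card =
      ((ibox (fun _ : Fin 1 => ((A + 1 : ℕ) : ℤ)) b).filter fun v => (d : ℤ) ∣ F.eval (v 0)).card := by
    refine Finset.card_bij (fun n _ => fun _ => (n : ℤ)) ?_ ?_ ?_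
    · intro n hn
      simp only [Finset.mem_filter, Finset.mem_Ioc, mem_ibox] at hn ⊢
      refine ⟨fun i => ⟨by exact_mod_cast hn.1.1, ?_⟩, hn.2⟩
      have := hn.1.2
      push_cast; omega
    · intro n _ n' _ h
      exact_mod_cast congrFun h 0
    · intro v hv
      simp only [Finset.mem_filter, mem_ibox] at hv
      obtain ⟨h1, h2⟩ := hv.1 0
      push_cast at h1 h2
      have h3 : (((v 0).toNat : ℕ) : ℤ) = v 0 := Int.toNat_of_nonneg (by omega)
      refine ⟨(v 0).toNat, ?_, ?_⟩
      · rw [Finset.mem_filter, Finset.mem_Ioc, h3]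
        exact ⟨by omega, hv.2⟩
      · funext i
        rw [h3, Subsingleton.elim i 0]
  rw [← polyRho_eq_numZeros] at h
  rw [hcard]
  have e : (polyRho F d : ℝ) * ((b : ℝ) / d) ^ 1 = b * (polyRho F d / d) := by ring
  rw [e] at h
  simpa using h

theorem polyRho_integralNormalization_of_rough {F : Polynomial ℤ} (hF : F ≠ 0) (hdeg : 1 ≤ F.natDegree) {d : ℕ} (hd : 0 < d)
    (h : ∀ p : ℕ, p.Prime → p ∣ d → F.leadingCoeff.natAbs < p) : polyRho F.integralNormalization d = polyRho F d := by
  refine polyRho_integralNormalization F hdeg hd ?_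
  rw [Int.isCoprime_iff_gcd_eq_one]
  refine Nat.Coprime.symm (Nat.Coprime.symm ?_)
  refine Nat.coprime_of_dvd fun p hp h1 h2 => ?_
  have h3 := Nat.le_of_dvd (Int.natAbs_pos.2 (Polynomial.leadingCoeff_ne_zero.2 hF)) h1
  have h4 := h p hp (by simpa using h2)
  omega

theorem sieve_multiples {F : Polynomial ℤ} (hF : Irreducible F) (hdeg : 1 ≤ F.natDegree) :
    ∃ D₀ K : ℕ, ∃ c : ℝ, 0 < c ∧ ∀ D v : ℕ, D₀ ≤ D → 2 ≤ v → ∀ (A b m : ℕ), 0 < m →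
      c * b * (polyRho F m / m) / log v - (v + 1) * (v : ℝ) ^ K * polyRho F m ≤
        (((Finset.Ioc A (A + b)).filter fun n : ℕ => (m : ℤ) ∣ F.eval (n : ℤ) ∧
          ∀ p ∈ prs D v, ¬ p ∣ m → ¬ (p : ℤ) ∣ F.eval (n : ℤ)).card : ℝ) := by
  obtain ⟨D₁, c, hc, hprod⟩ := prod_one_sub_ge (Polynomial.monic_integralNormalization hF.ne_zero)
    (irreducible_integralNormalization hF hdeg) (by rw [Polynomial.natDegree_integralNormalization]; exact hdeg) (E := 0) le_rfl
  set g := F.natDegree with hg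
  obtain ⟨K, hsieve⟩ := sieve_lower (g : ℝ) (by positivity)
  refine ⟨D₁ + 2 * g + F.leadingCoeff.natAbs, 2 * K, c / 2, by positivity, fun D v hD hv A b m hm => ?_⟩
  have hv' : (1 : ℝ) ≤ v := by exact_mod_cast (by omega : 1 ≤ v)
  set P := (prs D v).filter fun p => ¬ p ∣ m with hP
  have hprime : ∀ p ∈ prs D v, p.Prime := fun p hp => (mem_prs.1 hp).2
  have hρ : ∀ p ∈ prs D v, 0 ≤ (polyRho F p : ℝ) / p ∧ (polyRho F p : ℝ) / p ≤ g / p ∧ (polyRho F p : ℝ) / p ≤ 1 / 2 := by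
    intro p hp
    have hp0 : (0 : ℝ) < p := by exact_mod_cast (hprime p hp).pos
    have hpD := (mem_prs.1 hp).1.1
    have h1 : (polyRho F p : ℝ) ≤ g := by
      exact_mod_cast polyRho_prime_le F (hprime p hp) (not_dvd_leadingCoeff hF.ne_zero (by omega))
    have h2 : (2 * g : ℝ) ≤ p := by exact_mod_cast (by omega : 2 * g ≤ p)
    refine ⟨by positivity, by gcongr, ?_⟩
    rw [div_le_iff₀ hp0]; linarith
  have hmain := hsieve v (by omega) P
    (fun p hp => by
      have := Finset.mem_of_mem_filter p hp
      exact mem_prs.2 ⟨⟨(hprime p this).pos, (mem_prs.1 this).1.2⟩, hprime p this⟩)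
    (fun p => (polyRho F p : ℝ) / p) (fun p hp => hρ p (Finset.mem_of_mem_filter p hp))
    ((Finset.Ioc A (A + b)).filter fun n : ℕ => (m : ℤ) ∣ F.eval (n : ℤ)) (fun p n => (p : ℤ) ∣ F.eval (n : ℤ))
    (b * (polyRho F m / m)) ((v : ℝ) ^ K * polyRho F m) (by positivity) (by positivity)
    (fun S hS hSK => by
      have hSp : ∀ p ∈ S, p.Prime := fun p hp => hprime p (Finset.mem_of_mem_filter p (hS hp))
      set d := ∏ p ∈ S, p with hd
      have hd0 : 0 < d := Finset.prod_pos fun p hp => (hSp p hp).pos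
      have hcop : Nat.Coprime m d := by
        rw [hd]
        exact Nat.Coprime.prod_right fun p hp =>
          Nat.coprime_comm.1 ((Nat.Prime.coprime_iff_not_dvd (hSp p hp)).2 (Finset.mem_filter.1 (hS hp)).2)
      have h1 := abs_card_Ioc_dvd_sub_le F A b (Nat.mul_pos hm hd0)
      rw [polyRho_mul F hm hd0 hcop] at h1
      have h2 : (b : ℝ) * (polyRho F m / m) * ∏ p ∈ S, (polyRho F p : ℝ) / p =
          b * (((polyRho F m * polyRho F d : ℕ) : ℝ) / ((m * d : ℕ) : ℝ)) := by
        rw [Finset.prod_div_distrib, hd, polyRho_prod F S hSp]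
        push_cast
        ring
      rw [h2]
      have h3 : ((polyRho F m * polyRho F d : ℕ) : ℝ) ≤ (v : ℝ) ^ K * polyRho F m := by
        have h4 : (polyRho F d : ℝ) ≤ (v : ℝ) ^ K := by exact_mod_cast (polyRho_le F d).trans hSK
        push_cast
        rw [mul_comm]
        gcongr
      refine le_trans (le_of_eq ?_) (h1.trans h3)
      congr 4
      ext a
      simp only [Finset.mem_filter, and_assoc]
      refine and_congr_right fun _ => ?_
      rw [← prod_primes_dvd_iff S hSp, ← hd, Nat.cast_mul]
      exact ⟨fun h => (Nat.isCoprime_iff_coprime.2 hcop).mul_dvd h.1 h.2, fun h =>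
        ⟨(dvd_mul_right _ _).trans h, (dvd_mul_left _ _).trans h⟩⟩)
  have hP1 : c / log v ≤ ∏ p ∈ P, (1 - (polyRho F p : ℝ) / p) := by
    refine (hprod D v (by omega) hv (fun p => (polyRho F p : ℝ) / p) fun p hp => ?_).trans ?_
    · rw [polyRho_integralNormalization_of_rough hF.ne_zero hdeg (hprime p hp).pos]
      · simp
      · intro q hq hqp
        rw [(Nat.prime_dvd_prime_iff_eq hq (hprime p hp)).1 hqp]
        have := (mem_prs.1 hp).1.1
        omega
    · rw [← Finset.prod_sdiff (Finset.filter_subset (fun p => ¬ p ∣ m) (prs D v))]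
      refine mul_le_of_le_one_left (Finset.prod_nonneg fun p hp => ?_) (Finset.prod_le_one (fun p hp => ?_) fun p hp => ?_)
      · linarith [(hρ p (Finset.mem_of_mem_filter p hp)).2.2]
      · linarith [(hρ p (Finset.mem_sdiff.1 hp).1).2.2]
      · linarith [(hρ p (Finset.mem_sdiff.1 hp).1).1]
  refine le_trans ?_ (hmain.trans (le_of_eq ?_))
  · have h1 : c / 2 * b * (polyRho F m / m) / log v ≤ b * (polyRho F m / m) / 2 * ∏ p ∈ P, (1 - (polyRho F p : ℝ) / p) := by
      calc c / 2 * b * (polyRho F m / m) / log v = b * (polyRho F m / m) / 2 * (c / log v) := by ring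
        _ ≤ _ := by gcongr
    have h2 : ((v : ℝ) + 1) * (v : ℝ) ^ K * ((v : ℝ) ^ K * polyRho F m) = (v + 1) * (v : ℝ) ^ (2 * K) * polyRho F m := by
      rw [two_mul, pow_add]; ring
    rw [h2]
    linarith
  · congr 2
    ext n
    simp only [Finset.mem_filter, and_assoc, hP]
    refine and_congr_right fun _ => and_congr_right fun _ => ?_
    exact ⟨fun h p hp hpm => h p ⟨hp, hpm⟩, fun h p hp => h p hp.1 hp.2⟩

theorem card_le_of_factorization_le {T P : Finset ℕ} {B : ℕ} (h : ∀ n ∈ P, n ≠ 0 ∧ n.primeFactors ⊆ T ∧ ∀ p, n.factorization p ≤ B) :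
    P.card ≤ (B + 1) ^ T.card := by
  have h1 : (T.pi fun _ => Finset.range (B + 1)).card = (B + 1) ^ T.card := by simp [Finset.card_pi]
  rw [← h1]
  refine Finset.card_le_card_of_injOn (fun n => fun p _ => n.factorization p) ?_ ?_
  · intro n hn
    refine Finset.mem_coe.2 (Finset.mem_pi.2 fun p _ => Finset.mem_range.2 ?_)
    exact Nat.lt_succ_of_le ((h n hn).2.2 p)
  · intro n hn m hm hnm
    refine Nat.eq_of_factorization_eq (h n hn).1 (h m hm).1 fun p => ?_
    by_cases hp : p ∈ T
    · exact congrFun (congrFun hnm p) hp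
    · rw [Finsupp.notMem_support_iff.1 fun h' => hp ((h n hn).2.1 (Nat.support_factorization n ▸ h')),
        Finsupp.notMem_support_iff.1 fun h' => hp ((h m hm).2.1 (Nat.support_factorization m ▸ h'))]

theorem card_primes_le_of_dvd {T : Finset ℕ} {N : ℤ} (hN : N ≠ 0) {r : ℝ} (hr : 1 < r) {t : ℕ}
    (hT : ∀ p ∈ T, p.Prime ∧ r ≤ p ∧ (p : ℤ) ∣ N) (hNt : |(N : ℝ)| ≤ r ^ t) : T.card ≤ t := by
  have h1 := (prod_primes_dvd_iff T (fun p hp => (hT p hp).1) N).2 fun p hp => (hT p hp).2.2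
  have h2 : ((∏ p ∈ T, p : ℕ) : ℤ) ≤ |N| := Int.le_of_dvd (abs_pos.2 hN) ((dvd_abs _ _).2 h1)
  have h3 : ((∏ p ∈ T, p : ℕ) : ℝ) ≤ |(N : ℝ)| := by exact_mod_cast h2
  have h4 : r ^ T.card ≤ ((∏ p ∈ T, p : ℕ) : ℝ) := by
    push_cast
    calc r ^ T.card = ∏ _p ∈ T, r := by simp
      _ ≤ _ := Finset.prod_le_prod (fun _ _ => by linarith) fun p hp => (hT p hp).2.1
  exact (pow_le_pow_iff_right₀ hr).1 (h4.trans (h3.trans hNt))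

theorem card_pairs_le {N : ℤ} (hN : N ≠ 0) {D w v Z B t : ℕ} {r : ℝ} (hr : 1 < r) (hrw : r < w + 1) (hDw : D ≤ w) (hwv : w ≤ v)
    (Q : Finset (Finset ℕ × ℕ))
    (hQ : ∀ q ∈ Q, q.1 ⊆ prs D w ∧ 0 < q.2 ∧ q.2 ≤ Z ∧ (∀ p : ℕ, p.Prime → p ∣ q.2 → w < p) ∧
      ((((∏ p ∈ q.1, p) * q.2 : ℕ) : ℤ) ∣ N) ∧ ∀ p ∈ prs D v, ¬ p ∣ (∏ p ∈ q.1, p) * q.2 → ¬ (p : ℤ) ∣ N)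
    (hZ : (Z : ℝ) ≤ r ^ B) (hcase : |(N : ℝ)| ≤ r ^ t ∨ Z ≤ v) (hBt : B ≤ t) : Q.card ≤ (B + 1) ^ t := by
  have hrp : ∀ p : ℕ, w < p → r ≤ p := fun p hp => by
    have : ((w + 1 : ℕ) : ℝ) ≤ p := by exact_mod_cast hp
    push_cast at this
    linarith
  have hS : ∀ q ∈ Q, q.1 = (prs D w).filter fun p : ℕ => (p : ℤ) ∣ N := by
    intro q hq
    obtain ⟨h1, h2, h3, h4, h5, h6⟩ := hQ q hq
    ext p
    constructor
    · intro hp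
      refine Finset.mem_filter.2 ⟨h1 hp, dvd_trans ?_ h5⟩
      exact_mod_cast (Finset.dvd_prod_of_mem _ hp).trans (dvd_mul_right _ _)
    · intro hp
      obtain ⟨hp1, hp2⟩ := Finset.mem_filter.1 hp
      obtain ⟨⟨hp3, hp4⟩, hpp⟩ := mem_prs.1 hp1
      have h7 : p ∣ (∏ p ∈ q.1, p) * q.2 := by
        by_contra hcon
        exact h6 p (mem_prs.2 ⟨⟨hp3, hp4.trans hwv⟩, hpp⟩) hcon hp2
      rcases hpp.dvd_mul.1 h7 with h8 | h8
      · obtain ⟨p', hp', hpp'⟩ := (hpp.prime.dvd_finsetProd_iff _).1 h8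
        rwa [(Nat.prime_dvd_prime_iff_eq hpp (mem_prs.1 (h1 hp')).2).1 hpp']
      · exact absurd (h4 p hpp h8) (by omega)
  have hinj : Set.InjOn Prod.snd (Q : Set (Finset ℕ × ℕ)) := fun q hq q' hq' h =>
    Prod.ext ((hS q hq).trans (hS q' hq').symm) h
  rw [← Finset.card_image_of_injOn hinj]
  set T := (prs w Z).filter fun p : ℕ => (p : ℤ) ∣ N with hT
  have hTprop : ∀ p ∈ T, p.Prime ∧ r ≤ p ∧ (p : ℤ) ∣ N := fun p hp => by
    obtain ⟨h1, h2⟩ := Finset.mem_filter.1 hp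
    exact ⟨(mem_prs.1 h1).2, hrp p (mem_prs.1 h1).1.1, h2⟩
  have hPbound : ∀ q ∈ Q, ((q.2 : ℕ) : ℝ) ≤ r ^ B := fun q hq => le_trans (by exact_mod_cast (hQ q hq).2.2.1) hZ
  rcases Q.eq_empty_or_nonempty with rfl | ⟨q₀, hq₀⟩
  · simp
  have hTt : T.card ≤ t := by
    rcases hcase with hc | hc
    · exact card_primes_le_of_dvd hN hr hTprop hc
    · obtain ⟨h1, h2, h3, h4, h5, h6⟩ := hQ q₀ hq₀
      refine le_trans (card_primes_le_of_dvd (N := (q₀.2 : ℤ)) (by exact_mod_cast h2.ne') hr (fun p hp => ?_) (t := B) ?_) hBt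
      · refine ⟨(hTprop p hp).1, (hTprop p hp).2.1, ?_⟩
        obtain ⟨⟨hp3, hp4⟩, hpp⟩ := mem_prs.1 (Finset.mem_of_mem_filter p hp)
        have h7 : p ∣ (∏ p ∈ q₀.1, p) * q₀.2 := by
          by_contra hcon
          exact h6 p (mem_prs.2 ⟨⟨by omega, hp4.trans hc⟩, hpp⟩) hcon (hTprop p hp).2.2
        rcases hpp.dvd_mul.1 h7 with h8 | h8
        · obtain ⟨p', hp', hpp'⟩ := (hpp.prime.dvd_finsetProd_iff _).1 h8
          have h9 := mem_prs.1 (h1 hp')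
          rw [← (Nat.prime_dvd_prime_iff_eq hpp h9.2).1 hpp'] at h9
          omega
        · exact_mod_cast h8
      · rw [Int.cast_natCast, Nat.abs_cast]
        exact hPbound q₀ hq₀
  refine (card_le_of_factorization_le (T := T) (B := B) fun P hP => ?_).trans (pow_le_pow_right₀ (by omega) hTt)
  obtain ⟨q, hq, rfl⟩ := Finset.mem_image.1 hP
  obtain ⟨h1, h2, h3, h4, h5, h6⟩ := hQ q hq
  refine ⟨h2.ne', fun p hp => ?_, fun p => ?_⟩
  · have hpp := Nat.prime_of_mem_primeFactors hp
    have hpd := Nat.dvd_of_mem_primeFactors hp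
    refine Finset.mem_filter.2 ⟨mem_prs.2 ⟨⟨h4 p hpp hpd, (Nat.le_of_dvd h2 hpd).trans h3⟩, hpp⟩, dvd_trans ?_ h5⟩
    exact_mod_cast hpd.trans (dvd_mul_left _ _)
  · by_cases hpf : p ∈ q.2.primeFactors
    · have hpp := Nat.prime_of_mem_primeFactors hpf
      have hpd := Nat.dvd_of_mem_primeFactors hpf
      have h7 : p ^ q.2.factorization p ≤ q.2 := Nat.le_of_dvd h2 (Nat.ordProj_dvd _ _)
      have h8 : r ^ q.2.factorization p ≤ r ^ B := by
        calc r ^ q.2.factorization p ≤ (p : ℝ) ^ q.2.factorization p := by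
              gcongr; exact hrp p (h4 p hpp hpd)
          _ ≤ q.2 := by exact_mod_cast h7
          _ ≤ _ := hPbound q hq
      exact (pow_le_pow_iff_right₀ hr).1 h8
    · rw [Finsupp.notMem_support_iff.1 fun h' => hpf (Nat.support_factorization _ ▸ h')]
      exact Nat.zero_le _

theorem eval_ne_zero_of_irreducible {F : Polynomial ℤ} (hF : Irreducible F) (hdeg : 2 ≤ F.natDegree) (n : ℤ) : F.eval n ≠ 0 := by
  intro h
  obtain ⟨q, hq⟩ := Polynomial.dvd_iff_isRoot.2 h
  rcases hF.isUnit_or_isUnit hq with hu | hu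
  · exact Polynomial.not_isUnit_X_sub_C n hu
  · have h1 : F.natDegree ≤ (Polynomial.X - Polynomial.C n).natDegree + q.natDegree := by
      conv_lhs => rw [hq]
      exact Polynomial.natDegree_mul_le
    rw [Polynomial.natDegree_X_sub_C, Polynomial.natDegree_eq_zero_of_isUnit hu] at h1
    omega

theorem exists_abs_eval_le (F : Polynomial ℤ) : ∃ c : ℝ, ∀ n : ℕ, 1 ≤ n → |((F.eval (n : ℤ) : ℤ) : ℝ)| ≤ c * (n : ℝ) ^ F.natDegree := by
  refine ⟨∑ i ∈ Finset.range (F.natDegree + 1), |(F.coeff i : ℝ)|, fun n hn => ?_⟩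
  have hn' : (1 : ℝ) ≤ n := by exact_mod_cast hn
  rw [Polynomial.eval_eq_sum_range, Finset.sum_mul]
  push_cast
  refine (Finset.abs_sum_le_sum_abs _ _).trans (Finset.sum_le_sum fun i hi => ?_)
  rw [abs_mul, abs_of_nonneg (by positivity : (0 : ℝ) ≤ (n : ℝ) ^ i)]
  gcongr
  exact Nat.lt_succ_iff.1 (Finset.mem_range.1 hi)

theorem sum_le_mul_card {F : Polynomial ℤ} (hF : Irreducible F) (hdeg : 2 ≤ F.natDegree) {D w v B t : ℕ} {x y z r κ : ℝ}
    (hx : 0 ≤ x) (hz : 0 ≤ z) (hr : 1 < r) (hrw : r < w + 1) (hDw : D ≤ w) (hwv : w ≤ v)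
    (𝒮 : Finset (Finset ℕ)) (h𝒮 : ∀ S ∈ 𝒮, S ⊆ prs D w) (hzB : z ≤ r ^ B) (hBt : B ≤ t)
    (hcase : (∀ n : ℕ, 1 ≤ n → (n : ℝ) ≤ x → |((F.eval (n : ℤ) : ℤ) : ℝ)| ≤ r ^ t) ∨ ⌊z⌋₊ ≤ v)
    (hcount : ∀ S ∈ 𝒮, ∀ P ∈ roughCofactors (∏ p ∈ S, p) w y z,
      κ * ((polyRho F ((∏ p ∈ S, p) * P) : ℝ) / (((∏ p ∈ S, p) * P : ℕ) : ℝ)) ≤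
        (((Finset.Ioc ⌊x / 2⌋₊ ⌊x⌋₊).filter fun n : ℕ => (((∏ p ∈ S, p) * P : ℕ) : ℤ) ∣ F.eval (n : ℤ) ∧
          ∀ p ∈ prs D v, ¬ p ∣ (∏ p ∈ S, p) * P → ¬ (p : ℤ) ∣ F.eval (n : ℤ)).card : ℝ)) :
    κ * ∑ S ∈ 𝒮, (polyRho F (∏ p ∈ S, p) : ℝ) / ((∏ p ∈ S, p : ℕ) : ℝ) *
        ∑ P ∈ roughCofactors (∏ p ∈ S, p) w y z, (polyRho F P : ℝ) / P ≤
      (B + 1) ^ t * ((polyH F x y z : ℝ) - (polyH F (x / 2) y z : ℝ)) := by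
  rw [polyH_sub_half F hx]
  set 𝒩 := (Finset.Ioc ⌊x / 2⌋₊ ⌊x⌋₊).filter fun n : ℕ =>
      ∃ d : ℕ, 0 < d ∧ (d : ℤ) ∣ F.eval (n : ℤ) ∧ y < (d : ℝ) ∧ (d : ℝ) ≤ z with h𝒩
  set R : Finset ℕ × ℕ → ℕ → Prop := fun q n => ((((∏ p ∈ q.1, p) * q.2 : ℕ) : ℤ) ∣ F.eval (n : ℤ)) ∧
          ∀ p ∈ prs D v, ¬ p ∣ (∏ p ∈ q.1, p) * q.2 → ¬ (p : ℤ) ∣ F.eval (n : ℤ) with hR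
  set 𝒬 : Finset (Finset ℕ × ℕ) := 𝒮.biUnion fun S => (roughCofactors (∏ p ∈ S, p) w y z).image fun P => (S, P) with h𝒬
  have hmem : ∀ q ∈ 𝒬, q.1 ∈ 𝒮 ∧ q.2 ∈ roughCofactors (∏ p ∈ q.1, p) w y z := by
    intro q hq
    obtain ⟨S, hS, hq⟩ := Finset.mem_biUnion.1 hq
    obtain ⟨P, hP, rfl⟩ := Finset.mem_image.1 hq
    exact ⟨hS, hP⟩
  have hprime : ∀ S ∈ 𝒮, ∀ p ∈ S, p.Prime := fun S hS p hp => (mem_prs.1 (h𝒮 S hS hp)).2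
  have hsum : ∀ f : Finset ℕ × ℕ → ℝ, ∑ q ∈ 𝒬, f q = ∑ S ∈ 𝒮, ∑ P ∈ roughCofactors (∏ p ∈ S, p) w y z, f (S, P) := by
    intro f
    rw [h𝒬, Finset.sum_biUnion]
    · refine Finset.sum_congr rfl fun S _ => Finset.sum_image fun P _ P' _ h => (Prod.mk.inj h).2
    · intro S _ S' _ hSS'
      refine Finset.disjoint_left.2 fun q hq hq' => hSS' ?_
      obtain ⟨P, -, rfl⟩ := Finset.mem_image.1 hq
      obtain ⟨P', -, h⟩ := Finset.mem_image.1 hq'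
      exact (Prod.mk.inj h).1.symm
  have hlow : κ * ∑ S ∈ 𝒮, (polyRho F (∏ p ∈ S, p) : ℝ) / ((∏ p ∈ S, p : ℕ) : ℝ) *
        ∑ P ∈ roughCofactors (∏ p ∈ S, p) w y z, (polyRho F P : ℝ) / P ≤ ∑ q ∈ 𝒬, ((𝒩.filter fun n => R q n).card : ℝ) := by
    rw [hsum, Finset.mul_sum]
    refine Finset.sum_le_sum fun S hS => ?_
    rw [Finset.mul_sum, Finset.mul_sum]
    refine Finset.sum_le_sum fun P hP => ?_
    obtain ⟨hP1, hP2, d, hd, hd1, hd2⟩ := Finset.mem_filter.1 hP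
    have hP0 : 0 < P := (Finset.mem_Icc.1 hP1).1
    have ha0 : 0 < ∏ p ∈ S, p := Finset.prod_pos fun p hp => (hprime S hS p hp).pos
    have hcop : Nat.Coprime (∏ p ∈ S, p) P := Nat.Coprime.prod_left fun p hp =>
      (Nat.Prime.coprime_iff_not_dvd (hprime S hS p hp)).2 fun hpP => by
        have h1 := hP2 p (hprime S hS p hp) hpP
        have h2 := (mem_prs.1 (h𝒮 S hS hp)).1.2
        omega
    have h1 := hcount S hS P hP
    rw [polyRho_mul F ha0 hP0 hcop] at h1
    refine le_trans (le_of_eq ?_) (h1.trans ?_)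
    · push_cast; ring
    · refine Nat.cast_le.2 (Finset.card_le_card fun n hn => ?_)
      have hn' := (@Finset.mem_filter _ _ (_) _ _).1 hn
      refine Finset.mem_filter.2 ⟨Finset.mem_filter.2 ⟨hn'.1, d * P, ?_, ?_, hd1, hd2⟩, hn'.2⟩
      · exact Nat.mul_pos (Nat.pos_of_dvd_of_pos hd ha0) hP0
      · exact dvd_trans (by exact_mod_cast Nat.mul_dvd_mul hd dvd_rfl) hn'.2.1
  refine hlow.trans ?_
  have hswap := Finset.sum_card_bipartiteAbove_eq_sum_card_bipartiteBelow (s := 𝒬) (t := 𝒩) R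
  have hmult : ∀ n ∈ 𝒩, (𝒬.bipartiteBelow R n).card ≤ (B + 1) ^ t := by
    intro n hn
    have hn1 := Finset.mem_Ioc.1 (Finset.mem_filter.1 hn).1
    have hn0 : 1 ≤ n := by omega
    have hnx : (n : ℝ) ≤ x := (Nat.le_floor_iff hx).1 hn1.2
    refine card_pairs_le (Z := ⌊z⌋₊) (eval_ne_zero_of_irreducible hF hdeg (n : ℤ)) hr hrw hDw hwv _ (fun q hq => ?_)
      ((Nat.floor_le hz).trans hzB) (hcase.imp_left fun h => h n hn0 hnx) hBt
    obtain ⟨hq1, hq2⟩ := (Finset.mem_bipartiteBelow R).1 hq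
    obtain ⟨h1, h2⟩ := hmem q hq1
    obtain ⟨h3, h4, -⟩ := Finset.mem_filter.1 h2
    exact ⟨h𝒮 _ h1, (Finset.mem_Icc.1 h3).1, (Finset.mem_Icc.1 h3).2, h4, hq2.1, hq2.2⟩
  have h1 : ∑ q ∈ 𝒬, ((𝒩.filter fun n => R q n).card : ℝ) = ((∑ n ∈ 𝒩, (𝒬.bipartiteBelow R n).card : ℕ) : ℝ) := by
    rw [← hswap]
    push_cast
    rfl
  rw [h1]
  have h2 : ∑ n ∈ 𝒩, (𝒬.bipartiteBelow R n).card ≤ 𝒩.card * (B + 1) ^ t := by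
    rw [← smul_eq_mul]; exact Finset.sum_le_card_nsmul _ _ _ hmult
  calc ((∑ n ∈ 𝒩, (𝒬.bipartiteBelow R n).card : ℕ) : ℝ) ≤ ((𝒩.card * (B + 1) ^ t : ℕ) : ℝ) := Nat.cast_le.2 h2
    _ = _ := by push_cast; ring

theorem sieve_error_le {K v : ℕ} {δ c x m L : ℝ} (hδ : 0 < δ) (hc : 0 < c) (hx : 1 < x) (hv : 2 ≤ v)
    (hvx : (v : ℝ) ≤ x ^ (δ / (8 * (K + 3)))) (hxc : 8 / c ≤ x ^ (δ / 8)) (hm : 0 < m) (hmx : m ≤ x ^ (1 - δ / 4))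
    (hL : log v ≤ 2 * L) {b ρ : ℝ} (hb : x / 4 ≤ b) (hρ : 0 ≤ ρ) :
    c * x / (16 * L) * (ρ / m) ≤ c * b * (ρ / m) / log v - (v + 1) * (v : ℝ) ^ K * ρ := by
  have hv' : (2 : ℝ) ≤ v := by exact_mod_cast hv
  have hx0 : 0 < x := by linarith
  have hlv : 0 < log v := log_pos (by linarith)
  have h1 : (v + 1) * (v : ℝ) ^ K * log v ≤ x ^ (δ / 8) := by
    have h2 : log v ≤ v := (log_le_sub_one_of_pos (by linarith)).trans (by linarith)
    calc (v + 1) * (v : ℝ) ^ K * log v ≤ (v * v) * (v : ℝ) ^ K * v := by gcongr; nlinarith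
      _ = (v : ℝ) ^ (K + 3) := by ring
      _ ≤ (x ^ (δ / (8 * (K + 3)))) ^ (K + 3) := by gcongr
      _ = x ^ (δ / 8) := by
          rw [← rpow_natCast, ← rpow_mul hx0.le]; congr 1; push_cast; field_simp
  have h2 : (v + 1) * (v : ℝ) ^ K * log v * m ≤ c * x / 8 := by
    have h3 : x ^ (δ / 8) * x ^ (1 - δ / 4) * x ^ (δ / 8) = x := by
      rw [← rpow_add hx0, ← rpow_add hx0]; convert rpow_one x using 2; ring
    have h4 : 0 < x ^ (δ / 8) := by positivity
    rw [div_le_iff₀ hc] at hxc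
    calc (v + 1) * (v : ℝ) ^ K * log v * m ≤ x ^ (δ / 8) * x ^ (1 - δ / 4) := by gcongr
      _ = x ^ (δ / 8) * x ^ (1 - δ / 4) * 8 / 8 := by ring
      _ ≤ x ^ (δ / 8) * x ^ (1 - δ / 4) * (x ^ (δ / 8) * c) / 8 := by gcongr
      _ = c * (x ^ (δ / 8) * x ^ (1 - δ / 4) * x ^ (δ / 8)) / 8 := by ring
      _ = c * x / 8 := by rw [h3]
  have hL0 : 0 < L := by linarith
  have h5 : c * x / (16 * L) ≤ c * x / 8 / log v := by
    rw [div_div]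
    exact div_le_div_of_nonneg_left (by positivity) (by positivity) (by linarith)
  have h6 : c * x / 8 / log v + (v + 1) * (v : ℝ) ^ K * m ≤ c * b / log v := by
    rw [le_div_iff₀ hlv, add_mul, div_mul_cancel₀ _ hlv.ne']
    nlinarith
  have h7 : c * x / (16 * L) + (v + 1) * (v : ℝ) ^ K * m ≤ c * b / log v := by linarith
  have h8 := mul_le_mul_of_nonneg_right h7 (by positivity : 0 ≤ ρ / m)
  have h9 : (v + 1) * (v : ℝ) ^ K * m * (ρ / m) = (v + 1) * (v : ℝ) ^ K * ρ := by field_simp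
  have h10 : c * b * (ρ / m) / log v = c * b / log v * (ρ / m) := by ring
  rw [h10]
  linarith

theorem quarter_le_floor_sub {x : ℝ} (hx : 4 ≤ x) : x / 4 ≤ ((⌊x⌋₊ - ⌊x / 2⌋₊ : ℕ) : ℝ) := by
  have h1 : ⌊x / 2⌋₊ ≤ ⌊x⌋₊ := Nat.floor_mono (by linarith)
  rw [Nat.cast_sub h1]
  have h2 := Nat.lt_floor_add_one x
  have h3 := Nat.floor_le (by linarith : 0 ≤ x / 2)
  linarith

theorem pos_of_le_rpow {x z s : ℝ} (hs : 1 / 2 < s) (hs1 : s < 1) (hz : 0 < z) (h : z ≤ x ^ s) : 0 < x := by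
  by_contra hx
  rcases (not_lt.1 hx).lt_or_eq with hx | rfl
  · rw [rpow_def_of_neg hx] at h
    have h1 : cos (s * π) < 0 := cos_neg_of_pi_div_two_lt_of_lt (by nlinarith [pi_pos]) (by nlinarith [pi_pos])
    have h2 := exp_pos (log x * s)
    nlinarith
  · rw [zero_rpow (by linarith)] at h
    linarith

/-- The comparison of the main sum with the sum restricted to smooth, small `a`. -/
theorem tsum_le_sum_small {F : Polynomial ℤ} (hF : F ≠ 0) {D w : ℕ} (hD : F.leadingCoeff.natAbs ≤ D) (hD1 : 1 ≤ D)
    (hDw : D ≤ w) (η : ℝ) {e y z Y : ℝ} (he : 0 < e) (hy : 1 < y) (hz2 : 2 ≤ z) (hzy : z ≤ y ^ 2) (hwz : w ≤ ⌊z⌋₊) (hw : y ^ e < w + 1) (hY : 1 < Y)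
    (hwY : 2 * F.natDegree * (log w + log 4) ≤ log Y / 2) :
    ∑' a : (Psf D z), Lfun a η * (polyRho F a : ℝ) / (a : ℝ) ≤
      2 * exp (6 * F.natDegree * (2 / e)) *
        ∑ S ∈ (prs D w).powerset.filter (fun S => ((∏ p ∈ S, p : ℕ) : ℝ) ≤ Y), weight F η (∏ p ∈ S, p) := by
  have hz0 : 0 ≤ z := by linarith
  have h2 : 2 ≤ ⌊z⌋₊ := Nat.le_floor (by exact_mod_cast hz2)
  refine (tsum_Psf_eq D hz0 fun a => weight F η a).trans_le (sum_weight_le hF hD hD1 hDw hwz η h2 ?_ hY hwY)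
  have h3 : (0 : ℝ) < ⌊z⌋₊ := by positivity
  have h4 : log (⌊z⌋₊ : ℝ) ≤ 2 * log y := by
    rw [show 2 * log y = log (y ^ 2) by rw [log_pow]; norm_num]
    exact log_le_log h3 ((Nat.floor_le hz0).trans hzy)
  have h5 : e * log y ≤ log (w + 1 : ℕ) := by
    rw [← log_rpow (by linarith)]
    push_cast
    exact log_le_log (by positivity) hw.le
  calc log (⌊z⌋₊ : ℝ) ≤ 2 / e * (e * log y) := by rw [← mul_assoc, div_mul_cancel₀ _ he.ne']; exact h4
    _ ≤ _ := by gcongr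

theorem exists_sieve_level {F : Polynomial ℤ} {A θ e M x y z : ℝ} {t : ℕ} (hM : ∀ n : ℕ, 1 ≤ n → |((F.eval (n : ℤ) : ℤ) : ℝ)| ≤ M * (n : ℝ) ^ F.natDegree)
    (hy : 1 < y) (hMy : M ≤ y) (hyx : y ≤ x) (hyz : y < z) (hzy : z ≤ y ^ 2) (heθ : e ≤ θ) (he1 : e ≤ 1) (hθ : 0 < θ) (hA : A = 2 / θ)
    (ht : A * (F.natDegree + 1) ≤ e * t) :
    ∃ v : ℕ, ⌊y ^ e⌋₊ ≤ v ∧ (v : ℝ) ≤ x ^ θ ∧ (v : ℝ) ≤ y ^ 2 ∧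
      ((∀ n : ℕ, 1 ≤ n → (n : ℝ) ≤ x → |((F.eval (n : ℤ) : ℤ) : ℝ)| ≤ (y ^ e) ^ t) ∨ ⌊z⌋₊ ≤ v) := by
  have hy0 : 0 < y := by linarith
  have hx0 : 0 < x := by linarith
  have hye : y ^ e ≤ y := by
    conv_rhs => rw [← rpow_one y]
    exact rpow_le_rpow_of_exponent_le hy.le he1
  have hw : (⌊y ^ e⌋₊ : ℝ) ≤ y ^ e := Nat.floor_le (by positivity)
  rcases le_or_gt x (y ^ A) with hxy | hxy
  · refine ⟨⌊y ^ e⌋₊, le_rfl, ?_, ?_, Or.inl fun n hn hnx => ?_⟩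
    · calc (⌊y ^ e⌋₊ : ℝ) ≤ y ^ θ := hw.trans (rpow_le_rpow_of_exponent_le hy.le heθ)
        _ ≤ x ^ θ := by gcongr
    · nlinarith
    · calc |((F.eval (n : ℤ) : ℤ) : ℝ)| ≤ M * (n : ℝ) ^ F.natDegree := hM n hn
        _ ≤ x * x ^ F.natDegree := by gcongr; linarith
        _ = x ^ (F.natDegree + 1) := by ring
        _ ≤ (y ^ A) ^ (F.natDegree + 1) := by gcongr
        _ = y ^ (A * (F.natDegree + 1)) := by rw [← rpow_natCast, ← rpow_mul hy0.le]; push_cast; rfl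
        _ ≤ y ^ (e * t) := rpow_le_rpow_of_exponent_le hy.le ht
        _ = _ := by rw [← rpow_natCast, ← rpow_mul hy0.le]
  · have hz0 : (⌊z⌋₊ : ℝ) ≤ y ^ 2 := (Nat.floor_le (by linarith)).trans hzy
    refine ⟨⌊z⌋₊, Nat.floor_mono (by linarith), ?_, hz0, Or.inr le_rfl⟩
    calc (⌊z⌋₊ : ℝ) ≤ y ^ 2 := hz0
      _ = (y ^ A) ^ θ := by
          rw [← rpow_mul hy0.le, hA, div_mul_cancel₀ _ hθ.ne']; norm_num
      _ ≤ x ^ θ := by gcongr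

set_option maxHeartbeats 1000000 in
theorem stmt6 (F : Polynomial ℤ) (hF : Irreducible F) (hdeg : 2 ≤ F.natDegree)
    (δ C : ℝ) (hδ0 : 0 < δ) (hδ1 : δ < 1) (hC : 0 < C) :
    ∃ D y₀ c : ℝ, 2 ≤ D ∧ 0 < c ∧
      ∀ x y z : ℝ, y₀ ≤ y → y < z → z ≤ x ^ (1 - δ / 2) →
        (Real.log y) ^ (-C) ≤ Real.log (z / y) → Real.log (z / y) ≤ Real.log y →
        c * (x / (Real.log y) ^ 2) *
            ∑' a : (Psf D z), Lfun a (Real.log (z / y)) * (polyRho F a : ℝ) / (a : ℝ) ≤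
          (polyH F x y z : ℝ) - (polyH F (x / 2) y z : ℝ) := by
  have hdeg1 : 1 ≤ F.natDegree := by omega
  obtain ⟨D₁, K, c₁, hc₁, hsieve⟩ := sieve_multiples hF hdeg1
  obtain ⟨ε₀, hε₀, hL⟩ := Lfun_le_sum_roughCofactors (Polynomial.monic_integralNormalization hF.ne_zero)
    (irreducible_integralNormalization hF hdeg1) (by rw [Polynomial.natDegree_integralNormalization]; exact hdeg) hC
  obtain ⟨M, hM⟩ := exists_abs_eval_le F
  set θ : ℝ := δ / (8 * (K + 3)) with hθ
  set g : ℝ := (F.natDegree : ℝ) with hg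
  have hg2 : (2 : ℝ) ≤ g := by rw [hg]; exact_mod_cast hdeg
  have hθ0 : 0 < θ := by positivity
  set e : ℝ := min ε₀ (min θ (δ / (32 * g))) with he
  have he0 : 0 < e := by rw [he]; positivity
  have heε : e ≤ ε₀ := min_le_left _ _
  have heθ : e ≤ θ := (min_le_right _ _).trans (min_le_left _ _)
  have heδ : e ≤ δ / (32 * g) := (min_le_right _ _).trans (min_le_right _ _)
  have heδ' : 32 * g * e ≤ δ := by rwa [le_div_iff₀' (by positivity)] at heδ
  have he1 : e ≤ 1 := by nlinarith
  obtain ⟨c₂, y₁, hc₂, hL⟩ := hL e he0 heε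
  set D : ℕ := max D₁ (F.leadingCoeff.natAbs + 2) with hD
  have hDD₁ : D₁ ≤ D := le_max_left _ _
  have hDl : F.leadingCoeff.natAbs + 2 ≤ D := le_max_right _ _
  set B : ℕ := ⌈2 / e⌉₊ with hB
  set t : ℕ := max B ⌈2 / θ * (g + 1) / e⌉₊ with ht
  have hev : ∀ᶠ y : ℝ in Filter.atTop, y₁ ≤ y ∧ 4 ≤ y ∧ M ≤ y ∧ (D : ℝ) + 1 ≤ y ^ e ∧ 8 / c₁ ≤ y ^ (δ / 8) ∧
      32 * g * log 4 / δ ≤ log y := by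
    filter_upwards [Filter.eventually_ge_atTop y₁, Filter.eventually_ge_atTop 4, Filter.eventually_ge_atTop M,
      (tendsto_rpow_atTop he0).eventually_ge_atTop ((D : ℝ) + 1),
      (tendsto_rpow_atTop (by positivity : 0 < δ / 8)).eventually_ge_atTop (8 / c₁),
      tendsto_log_atTop.eventually_ge_atTop (32 * g * log 4 / δ)] with y h1 h2 h3 h4 h5 h6
    exact ⟨h1, h2, h3, h4, h5, h6⟩
  obtain ⟨y₀, hev⟩ := Filter.eventually_atTop.1 hev
  set E : ℝ := 2 * exp (6 * g * (2 / e)) with hE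
  have hE0 : 0 < E := by positivity
  refine ⟨D, y₀, c₁ * c₂ / (16 * E * (B + 1) ^ t), by exact_mod_cast (by omega : 2 ≤ D), by positivity,
    fun x y z hy hyz hzx hη hη' => ?_⟩
  obtain ⟨hy₁, hy4, hMy, hyD, hyc, hylog⟩ := hev y hy
  have hy0 : 0 < y := by linarith
  have hy1 : 1 < y := by linarith
  have hz0 : 0 < z := by linarith
  have hx0 : 0 < x := pos_of_le_rpow (s := 1 - δ / 2) (by linarith) (by linarith) hz0 hzx
  have hx1 : 1 < x := by
    by_contra h
    have := rpow_le_one hx0.le (not_lt.1 h) (by linarith : 0 ≤ 1 - δ / 2)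
    linarith
  have hzx' : z ≤ x := hzx.trans (by
    conv_rhs => rw [← rpow_one x]
    exact rpow_le_rpow_of_exponent_le hx1.le (by linarith))
  have hlogy : 0 < log y := log_pos hy1
  have hzy : z ≤ y ^ 2 := by
    rw [log_le_log_iff (by positivity) hy0, div_le_iff₀ hy0] at hη'
    nlinarith
  set w := ⌊y ^ e⌋₊ with hw
  have hrw : y ^ e < w + 1 := Nat.lt_floor_add_one _
  have hwr : (w : ℝ) ≤ y ^ e := Nat.floor_le (by positivity)
  have hDw : D ≤ w := Nat.le_floor (by linarith)
  have hr1 : 1 < y ^ e := one_lt_rpow hy1 he0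
  have hye : y ^ e ≤ y := by
    conv_rhs => rw [← rpow_one y]
    exact rpow_le_rpow_of_exponent_le hy1.le he1
  have het : 2 / θ * (g + 1) ≤ e * t := by
    rw [← div_le_iff₀' he0]
    exact (Nat.le_ceil _).trans (by exact_mod_cast le_max_right _ _)
  obtain ⟨v, hwv, hvx, hvy, hcase⟩ := exists_sieve_level hM hy1 hMy (hyz.le.trans hzx') hyz hzy heθ he1 hθ0 rfl het
  set Y := y ^ (δ / 4) with hY
  set η := log (z / y) with hηdef
  set 𝒮 := (prs D w).powerset.filter (fun S => ((∏ p ∈ S, p : ℕ) : ℝ) ≤ Y) with h𝒮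
  have hmem : ∀ S ∈ 𝒮, S ⊆ prs D w ∧ ((∏ p ∈ S, p : ℕ) : ℝ) ≤ Y ∧ 0 < ∏ p ∈ S, p := fun S hS => by
    obtain ⟨h1, h2⟩ := Finset.mem_filter.1 hS
    have h1 := Finset.mem_powerset.1 h1
    exact ⟨h1, h2, Finset.prod_pos fun p hp => (mem_prs.1 (h1 hp)).2.pos⟩
  have hYx : Y * z ≤ x ^ (1 - δ / 4) := by
    calc Y * z ≤ x ^ (δ / 4) * x ^ (1 - δ / 2) := by rw [hY]; gcongr; linarith
      _ = _ := by rw [← rpow_add hx0]; congr 1; ring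
  have hzB : z ≤ (y ^ e) ^ B := by
    refine hzy.trans ?_
    rw [← rpow_natCast (y ^ e), ← rpow_mul hy0.le, ← rpow_natCast]
    refine rpow_le_rpow_of_exponent_le hy1.le ?_
    rw [← div_le_iff₀' he0]
    exact_mod_cast Nat.le_ceil (2 / e)
  have hfloor : ⌊x / 2⌋₊ + (⌊x⌋₊ - ⌊x / 2⌋₊) = ⌊x⌋₊ := Nat.add_sub_of_le (Nat.floor_mono (by linarith))
  have hmain := sum_le_mul_card hF hdeg (κ := c₁ * x / (16 * log y)) (y := y) hx0.le hz0.le hr1 hrw hDw hwv 𝒮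
    (fun S hS => (hmem S hS).1) hzB (le_max_left _ _ : B ≤ t) hcase (fun S hS P hP => by
      obtain ⟨-, h2, h3⟩ := hmem S hS
      obtain ⟨hP1, hP2⟩ := Finset.mem_Icc.1 (Finset.mem_filter.1 hP).1
      have hPz : (P : ℝ) ≤ z := (Nat.le_floor_iff hz0.le).1 hP2
      have hm : 0 < (∏ p ∈ S, p) * P := Nat.mul_pos h3 hP1
      have hv2 : 2 ≤ v := by omega
      have h4 := hsieve D v hDD₁ hv2 ⌊x / 2⌋₊ (⌊x⌋₊ - ⌊x / 2⌋₊) _ hm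
      rw [hfloor] at h4
      refine (sieve_error_le hδ0 hc₁ hx1 hv2 hvx (hyc.trans (by gcongr; linarith)) (by exact_mod_cast hm) ?_ ?_
        (quarter_le_floor_sub (by linarith)) (by positivity)).trans h4
      · push_cast
        push_cast at h2
        refine le_trans ?_ hYx
        gcongr
      · rw [show 2 * log y = log (y ^ 2) by rw [log_pow]; norm_num]
        exact log_le_log (by positivity) hvy)
  have hY1 : 1 < Y := one_lt_rpow hy1 (by positivity)
  have hw0 : (0 : ℝ) < w := by exact_mod_cast (by omega : 0 < w)
  have hwY : 2 * F.natDegree * (log w + log 4) ≤ log Y / 2 := by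
    have h1 : log w ≤ e * log y := by
      rw [← log_rpow hy0]; exact log_le_log hw0 hwr
    rw [hY, log_rpow hy0]
    rw [div_le_iff₀ hδ0] at hylog
    rw [← hg]
    have h2 := mul_le_mul_of_nonneg_left h1 (by linarith : 0 ≤ 2 * g)
    have h3 := mul_le_mul_of_nonneg_right heδ' hlogy.le
    linarith
  have hsum := tsum_le_sum_small hF.ne_zero (by omega : F.leadingCoeff.natAbs ≤ D) (by omega) hDw η he0 hy1 (by linarith) hzy
    (Nat.floor_mono (by linarith)) hrw hY1 hwY
  have hinner : c₂ / log y * ∑ S ∈ 𝒮, weight F η (∏ p ∈ S, p) ≤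
      ∑ S ∈ 𝒮, (polyRho F (∏ p ∈ S, p) : ℝ) / ((∏ p ∈ S, p : ℕ) : ℝ) *
        ∑ P ∈ roughCofactors (∏ p ∈ S, p) w y z, (polyRho F P : ℝ) / P := by
    rw [Finset.mul_sum]
    refine Finset.sum_le_sum fun S hS => ?_
    obtain ⟨-, h2, h3⟩ := hmem S hS
    have h4 := hL y z hy₁ hη hyz _ h3 (h2.trans (rpow_le_rpow_of_exponent_le hy1.le (by linarith)))
    have h5 : ∑ P ∈ roughCofactors (∏ p ∈ S, p) w y z, (polyRho F.integralNormalization P : ℝ) / P =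
        ∑ P ∈ roughCofactors (∏ p ∈ S, p) w y z, (polyRho F P : ℝ) / P := by
      refine Finset.sum_congr rfl fun P hP => ?_
      obtain ⟨hP1, hP2, -⟩ := Finset.mem_filter.1 hP
      rw [polyRho_integralNormalization_of_rough hF.ne_zero hdeg1 (Finset.mem_Icc.1 hP1).1 fun p hp hpP => by
        have := hP2 p hp hpP
        omega]
    rw [h5] at h4
    refine le_trans (le_of_eq ?_) (mul_le_mul_of_nonneg_left h4
      (by positivity : 0 ≤ (polyRho F (∏ p ∈ S, p) : ℝ) / ((∏ p ∈ S, p : ℕ) : ℝ)))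
    unfold weight
    ring
  set W := ∑ S ∈ 𝒮, weight F η (∏ p ∈ S, p) with hW
  set T := ∑' a : (Psf D z), Lfun a η * (polyRho F a : ℝ) / (a : ℝ) with hT
  have hB0 : (0 : ℝ) < (B + 1) ^ t := by positivity
  rw [← mul_le_mul_iff_right₀ hB0]
  refine le_trans ?_ hmain
  calc (B + 1 : ℝ) ^ t * (c₁ * c₂ / (16 * E * (B + 1) ^ t) * (x / log y ^ 2) * T)
      = c₁ * x / (16 * log y) * (c₂ / log y * (T / E)) := by field_simp
    _ ≤ c₁ * x / (16 * log y) * (c₂ / log y * W) := by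
        have : T / E ≤ W := by rw [div_le_iff₀' hE0]; exact hsum
        gcongr
    _ ≤ _ := by gcongr
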